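/- Let (a_n)_{n≥1} be a strictly increasing sequence of positive integers. Then for Lebesgue-almost all α ∈ [0,1] there are infinitely many N such that δ_min^α(N) ≤ 1/C_N. (In particular this upper bound depends only on the cardinality C_N of the difference set and is independent of the actual size of the elements a_n.) -/

import Mathlib

open MeasureTheory Filter

/-- Distance to the nearest integer. -/
noncomputable def nint (x : ℝ) : ℝ := |x - round x|

/-- `δ_min^α(N) = min { ‖(a_m - a_n) α‖ : 1 ≤ m, n ≤ N, m ≠ n }`. -/
noncomputable def deltaMin (a : ℕ → ℕ) (α : ℝ) (N : ℕ) : ℝ :=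
  sInf {x : ℝ | ∃ m n : ℕ, 1 ≤ m ∧ m ≤ N ∧ 1 ≤ n ∧ n ≤ N ∧ m ≠ n ∧
    x = nint (((a m : ℝ) - (a n : ℝ)) * α)}

/-- `C_N = #(A_N - A_N)` where `A_N = {a_1, …, a_N}`. -/
noncomputable def diffCard (a : ℕ → ℕ) (N : ℕ) : ℕ :=
  (((Finset.Icc 1 N) ×ˢ (Finset.Icc 1 N)).image
    (fun p : ℕ × ℕ => (a p.1 : ℤ) - (a p.2 : ℤ))).card

/-- `log x`, read as `max {1, log x}`. -/
noncomputable def L (x : ℝ) : ℝ := max 1 (Real.log x)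

/-- `log₂ x = log log x`, with the `max {1, ·}` convention. -/
noncomputable def LL (x : ℝ) : ℝ := L (L x)

/-- Distance between two natural numbers. -/
def gap (i j : ℕ) : ℕ := (i - j) + (j - i)

lemma gap_comm (i j : ℕ) : gap i j = gap j i := by unfold gap; omega

lemma gap_self (i : ℕ) : gap i i = 0 := by unfold gap; omega

lemma sum_pow_succ_le {q : ℝ} (hq : 0 ≤ q) (hq2 : q ≤ 1 / 2) (n : ℕ) :
    ∑ j ∈ Finset.range n, q ^ (j + 1) ≤ 2 * q := by
  have h : (1 - q) * ∑ j ∈ Finset.range n, q ^ j = 1 - q ^ n := mul_neg_geom_sum q n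
  have h2 : 0 ≤ ∑ j ∈ Finset.range n, q ^ j := Finset.sum_nonneg fun _ _ => by positivity
  have h3 : 0 ≤ q ^ n := by positivity
  simp_rw [pow_succ]
  rw [← Finset.sum_mul]
  nlinarith

lemma sum_erase_pow_gap_le {q S : ℝ} (hq : 0 ≤ q)
    (hS : ∀ n, ∑ j ∈ Finset.range n, q ^ (j + 1) ≤ S) (I : Finset ℕ) (i : ℕ) :
    ∑ j ∈ I.erase i, q ^ gap i j ≤ 2 * S := by
  have h1 : ∑ j ∈ (I.erase i).filter (· < i), q ^ gap i j ≤ S := by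
    have hs : (I.erase i).filter (· < i) ⊆ Finset.range i := by
      intro j hj
      simp only [Finset.mem_filter] at hj
      exact Finset.mem_range.2 hj.2
    refine (Finset.sum_le_sum_of_subset_of_nonneg hs fun _ _ _ => by positivity).trans ?_
    rw [← Finset.sum_range_reflect]
    refine le_trans (le_of_eq ?_) (hS i)
    refine Finset.sum_congr rfl fun j hj => ?_
    rw [Finset.mem_range] at hj
    congr 1
    unfold gap; omega
  have h2 : ∑ j ∈ (I.erase i).filter (fun j => ¬ j < i), q ^ gap i j ≤ S := by
    have hs : (I.erase i).filter (fun j => ¬ j < i) ⊆ Finset.Ico (i + 1) (I.sup id + 1) := by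
      intro j hj
      simp only [Finset.mem_filter, Finset.mem_erase] at hj
      have : j ≤ I.sup id := Finset.le_sup (f := id) hj.1.2
      exact Finset.mem_Ico.2 (by omega)
    refine (Finset.sum_le_sum_of_subset_of_nonneg hs fun _ _ _ => by positivity).trans ?_
    rw [Finset.sum_Ico_eq_sum_range]
    refine le_trans (le_of_eq ?_) (hS (I.sup id + 1 - (i + 1)))
    refine Finset.sum_congr rfl fun j hj => ?_
    congr 1
    unfold gap; omega
  rw [← Finset.sum_filter_add_sum_filter_not _ (· < i)]
  linarith

lemma four_mul_pow_three_le {a : ℝ} : 4 * a ^ 3 ≤ 3 * a ^ 4 + 1 := by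
  nlinarith [mul_nonneg (sq_nonneg (a - 1)) (add_nonneg (sq_nonneg (a + 1 / 3)) (sq_nonneg a)),
    sq_nonneg (a - 1), sq_nonneg (a * (a - 1)), sq_nonneg ((a - 1) * (3 * a + 1))]

lemma mul_pow_three_le {x y δ : ℝ} (hx : 0 ≤ x) (hy : 0 ≤ y) (hδ : 0 < δ) :
    x * y ^ 3 ≤ δ * y ^ 4 + x ^ 4 / δ ^ 3 := by
  rcases le_total x (δ * y) with h | h
  · have : x * y ^ 3 ≤ δ * y * y ^ 3 := by gcongr
    have h2 : 0 ≤ x ^ 4 / δ ^ 3 := by positivity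
    nlinarith
  · have h1 : x * (δ * y) ^ 3 ≤ x * x ^ 3 := by gcongr
    have h2 : x * y ^ 3 ≤ x ^ 4 / δ ^ 3 := by
      rw [le_div_iff₀ (by positivity)]; nlinarith
    have : 0 ≤ δ * y ^ 4 := by positivity
    linarith

lemma mul_three_le_six {a b : ℝ} : a ^ 3 * b ^ 3 ≤ (a ^ 6 + b ^ 6) / 2 := by
  nlinarith [sq_nonneg (a ^ 3 - b ^ 3)]

/-- Schur-type bound for a matrix with entries decaying away from the diagonal. -/
lemma schur_offdiag {q S : ℝ} (hq : 0 ≤ q)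
    (hS : ∀ n, ∑ j ∈ Finset.range n, q ^ (j + 1) ≤ S) (I : Finset ℕ) (a b : ℕ → ℝ) :
    ∑ i ∈ I, ∑ j ∈ I.erase i, q ^ gap i j * (a i ^ 3 * b j ^ 3) ≤
      S * (∑ i ∈ I, a i ^ 6 + ∑ i ∈ I, b i ^ 6) := by
  have h1 : ∑ i ∈ I, ∑ j ∈ I.erase i, q ^ gap i j * (a i ^ 3 * b j ^ 3) ≤
      ∑ i ∈ I, ∑ j ∈ I.erase i, (q ^ gap i j * a i ^ 6 / 2 + q ^ gap i j * b j ^ 6 / 2) := by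
    refine Finset.sum_le_sum fun i _ => Finset.sum_le_sum fun j _ => ?_
    have := mul_le_mul_of_nonneg_left (mul_three_le_six (a := a i) (b := b j))
      (pow_nonneg hq (gap i j))
    linarith
  have h2 : ∑ i ∈ I, ∑ j ∈ I.erase i, q ^ gap i j * a i ^ 6 / 2 ≤ ∑ i ∈ I, S * a i ^ 6 := by
    refine Finset.sum_le_sum fun i _ => ?_
    have := sum_erase_pow_gap_le hq hS I i
    rw [← Finset.sum_div, ← Finset.sum_mul]
    have h6 : 0 ≤ a i ^ 6 := by positivity
    nlinarith
  have h3 : ∑ i ∈ I, ∑ j ∈ I.erase i, q ^ gap i j * b j ^ 6 / 2 ≤ ∑ j ∈ I, S * b j ^ 6 := by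
    rw [Finset.sum_comm' (t' := I) (s' := fun j => I.erase j)
      (by intro i j; simp only [Finset.mem_erase]; tauto)]
    refine Finset.sum_le_sum fun i _ => ?_
    have := sum_erase_pow_gap_le hq hS I i
    rw [← Finset.sum_div, ← Finset.sum_mul]
    simp_rw [gap_comm _ i]
    have h6 : 0 ≤ b i ^ 6 := by positivity
    nlinarith
  simp_rw [Finset.sum_add_distrib] at h1
  rw [← Finset.mul_sum] at h2 h3
  linarith

lemma sum_pow_six_le (I : Finset ℕ) {a : ℕ → ℝ} (ha : ∀ i, 0 ≤ a i) {A : ℝ}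
    (hA : ∑ i ∈ I, a i ^ 4 ≤ A) : ∑ i ∈ I, a i ^ 6 ≤ √A * A := by
  have hA0 : 0 ≤ A := le_trans (Finset.sum_nonneg fun i _ => by have := ha i; positivity) hA
  have : ∑ i ∈ I, a i ^ 6 ≤ ∑ i ∈ I, √A * a i ^ 4 := by
    refine Finset.sum_le_sum fun i hi => ?_
    have h4 : a i ^ 4 ≤ A := (Finset.single_le_sum (f := fun i => a i ^ 4)
      (fun i _ => by have := ha i; positivity) hi).trans hA
    have : a i ^ 2 ≤ √A := Real.le_sqrt_of_sq_le (by nlinarith)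
    have h4' : 0 ≤ a i ^ 4 := by positivity
    nlinarith
  rw [← Finset.mul_sum] at this
  exact this.trans (by gcongr)

set_option maxHeartbeats 1000000 in
/-- If a probability mass function on pairs is dominated by a matrix decaying off the diagonal
tensored with `a ^ 3`, `b ^ 3`, then it is concentrated at a single diagonal point. -/
lemma exists_concentration {E : ℝ} (hE : 1 ≤ E) : ∃ C r₀ : ℝ, 0 < C ∧ 0 < r₀ ∧
    ∀ (I : Finset ℕ) (a b : ℕ → ℝ) (m : ℕ → ℕ → ℝ) (r : ℝ), 0 < r → r ≤ r₀ →
    (∀ i, 0 ≤ a i) → (∀ i, 0 ≤ b i) → (∀ i j, 0 ≤ m i j) →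
    ∑ i ∈ I, a i ^ 4 ≤ 1 → ∑ i ∈ I, b i ^ 4 ≤ 1 → ∑ i ∈ I, ∑ j ∈ I, m i j = 1 →
    (∀ i ∈ I, m i i ≤ a i ^ 3 * b i ^ 3) →
    (∀ i ∈ I, ∀ j ∈ I, i ≠ j → m i j ≤ E * r ^ gap i j * (a i ^ 3 * b j ^ 3)) →
    ∃ k ∈ I, ∑ j ∈ I.erase k, m k j + ∑ i ∈ I.erase k, m i k +
        ∑ i ∈ I.erase k, ∑ j ∈ I.erase k, m i j ≤ C * r ^ 4 ∧
      ∑ i ∈ I.erase k, ∑ j ∈ I.erase k, m i j ≤ C * r ^ 6 := by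
  set D : ℝ := 8 * 16 ^ 3 * E ^ 4 with hD
  have hD0 : 1 ≤ D := by
    have : 1 ≤ E ^ 4 := one_le_pow₀ hE
    rw [hD]; nlinarith
  refine ⟨2 * D + 4 * D * √(4 * D), 1 / (4096 * E), by positivity, by positivity, ?_⟩
  intro I a b m r hr hr0 ha hb hm hA1 hB1 hsum hdiag hoff
  have hE0 : 0 < E := by linarith
  have hrE : 4096 * E * r ≤ 1 := by
    rw [le_div_iff₀ (by positivity)] at hr0; linarith
  have hr2 : r ≤ 1 / 2 := by nlinarith
  have hsplit : ∀ J : Finset ℕ, J ⊆ I → ∑ i ∈ J, ∑ j ∈ J, m i j ≤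
      ∑ i ∈ J, a i ^ 3 * b i ^ 3 + E * (2 * r * (∑ i ∈ J, a i ^ 6 + ∑ i ∈ J, b i ^ 6)) := by
    intro J hJ
    have h1 : ∑ i ∈ J, ∑ j ∈ J, m i j = ∑ i ∈ J, m i i + ∑ i ∈ J, ∑ j ∈ J.erase i, m i j := by
      rw [← Finset.sum_add_distrib]
      exact Finset.sum_congr rfl fun i hi => (Finset.add_sum_erase J _ hi).symm
    have h2 : ∑ i ∈ J, ∑ j ∈ J.erase i, m i j ≤
        E * ∑ i ∈ J, ∑ j ∈ J.erase i, r ^ gap i j * (a i ^ 3 * b j ^ 3) := by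
      simp_rw [Finset.mul_sum]
      refine Finset.sum_le_sum fun i hi => Finset.sum_le_sum fun j hj => ?_
      rw [Finset.mem_erase] at hj
      have := hoff i (hJ hi) j (hJ hj.2) (Ne.symm hj.1)
      linarith
    have h3 := schur_offdiag hr.le (sum_pow_succ_le hr.le hr2) J a b
    have h4 : ∑ i ∈ J, m i i ≤ ∑ i ∈ J, a i ^ 3 * b i ^ 3 :=
      Finset.sum_le_sum fun i hi => hdiag i (hJ hi)
    have h5 := mul_le_mul_of_nonneg_left h3 hE0.le
    linarith
  have h64 : ∀ c : ℕ → ℝ, (∀ i, 0 ≤ c i) → ∑ i ∈ I, c i ^ 4 ≤ 1 → ∑ i ∈ I, c i ^ 6 ≤ 1 := by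
    intro c hc h
    have := sum_pow_six_le I hc h
    simpa using this
  have hIne : I.Nonempty := by
    by_contra h
    rw [Finset.not_nonempty_iff_eq_empty] at h
    rw [h] at hsum; simp at hsum
  obtain ⟨k, hk, hkmax⟩ := Finset.exists_max_image I (fun i => a i * b i) hIne
  have hle1 : ∀ c : ℕ → ℝ, (∀ i, 0 ≤ c i) → ∑ i ∈ I, c i ^ 4 ≤ 1 → c k ≤ 1 := by
    intro c hc h
    have : c k ^ 4 ≤ 1 := (Finset.single_le_sum (f := fun i => c i ^ 4)
      (fun i _ => by have := hc i; positivity) hk).trans h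
    by_contra h1
    push Not at h1
    have := one_lt_pow₀ h1 (n := 4) (by norm_num)
    linarith
  have hak1 := hle1 a ha hA1
  have hbk1 := hle1 b hb hB1
  have hdiagbig : 1 - 4 * E * r ≤ ∑ i ∈ I, a i ^ 3 * b i ^ 3 := by
    have h := hsplit I subset_rfl
    have h1 := h64 a ha hA1
    have h2 := h64 b hb hB1
    rw [hsum] at h
    nlinarith [mul_pos hE0 hr]
  have habk : 1 - 4 * E * r ≤ a k * b k := by
    have h1 : ∑ i ∈ I, a i ^ 3 * b i ^ 3 ≤ ∑ i ∈ I, a k * b k * ((a i ^ 4 + b i ^ 4) / 2) := by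
      refine Finset.sum_le_sum fun i hi => ?_
      have h := hkmax i hi
      have h2 : a i ^ 2 * b i ^ 2 ≤ (a i ^ 4 + b i ^ 4) / 2 := by
        nlinarith [sq_nonneg (a i ^ 2 - b i ^ 2)]
      have h3 : 0 ≤ a i * b i := mul_nonneg (ha i) (hb i)
      have h4 : 0 ≤ a k * b k := h3.trans h
      calc a i ^ 3 * b i ^ 3 = a i * b i * (a i ^ 2 * b i ^ 2) := by ring
        _ ≤ a k * b k * ((a i ^ 4 + b i ^ 4) / 2) := by gcongr
    rw [← Finset.mul_sum, ← Finset.sum_div, Finset.sum_add_distrib] at h1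
    have h3 : 0 ≤ a k * b k := mul_nonneg (ha k) (hb k)
    nlinarith
  have hak : 1 - 4 * E * r ≤ a k := by nlinarith [ha k, hb k]
  have hbk : 1 - 4 * E * r ≤ b k := by nlinarith [ha k, hb k]
  set s := I.erase k with hs
  set A := ∑ i ∈ s, a i ^ 4 with hAdef
  set B := ∑ i ∈ s, b i ^ 4 with hBdef
  have hA0 : 0 ≤ A := Finset.sum_nonneg fun i _ => by have := ha i; positivity
  have hB0 : 0 ≤ B := Finset.sum_nonneg fun i _ => by have := hb i; positivity
  have haA : a k ^ 4 + A ≤ 1 := by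
    rw [hAdef, hs, Finset.add_sum_erase I (fun i => a i ^ 4) hk]; exact hA1
  have hbB : b k ^ 4 + B ≤ 1 := by
    rw [hBdef, hs, Finset.add_sum_erase I (fun i => b i ^ 4) hk]; exact hB1
  have hpow : ∀ c : ℝ, 1 - 4 * E * r ≤ c → 1 - 16 * E * r ≤ c ^ 4 := by
    intro c hc
    have := one_add_mul_le_pow (a := c - 1) (by nlinarith [mul_pos hE0 hr]) 4
    norm_num at this
    linarith
  have hAs : A ≤ 16 * E * r := by have := hpow _ hak; linarith
  have hBs : B ≤ 16 * E * r := by have := hpow _ hbk; linarith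
  have hsqA : √A ≤ 1 / 16 := by
    rw [Real.sqrt_le_left (by norm_num)]; nlinarith
  have hsqB : √B ≤ 1 / 16 := by
    rw [Real.sqrt_le_left (by norm_num)]; nlinarith
  have hrest : ∑ i ∈ s, ∑ j ∈ s, m i j ≤ √A * A + √B * B := by
    have h := hsplit s (Finset.erase_subset _ _)
    have h1 := sum_pow_six_le s ha (le_refl A)
    have h2 := sum_pow_six_le s hb (le_refl B)
    have h3 : ∑ i ∈ s, a i ^ 3 * b i ^ 3 ≤ (∑ i ∈ s, a i ^ 6 + ∑ i ∈ s, b i ^ 6) / 2 := by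
      rw [← Finset.sum_add_distrib, Finset.sum_div]
      exact Finset.sum_le_sum fun i _ => mul_three_le_six
    have h4 : 0 ≤ ∑ i ∈ s, a i ^ 6 + ∑ i ∈ s, b i ^ 6 := by positivity
    have h5 : E * (2 * r * (∑ i ∈ s, a i ^ 6 + ∑ i ∈ s, b i ^ 6)) ≤
        1 / 2 * (∑ i ∈ s, a i ^ 6 + ∑ i ∈ s, b i ^ 6) := by
      rw [← mul_assoc]; gcongr; nlinarith
    linarith
  have hyoung : ∀ c : ℕ → ℝ, (∀ i, 0 ≤ c i) → ∑ j ∈ s, r ^ gap k j * c j ^ 3 ≤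
      1 / (16 * E) * ∑ j ∈ s, c j ^ 4 + 4 * (16 * E) ^ 3 * r ^ 4 := by
    intro c hc
    have h1 : ∑ j ∈ s, r ^ gap k j * c j ^ 3 ≤
        ∑ j ∈ s, (1 / (16 * E) * c j ^ 4 + (16 * E) ^ 3 * (r ^ 4) ^ gap k j) := by
      refine Finset.sum_le_sum fun j _ => ?_
      have := mul_pow_three_le (x := r ^ gap k j) (δ := 1 / (16 * E)) (by positivity) (hc j)
        (by positivity)
      refine this.trans (le_of_eq ?_)
      rw [← pow_mul, ← pow_mul, mul_comm 4]
      field_simp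
    rw [Finset.sum_add_distrib, ← Finset.mul_sum, ← Finset.mul_sum] at h1
    have h2 := sum_erase_pow_gap_le (q := r ^ 4) (by positivity) (sum_pow_succ_le (by positivity)
      (by have := pow_le_of_le_one hr.le (by linarith) (n := 4) (by norm_num); linarith)) I k
    have h3 := mul_le_mul_of_nonneg_left h2 (show 0 ≤ (16 * E) ^ 3 by positivity)
    linarith
  have hak3 : a k ^ 3 ≤ 1 := pow_le_one₀ (ha k) hak1
  have hbk3 : b k ^ 3 ≤ 1 := pow_le_one₀ (hb k) hbk1
  have hrow : ∑ j ∈ s, m k j ≤ B / 16 + D / 2 * r ^ 4 := by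
    have h1 : ∑ j ∈ s, m k j ≤ E * ∑ j ∈ s, r ^ gap k j * b j ^ 3 := by
      rw [Finset.mul_sum]
      refine Finset.sum_le_sum fun j hj => ?_
      rw [hs, Finset.mem_erase] at hj
      refine (hoff k hk j hj.2 (Ne.symm hj.1)).trans ?_
      have hbj := hb j
      have : 0 ≤ E * r ^ gap k j * b j ^ 3 := by positivity
      nlinarith
    have h2 := mul_le_mul_of_nonneg_left (hyoung b hb) hE0.le
    refine (h1.trans h2).trans (le_of_eq ?_)
    rw [hD, ← hBdef]; field_simp; ring
  have hcol : ∑ i ∈ s, m i k ≤ A / 16 + D / 2 * r ^ 4 := by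
    have h1 : ∑ i ∈ s, m i k ≤ E * ∑ j ∈ s, r ^ gap k j * a j ^ 3 := by
      rw [Finset.mul_sum]
      refine Finset.sum_le_sum fun j hj => ?_
      rw [hs, Finset.mem_erase] at hj
      refine (hoff j hj.2 k hk hj.1).trans ?_
      have haj := ha j
      rw [gap_comm j k]
      have : 0 ≤ E * r ^ gap k j * a j ^ 3 := by positivity
      nlinarith
    have h2 := mul_le_mul_of_nonneg_left (hyoung a ha) hE0.le
    refine (h1.trans h2).trans (le_of_eq ?_)
    rw [hD, ← hAdef]; field_simp; ring
  have hdecomp : m k k + (∑ j ∈ s, m k j + ∑ i ∈ s, m i k + ∑ i ∈ s, ∑ j ∈ s, m i j) = 1 := by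
    rw [← hsum, ← Finset.add_sum_erase I _ hk, ← Finset.add_sum_erase I (fun j => m k j) hk]
    have : ∑ i ∈ I.erase k, ∑ j ∈ I, m i j =
        ∑ i ∈ I.erase k, m i k + ∑ i ∈ I.erase k, ∑ j ∈ I.erase k, m i j := by
      rw [← Finset.sum_add_distrib]
      exact Finset.sum_congr rfl fun i _ => (Finset.add_sum_erase I _ hk).symm
    rw [this]; ring
  have hmkk : m k k ≤ 1 - 3 / 8 * (A + B) := by
    have h := hdiag k hk
    have h1 : a k ^ 3 ≤ 1 - 3 / 4 * A := by
      have := four_mul_pow_three_le (a := a k); linarith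
    have h2 : b k ^ 3 ≤ 1 - 3 / 4 * B := by
      have := four_mul_pow_three_le (a := b k); linarith
    have h3 : 0 ≤ a k ^ 3 := pow_nonneg (ha k) 3
    have h4 : 0 ≤ b k ^ 3 := pow_nonneg (hb k) 3
    nlinarith
  have hrest' : √A * A + √B * B ≤ (A + B) / 16 := by
    have h1 := mul_le_mul_of_nonneg_right hsqA hA0
    have h2 := mul_le_mul_of_nonneg_right hsqB hB0
    linarith
  have hAB : A + B ≤ 4 * D * r ^ 4 := by
    have : 0 ≤ D * r ^ 4 := by positivity
    linarith
  have hD4 : 0 ≤ 4 * D * √(4 * D) := by positivity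
  refine ⟨k, hk, ?_, ?_⟩
  · have h1 : 0 ≤ D * r ^ 4 := by positivity
    have h2 : 0 ≤ 4 * D * √(4 * D) * r ^ 4 := by positivity
    nlinarith
  · have hsq : ∀ x : ℝ, 0 ≤ x → x ≤ 4 * D * r ^ 4 → √x ≤ √(4 * D) * r ^ 2 := by
      intro x hx hx2
      refine (Real.sqrt_le_sqrt hx2).trans (le_of_eq ?_)
      rw [Real.sqrt_mul (by positivity), show r ^ 4 = (r ^ 2) ^ 2 by ring,
        Real.sqrt_sq (by positivity)]
    have h1 := hsq A hA0 (by linarith)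
    have h2 := hsq B hB0 (by linarith)
    have h3 : √A * A + √B * B ≤ √(4 * D) * r ^ 2 * (A + B) := by nlinarith
    have h4 : √(4 * D) * r ^ 2 * (A + B) ≤ √(4 * D) * r ^ 2 * (4 * D * r ^ 4) := by gcongr
    have h5 : 0 ≤ 2 * D * r ^ 6 := by positivity
    nlinarith

open Classical in
/-- Total `ν`-weight of the neighbours of `v`. -/
noncomputable def degree {ι : Type*} (ν : ι → ℝ) (E : ι → ι → Prop) (W : Finset ι) (v : ι) : ℝ :=
  ∑ w ∈ W, if E v w then ν w else 0

/-- Total `μ ⊗ ν`-weight of the edges between `V` and `W`. -/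
noncomputable def edgeMass {ι : Type*} (μ ν : ι → ℝ) (E : ι → ι → Prop) (V W : Finset ι) : ℝ :=
  ∑ v ∈ V, μ v * degree ν E W v

section Graph

variable {ι : Type*} {μ ν : ι → ℝ} {E : ι → ι → Prop} {V W : Finset ι}

open Classical in
lemma edgeMass_eq_sum (μ ν : ι → ℝ) (E : ι → ι → Prop) (V W : Finset ι) :
    edgeMass μ ν E V W = ∑ v ∈ V, ∑ w ∈ W, if E v w then μ v * ν w else 0 := by
  unfold edgeMass degree
  refine Finset.sum_congr rfl fun v _ => ?_
  rw [Finset.mul_sum]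
  exact Finset.sum_congr rfl fun w _ => by split_ifs <;> simp

lemma edgeMass_swap (μ ν : ι → ℝ) (E : ι → ι → Prop) (V W : Finset ι) :
    edgeMass ν μ (fun w v => E v w) W V = edgeMass μ ν E V W := by
  rw [edgeMass_eq_sum, edgeMass_eq_sum, Finset.sum_comm]
  refine Finset.sum_congr rfl fun v _ => Finset.sum_congr rfl fun w _ => ?_
  rw [mul_comm]

lemma degree_nonneg (hν : ∀ w, 0 < ν w) (v : ι) : 0 ≤ degree ν E W v :=
  Finset.sum_nonneg fun w _ => by split_ifs; exacts [(hν w).le, le_rfl]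

lemma degree_le_sum (hν : ∀ w, 0 < ν w) (v : ι) : degree ν E W v ≤ ∑ w ∈ W, ν w :=
  Finset.sum_le_sum fun w _ => by split_ifs; exacts [le_rfl, (hν w).le]

lemma edgeMass_nonneg (hμ : ∀ v, 0 < μ v) (hν : ∀ w, 0 < ν w) : 0 ≤ edgeMass μ ν E V W :=
  Finset.sum_nonneg fun v _ => mul_nonneg (hμ v).le (degree_nonneg hν v)

lemma edgeMass_erase [DecidableEq ι] {v : ι} (hv : v ∈ V) :
    edgeMass μ ν E (V.erase v) W = edgeMass μ ν E V W - μ v * degree ν E W v := by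
  unfold edgeMass
  rw [← Finset.add_sum_erase V _ hv]; ring

lemma rpow_sub_le {s x : ℝ} (hs : 0 < s) (hx : x ≤ s) :
    (s - x) ^ (3 / 4 : ℝ) ≤ s ^ (3 / 4 : ℝ) * (1 - 3 / 4 * (x / s)) := by
  have h := rpow_one_add_le_one_add_mul_self (s := -(x / s)) (p := 3 / 4)
    (by rw [neg_le_neg_iff, div_le_one hs]; exact hx) (by norm_num) (by norm_num)
  have h1 : s - x = s * (1 + -(x / s)) := by field_simp; ring
  have h2 : 0 ≤ 1 + -(x / s) := by
    have : x / s ≤ 1 := by rw [div_le_one hs]; exact hx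
    linarith
  rw [h1, Real.mul_rpow hs.le h2]
  have : 0 ≤ s ^ (3 / 4 : ℝ) := by positivity
  nlinarith

/-- Removing a vertex from a minimal dense pair lowers the density, so its degree is large. -/
lemma degree_ge_of_minimal [DecidableEq ι] (hμ : ∀ v, 0 < μ v) (hν : ∀ w, 0 < ν w) {c : ℝ}
    (hc : 0 ≤ c) {v : ι} (hv : v ∈ V)
    (hM : c * ((∑ v ∈ V, μ v) * ∑ w ∈ W, ν w) ^ (3 / 4 : ℝ) < edgeMass μ ν E V W)
    (hmin : edgeMass μ ν E (V.erase v) W ≤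
      c * ((∑ v ∈ V.erase v, μ v) * ∑ w ∈ W, ν w) ^ (3 / 4 : ℝ)) :
    3 / 4 * edgeMass μ ν E V W / (∑ v ∈ V, μ v) ≤ degree ν E W v := by
  set m := ∑ v ∈ V, μ v with hm
  set n := ∑ w ∈ W, ν w with hn
  have hvm : μ v ≤ m := Finset.single_le_sum (fun i _ => (hμ i).le) hv
  have hm0 : 0 < m := (hμ v).trans_le hvm
  have hn0 : 0 ≤ n := Finset.sum_nonneg fun i _ => (hν i).le
  have her : ∑ v ∈ V.erase v, μ v = m - μ v := by
    rw [hm, ← Finset.add_sum_erase V _ hv]; ring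
  rw [edgeMass_erase hv, her, Real.mul_rpow (by linarith) hn0] at hmin
  rw [Real.mul_rpow hm0.le hn0] at hM
  have h1 := rpow_sub_le hm0 hvm
  have hnn : 0 ≤ n ^ (3 / 4 : ℝ) := by positivity
  have h2 : c * ((m - μ v) ^ (3 / 4 : ℝ) * n ^ (3 / 4 : ℝ)) ≤
      c * (m ^ (3 / 4 : ℝ) * (1 - 3 / 4 * (μ v / m)) * n ^ (3 / 4 : ℝ)) := by gcongr
  have h3 : 0 ≤ 1 - 3 / 4 * (μ v / m) := by
    have : μ v / m ≤ 1 := by rw [div_le_one hm0]; exact hvm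
    linarith
  have h4 := mul_le_mul_of_nonneg_right hM.le h3
  have h5 : 3 / 4 * edgeMass μ ν E V W * (μ v / m) ≤ μ v * degree ν E W v := by nlinarith
  rw [div_le_iff₀ hm0]
  rw [mul_div_assoc', div_le_iff₀ hm0] at h5
  have := hμ v
  have h6 : 3 / 4 * edgeMass μ ν E V W * μ v ≤ degree ν E W v * m * μ v := by linarith
  exact le_of_mul_le_mul_right h6 this

/-- Every dense pair contains a dense pair all of whose vertices have large degree. -/
lemma exists_minDegree [DecidableEq ι] (hμ : ∀ v, 0 < μ v) (hν : ∀ w, 0 < ν w) {c : ℝ}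
    (hc : 0 ≤ c)
    (hM : c * ((∑ v ∈ V, μ v) * ∑ w ∈ W, ν w) ^ (3 / 4 : ℝ) < edgeMass μ ν E V W) :
    ∃ V' ⊆ V, ∃ W' ⊆ W,
      c * ((∑ v ∈ V', μ v) * ∑ w ∈ W', ν w) ^ (3 / 4 : ℝ) < edgeMass μ ν E V' W' ∧
      (∀ v ∈ V', 3 / 4 * edgeMass μ ν E V' W' / (∑ v ∈ V', μ v) ≤ degree ν E W' v) ∧
      (∀ w ∈ W', 3 / 4 * edgeMass μ ν E V' W' / (∑ w ∈ W', ν w) ≤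
        degree μ (fun w v => E v w) V' w) := by
  induction h : V.card + W.card using Nat.strong_induction_on generalizing V W with
  | _ n ih =>
  by_cases h1 : ∃ v ∈ V, c * ((∑ v ∈ V.erase v, μ v) * ∑ w ∈ W, ν w) ^ (3 / 4 : ℝ) <
      edgeMass μ ν E (V.erase v) W
  · obtain ⟨v, hv, h2⟩ := h1
    have hcard := Finset.card_erase_lt_of_mem hv
    obtain ⟨V', hV', W', hW', h3⟩ := ih _ (by omega) h2 rfl
    exact ⟨V', hV'.trans (Finset.erase_subset _ _), W', hW', h3⟩
  by_cases h2 : ∃ w ∈ W, c * ((∑ v ∈ V, μ v) * ∑ w ∈ W.erase w, ν w) ^ (3 / 4 : ℝ) <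
      edgeMass μ ν E V (W.erase w)
  · obtain ⟨w, hw, h2⟩ := h2
    have hcard := Finset.card_erase_lt_of_mem hw
    obtain ⟨V', hV', W', hW', h3⟩ := ih _ (by omega) h2 rfl
    exact ⟨V', hV', W', hW'.trans (Finset.erase_subset _ _), h3⟩
  push Not at h1 h2
  refine ⟨V, subset_rfl, W, subset_rfl, hM, fun v hv => degree_ge_of_minimal hμ hν hc hv hM
    (h1 v hv), fun w hw => ?_⟩
  have := degree_ge_of_minimal (E := fun w v => E v w) (V := W) (W := V) hν hμ hc hw
    (by rw [edgeMass_swap, mul_comm (∑ v ∈ W, ν v)]; exact hM)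
    (by rw [edgeMass_swap, mul_comm (∑ v ∈ W.erase w, ν v)]; exact h2 w hw)
  rwa [edgeMass_swap] at this

end Graph

/-- The integer `∏ p ∈ P, p ^ f p` with prescribed exponents. -/
def primeProd (P : Finset ℕ) (f : ℕ → ℕ) : ℕ := ∏ p ∈ P, p ^ f p

/-- The product of `1 - 1 / p` over the `p ∈ P` where the exponent `f p` is positive. -/
noncomputable def density (P : Finset ℕ) (f : ℕ → ℕ) : ℝ :=
  ∏ p ∈ P, if f p = 0 then 1 else 1 - 1 / (p : ℝ)

lemma factorization_primeProd {P : Finset ℕ} (hP : ∀ p ∈ P, p.Prime) (f : ℕ → ℕ) {q : ℕ}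
    (hq : q ∈ P) : (primeProd P f).factorization q = f q := by
  unfold primeProd
  rw [Nat.factorization_prod fun p hp => pow_ne_zero _ (hP p hp).ne_zero, Finsupp.finsetSum_apply,
    Finset.sum_eq_single q]
  · rw [(hP q hq).factorization_pow]; simp
  · intro p hp hpq
    rw [(hP p hp).factorization_pow, Finsupp.single_apply, if_neg hpq]
  · exact fun h => absurd hq h

lemma primeProd_pos {P : Finset ℕ} (hP : ∀ p ∈ P, p.Prime) (f : ℕ → ℕ) : 0 < primeProd P f :=
  Finset.prod_pos fun p hp => pow_pos (hP p hp).pos _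

lemma density_pos {P : Finset ℕ} (hP : ∀ p ∈ P, p.Prime) (f : ℕ → ℕ) : 0 < density P f := by
  refine Finset.prod_pos fun p hp => ?_
  split_ifs
  · norm_num
  · have : (1 : ℝ) < p := by exact_mod_cast (hP p hp).one_lt
    rw [sub_pos, div_lt_one (by linarith)]; exact this

lemma sum_inv_sq_le (P : Finset ℕ) {t : ℝ} (ht : 0 < t) :
    ∑ p ∈ P.filter (fun p : ℕ => t < (p : ℝ)), 1 / (p : ℝ) ^ 2 ≤ 2 / t := by
  have hs : P.filter (fun p : ℕ => t < (p : ℝ)) ⊆ Finset.Ioo ⌊t⌋₊ (P.sup id + 1) := by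
    intro p hp
    rw [Finset.mem_filter] at hp
    have h1 : p ≤ P.sup id := Finset.le_sup (f := id) hp.1
    have h2 : ⌊t⌋₊ < p := (Nat.floor_lt ht.le).2 hp.2
    exact Finset.mem_Ioo.2 ⟨h2, by omega⟩
  refine (Finset.sum_le_sum_of_subset_of_nonneg hs fun _ _ _ => by positivity).trans ?_
  have h := sum_Ioo_inv_sq_le (α := ℝ) ⌊t⌋₊ (P.sup id + 1)
  simp_rw [one_div]
  refine h.trans ?_
  have := (Nat.lt_floor_add_one t).le
  gcongr

/-- Local factor in the count of neighbours. -/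
noncomputable def localFactor (p k e : ℕ) : ℝ :=
  if e = 0 then (if k = 0 then 1 else 1 - 1 / (p : ℝ)) else 1 / (p : ℝ) ^ e

lemma localFactor_nonneg {p : ℕ} (hp : p.Prime) (k e : ℕ) : 0 ≤ localFactor p k e := by
  unfold localFactor
  have : (1 : ℝ) < p := by exact_mod_cast hp.one_lt
  have h2 : 1 / (p : ℝ) ≤ 1 := by rw [div_le_one (by linarith)]; exact this.le
  split_ifs <;> first | linarith | positivity

lemma sum_localFactor_le {p : ℕ} (hp : p.Prime) (k : ℕ) :
    ∑ e ∈ Finset.range (k + 1), localFactor p k e ≤ 1 + 2 / (p : ℝ) ^ 2 := by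
  have hp2 : (2 : ℝ) ≤ p := by exact_mod_cast hp.two_le
  rcases Nat.eq_zero_or_pos k with rfl | hk
  · have : 0 ≤ 2 / (p : ℝ) ^ 2 := by positivity
    simp only [localFactor, zero_add, Finset.range_one, Finset.sum_singleton, if_true]
    linarith
  rw [Finset.sum_range_succ']
  simp only [localFactor, Nat.add_eq_zero_iff, one_ne_zero, and_false, if_false, if_true,
    if_neg hk.ne']
  set q : ℝ := 1 / p with hq
  have hq0 : 0 < q := by positivity
  have hq2 : q ≤ 1 / 2 := by rw [hq]; gcongr
  have h1 : ∑ e ∈ Finset.range k, 1 / (p : ℝ) ^ (e + 1) = q * ∑ e ∈ Finset.range k, q ^ e := by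
    rw [Finset.mul_sum]
    refine Finset.sum_congr rfl fun e _ => ?_
    rw [hq, ← pow_succ', one_div_pow]
  have h2 : (1 - q) * ∑ e ∈ Finset.range k, q ^ e = 1 - q ^ k := mul_neg_geom_sum q k
  have h3 : 0 < q ^ k := by positivity
  have h4 : 2 / (p : ℝ) ^ 2 = 2 * q ^ 2 := by rw [hq]; field_simp
  rw [h1, h4]
  set G := ∑ e ∈ Finset.range k, q ^ e
  have h5 : G ≤ 1 + 2 * q := by
    by_contra h
    push Not at h
    nlinarith
  nlinarith

lemma density_div_le {P : Finset ℕ} (hP : ∀ p ∈ P, p.Prime) (k x : ℕ → ℕ) :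
    density P x / primeProd P (fun p => k p - x p) ≤ ∏ p ∈ P, localFactor p (k p) (k p - x p) := by
  unfold density primeProd
  push_cast
  rw [← Finset.prod_div_distrib]
  have hp1 : ∀ p ∈ P, 0 < 1 / (p : ℝ) ∧ 1 / (p : ℝ) ≤ 1 := fun p hp => by
    have : (1 : ℝ) < p := by exact_mod_cast (hP p hp).one_lt
    exact ⟨by positivity, by rw [div_le_one (by linarith)]; exact this.le⟩
  refine Finset.prod_le_prod (fun p hp => ?_) fun p hp => ?_
  · have := hp1 p hp
    refine div_nonneg ?_ (by positivity)
    split_ifs <;> linarith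
  · have := hp1 p hp
    unfold localFactor
    by_cases h : k p - x p = 0
    · rw [if_pos h, h]
      split_ifs <;> simp only [pow_zero, div_one] <;> first | linarith | omega
    · rw [if_neg h]
      gcongr
      split_ifs <;> linarith

lemma prod_sum_localFactor_le {P : Finset ℕ} (hP : ∀ p ∈ P, p.Prime) (k : ℕ → ℕ) :
    ∏ p ∈ P, ∑ e ∈ Finset.range (k p + 1), localFactor p (k p) e ≤ Real.exp 8 := by
  have h1 : ∏ p ∈ P, ∑ e ∈ Finset.range (k p + 1), localFactor p (k p) e ≤
      ∏ p ∈ P, Real.exp (2 / (p : ℝ) ^ 2) := by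
    refine Finset.prod_le_prod (fun p hp => Finset.sum_nonneg fun e _ =>
      localFactor_nonneg (hP p hp) _ _) fun p hp => ?_
    refine (sum_localFactor_le (hP p hp) (k p)).trans ?_
    have := Real.add_one_le_exp (2 / (p : ℝ) ^ 2)
    linarith
  refine h1.trans ?_
  rw [← Real.exp_sum]
  gcongr
  have h2 := sum_inv_sq_le P (t := 1 / 2) (by norm_num)
  rw [Finset.filter_true_of_mem (fun p hp => by
    have : (1 : ℝ) < p := by exact_mod_cast (hP p hp).one_lt
    linarith)] at h2
  have h3 : ∑ p ∈ P, 2 / (p : ℝ) ^ 2 = 2 * ∑ p ∈ P, 1 / (p : ℝ) ^ 2 := by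
    rw [Finset.mul_sum]; exact Finset.sum_congr rfl fun _ _ => by ring
  rw [h3]; linarith

/-- Weighted count of exponent vectors `x`, split into the part above `k` and the part below. -/
lemma sum_density_le {ι : Type*} {P : Finset ℕ} (hP : ∀ p ∈ P, p.Prime) (k : ℕ → ℕ)
    (x : ι → ℕ → ℕ) (S : Finset ι)
    (hinj : ∀ w ∈ S, ∀ w' ∈ S, (∀ p ∈ P, x w p = x w' p) → w = w') (J : Finset ℕ) (g : ℕ → ℝ)
    (hg : ∀ j, 0 ≤ g j) (η : ι → ℝ)
    (hη : ∀ w ∈ S, η w * primeProd P (fun p => k p - x w p) ≤ g (primeProd P fun p => x w p - k p))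
    (hJ : ∀ w ∈ S, primeProd P (fun p => x w p - k p) ∈ J) :
    ∑ w ∈ S, η w * density P (x w) ≤ Real.exp 8 * ∑ j ∈ J, g j := by
  classical
  set T : Finset (P → ℕ) := Fintype.piFinset fun p : P => Finset.range (k p + 1) with hT
  set F : ℕ × (P → ℕ) → ℝ := fun q => g q.1 * ∏ p : P, localFactor p (k p) (q.2 p) with hF
  set Φ : ι → ℕ × (P → ℕ) := fun w =>
    (primeProd P fun p => x w p - k p, fun p => k p - x w p) with hΦ
  have h1 : ∑ w ∈ S, η w * density P (x w) ≤ ∑ w ∈ S, F (Φ w) := by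
    refine Finset.sum_le_sum fun w hw => ?_
    have hpos : (0 : ℝ) < primeProd P (fun p => k p - x w p) := by
      exact_mod_cast primeProd_pos hP _
    have e1 : η w * density P (x w) = η w * primeProd P (fun p => k p - x w p) *
        (density P (x w) / primeProd P (fun p => k p - x w p)) := by
      field_simp
    have e2 : ∏ p : P, localFactor p (k p) (k p - x w p) =
        ∏ p ∈ P, localFactor p (k p) (k p - x w p) :=
      Finset.prod_coe_sort P fun p => localFactor p (k p) (k p - x w p)
    simp only [hF, hΦ]
    rw [e1, e2]
    exact mul_le_mul (hη w hw) (density_div_le hP k (x w))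
      (div_nonneg (density_pos hP _).le hpos.le) (hg _)
  have h2 : ∑ w ∈ S, F (Φ w) ≤ ∑ q ∈ J ×ˢ T, F q := by
    rw [← Finset.sum_image (f := F) (g := Φ)]
    · refine Finset.sum_le_sum_of_subset_of_nonneg ?_ fun q _ _ =>
        mul_nonneg (hg _) (Finset.prod_nonneg fun p _ => localFactor_nonneg (hP p p.2) _ _)
      intro q hq
      obtain ⟨w, hw, rfl⟩ := Finset.mem_image.1 hq
      refine Finset.mem_product.2 ⟨hJ w hw, Fintype.mem_piFinset.2 fun p => ?_⟩
      exact Finset.mem_range.2 (by simp only [hΦ]; omega)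
    · intro w hw w' hw' h
      refine hinj w hw w' hw' fun p hp => ?_
      have e1 := congrArg Prod.fst h
      have e2 := congrFun (congrArg Prod.snd h) ⟨p, hp⟩
      simp only [hΦ] at e1 e2
      have e3 := factorization_primeProd hP (fun p => x w p - k p) hp
      rw [e1, factorization_primeProd hP _ hp] at e3
      omega
  have h3 : ∑ q ∈ J ×ˢ T, F q = (∑ j ∈ J, g j) *
      ∏ p ∈ P, ∑ e ∈ Finset.range (k p + 1), localFactor p (k p) e := by
    rw [← Finset.prod_coe_sort P fun p => ∑ e ∈ Finset.range (k p + 1), localFactor p (k p) e,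
      Finset.prod_univ_sum, Finset.sum_product, Finset.sum_mul_sum]
  refine (h1.trans h2).trans ?_
  rw [h3, mul_comm]
  exact mul_le_mul_of_nonneg_right (prod_sum_localFactor_le hP k)
    (Finset.sum_nonneg fun j _ => hg j)

lemma sum_rpow_neg_le (n : ℕ) :
    ∑ j ∈ Finset.Icc 1 n, (j : ℝ) ^ (-(3 / 4) : ℝ) ≤ 4 * (n : ℝ) ^ (1 / 4 : ℝ) := by
  induction n with
  | zero => simp
  | succ n ih =>
    rw [Finset.sum_Icc_succ_top (by omega)]
    have hm : (0 : ℝ) < ((n + 1 : ℕ) : ℝ) := by positivity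
    set m : ℝ := ((n + 1 : ℕ) : ℝ) with hmdef
    have hm1 : 1 ≤ m := by rw [hmdef]; exact_mod_cast Nat.le_add_left 1 n
    have hnm : (n : ℝ) = m * (1 + -(1 / m)) := by
      rw [hmdef]; push_cast; field_simp; ring
    have h := rpow_one_add_le_one_add_mul_self (s := -(1 / m)) (p := 1 / 4)
      (by rw [neg_le_neg_iff, div_le_one hm]; exact hm1) (by norm_num) (by norm_num)
    have h0 : 0 ≤ 1 + -(1 / m) := by
      have : 1 / m ≤ 1 := by rw [div_le_one hm]; exact hm1
      linarith
    have h1 : (n : ℝ) ^ (1 / 4 : ℝ) ≤ m ^ (1 / 4 : ℝ) * (1 + 1 / 4 * -(1 / m)) := by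
      rw [hnm, Real.mul_rpow hm.le h0]; gcongr
    have h2 : m ^ (-(3 / 4) : ℝ) = m ^ (1 / 4 : ℝ) * (1 / m) := by
      rw [one_div m, ← Real.rpow_neg_one m, ← Real.rpow_add hm]; norm_num
    rw [h2]
    nlinarith

lemma min_le_rpow_mul {x y : ℝ} (hx : 0 < x) (hy : 0 < y) :
    min x y ≤ x ^ (1 / 4 : ℝ) * y ^ (3 / 4 : ℝ) := by
  have hm : 0 < min x y := lt_min hx hy
  calc min x y = min x y ^ (1 / 4 : ℝ) * min x y ^ (3 / 4 : ℝ) := by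
        rw [← Real.rpow_add hm]; norm_num
    _ ≤ _ := by
        gcongr
        · exact min_le_left _ _
        · exact min_le_right _ _

lemma sum_min_le {X y B : ℝ} (hX : 0 < X) (hy : 0 < y) (hB : 0 < B) :
    ∑ j ∈ Finset.Icc 1 ⌊X⌋₊, min (1 / y) (1 / (B * j)) ≤
      4 * (X / y) ^ (1 / 4 : ℝ) / B ^ (3 / 4 : ℝ) := by
  have h1 : ∑ j ∈ Finset.Icc 1 ⌊X⌋₊, min (1 / y) (1 / (B * j)) ≤
      ∑ j ∈ Finset.Icc 1 ⌊X⌋₊, 1 / y ^ (1 / 4 : ℝ) / B ^ (3 / 4 : ℝ) *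
        (j : ℝ) ^ (-(3 / 4) : ℝ) := by
    refine Finset.sum_le_sum fun j hj => ?_
    have hj0 : (0 : ℝ) < j := by exact_mod_cast (Finset.mem_Icc.1 hj).1
    refine (min_le_rpow_mul (by positivity) (by positivity)).trans (le_of_eq ?_)
    rw [Real.div_rpow (by norm_num) hy.le, Real.div_rpow (by norm_num) (by positivity),
      Real.mul_rpow hB.le hj0.le, Real.rpow_neg hj0.le, Real.one_rpow, Real.one_rpow]
    field_simp
  rw [← Finset.mul_sum] at h1
  have h2 := sum_rpow_neg_le ⌊X⌋₊
  have h3 : ((⌊X⌋₊ : ℕ) : ℝ) ^ (1 / 4 : ℝ) ≤ X ^ (1 / 4 : ℝ) := by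
    gcongr; exact Nat.floor_le hX.le
  have h4 : 0 ≤ 1 / y ^ (1 / 4 : ℝ) / B ^ (3 / 4 : ℝ) := by positivity
  refine h1.trans ((mul_le_mul_of_nonneg_left (h2.trans
    (mul_le_mul_of_nonneg_left h3 (by norm_num))) h4).trans (le_of_eq ?_))
  rw [Real.div_rpow hX.le hy.le]
  field_simp

/-- A bipartite graph on vertices with prime exponents `x`, whose edges satisfy the size conditions
of overlapping approximation problems with approximation functions `ψ` and `η`. -/
structure Admissible {ι : Type*} (P : Finset ℕ) (x : ι → ℕ → ℕ) (ψ η : ι → ℝ)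
    (E : ι → ι → Prop) (V W : Finset ι) : Prop where
  left : ∀ v ∈ V, ∀ w ∈ W, E v w → (primeProd P fun p => x v p - x w p) * η w ≤ 1
  right : ∀ v ∈ V, ∀ w ∈ W, E v w → (primeProd P fun p => x w p - x v p) * ψ v ≤ 1
  inj_left : ∀ v ∈ V, ∀ w ∈ W, ∀ w' ∈ W, E v w → E v w' → (∀ p ∈ P, x w p = x w' p) → w = w'
  inj_right : ∀ w ∈ W, ∀ v ∈ V, ∀ v' ∈ V, E v w → E v' w → (∀ p ∈ P, x v p = x v' p) → v = v'

lemma Admissible.swap {ι : Type*} {P : Finset ℕ} {x : ι → ℕ → ℕ} {ψ η : ι → ℝ}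
    {E : ι → ι → Prop} {V W : Finset ι} (h : Admissible P x ψ η E V W) :
    Admissible P x η ψ (fun w v => E v w) W V :=
  ⟨fun w hw v hv => h.right v hv w hw, fun w hw v hv => h.left v hv w hw, h.inj_right, h.inj_left⟩

lemma Admissible.mono {ι : Type*} {P : Finset ℕ} {x : ι → ℕ → ℕ} {ψ η : ι → ℝ}
    {E E' : ι → ι → Prop} {V W V' W' : Finset ι} (h : Admissible P x ψ η E V W)
    (hV : V' ⊆ V) (hW : W' ⊆ W) (hE : ∀ v w, E' v w → E v w) :
    Admissible P x ψ η E' V' W' :=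
  ⟨fun v hv w hw h1 => h.left v (hV hv) w (hW hw) (hE _ _ h1),
   fun v hv w hw h1 => h.right v (hV hv) w (hW hw) (hE _ _ h1),
   fun v hv w hw w' hw' h1 h2 => h.inj_left v (hV hv) w (hW hw) w' (hW hw') (hE _ _ h1) (hE _ _ h2),
   fun w hw v hv v' hv' h1 h2 =>
    h.inj_right w (hW hw) v (hV hv) v' (hV hv') (hE _ _ h1) (hE _ _ h2)⟩

/-- The quantity `1 / (ψ v⁺ v⁻)`, where `v⁺ / v⁻` is the ratio of `v` to the base point `k`. -/
noncomputable def spread (P : Finset ℕ) (k : ℕ → ℕ) (s : ℝ) (f : ℕ → ℕ) : ℝ :=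
  1 / (s * (primeProd P fun p => f p - k p) * (primeProd P fun p => k p - f p))

lemma spread_pos {P : Finset ℕ} (hP : ∀ p ∈ P, p.Prime) (k : ℕ → ℕ) {s : ℝ} (hs : 0 < s)
    (f : ℕ → ℕ) : 0 < spread P k s f := by
  have h1 : (0 : ℝ) < primeProd P fun p => f p - k p := by exact_mod_cast primeProd_pos hP _
  have h2 : (0 : ℝ) < primeProd P fun p => k p - f p := by exact_mod_cast primeProd_pos hP _
  unfold spread; positivity

section Counting

variable {ι : Type*} {P : Finset ℕ} {x : ι → ℕ → ℕ} {ψ η : ι → ℝ} {E : ι → ι → Prop}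
  {V W : Finset ι} {k : ℕ → ℕ}

lemma degree_le_spread (hP : ∀ p ∈ P, p.Prime) (hψ : ∀ v, 0 < ψ v) (hη : ∀ w, 0 < η w)
    (hA : Admissible P x ψ η E V W)
    (hk : ∀ v ∈ V, ∀ w ∈ W, E v w → ∀ p ∈ P, x v p = k p ∨ x w p = k p) {B : ℝ} (hB : 0 < B)
    (hBW : ∀ w ∈ W, B ≤ spread P k (η w) (x w)) {v : ι} (hv : v ∈ V) :
    degree (fun w => η w * density P (x w)) E W v ≤ Real.exp 8 * spread P k (ψ v) (x v) ∧
    degree (fun w => η w * density P (x w)) E W v ≤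
      Real.exp 8 * (4 * spread P k (ψ v) (x v) ^ (1 / 4 : ℝ) / B ^ (3 / 4 : ℝ)) := by
  classical
  have hpp : ∀ f, (0 : ℝ) < primeProd P f := fun f => by exact_mod_cast primeProd_pos hP f
  set vp : ℝ := ((primeProd P fun p => x v p - k p : ℕ) : ℝ) with hvp
  set vm : ℝ := ((primeProd P fun p => k p - x v p : ℕ) : ℝ) with hvm
  have hvp0 : 0 < vp := hpp _
  have hvm0 : 0 < vm := hpp _
  set X : ℝ := 1 / (ψ v * vm) with hX
  have hψv := hψ v
  have hX0 : 0 < X := by positivity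
  have hXs : X / vp = spread P k (ψ v) (x v) := by
    rw [hX, spread, ← hvp, ← hvm]; field_simp
  have hU : ∀ w ∈ W, E v w → primeProd P (fun p => x v p - x w p) =
      primeProd P (fun p => x v p - k p) * primeProd P (fun p => k p - x w p) := by
    intro w hw hE
    unfold primeProd
    rw [← Finset.prod_mul_distrib]
    refine Finset.prod_congr rfl fun p hp => ?_
    rw [← pow_add]
    congr 1
    rcases hk v hv w hw hE p hp with h | h <;> dsimp only <;> omega
  have hU' : ∀ w ∈ W, E v w → primeProd P (fun p => x w p - x v p) =
      primeProd P (fun p => x w p - k p) * primeProd P (fun p => k p - x v p) := by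
    intro w hw hE
    unfold primeProd
    rw [← Finset.prod_mul_distrib]
    refine Finset.prod_congr rfl fun p hp => ?_
    rw [← pow_add]
    congr 1
    rcases hk v hv w hw hE p hp with h | h <;> dsimp only <;> omega
  have hdeg : degree (fun w => η w * density P (x w)) E W v =
      ∑ w ∈ W.filter (E v), η w * density P (x w) := by
    unfold degree; rw [Finset.sum_filter]
  have hJ : ∀ w ∈ W.filter (E v), primeProd P (fun p => x w p - k p) ∈ Finset.Icc 1 ⌊X⌋₊ := by
    intro w hw
    rw [Finset.mem_filter] at hw
    refine Finset.mem_Icc.2 ⟨primeProd_pos hP _, Nat.le_floor ?_⟩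
    have h1 := hA.right v hv w hw.1 hw.2
    rw [hU' w hw.1 hw.2] at h1
    push_cast at h1
    rw [hX, le_div_iff₀ (by positivity)]
    linarith
  have hinj : ∀ w ∈ W.filter (E v), ∀ w' ∈ W.filter (E v), (∀ p ∈ P, x w p = x w' p) → w = w' := by
    intro w hw w' hw'
    rw [Finset.mem_filter] at hw hw'
    exact hA.inj_left v hv w hw.1 w' hw'.1 hw.2 hw'.2
  have hη1 : ∀ w ∈ W.filter (E v), η w * primeProd P (fun p => k p - x w p) ≤ 1 / vp := by
    intro w hw
    rw [Finset.mem_filter] at hw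
    have h1 := hA.left v hv w hw.1 hw.2
    rw [hU w hw.1 hw.2] at h1
    push_cast at h1
    rw [le_div_iff₀ hvp0]
    linarith
  constructor
  · rw [hdeg]
    refine (sum_density_le hP k x _ hinj _ (fun _ => 1 / vp) (fun _ => by positivity) η hη1
      hJ).trans ?_
    gcongr
    rw [Finset.sum_const, Nat.card_Icc, nsmul_eq_mul, ← hXs, mul_one_div]
    have := Nat.floor_le hX0.le
    gcongr
    simpa using this
  · rw [hdeg]
    refine (sum_density_le hP k x _ hinj _ (fun j => min (1 / vp) (1 / (B * j)))
      (fun j => by positivity) η (fun w hw => le_min (hη1 w hw) ?_) hJ).trans ?_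
    · rw [Finset.mem_filter] at hw
      have h1 := hBW w hw.1
      have h2 := hpp fun p => x w p - k p
      have h3 := hpp fun p => k p - x w p
      have h4 := hη w
      rw [spread, le_div_iff₀ (by positivity)] at h1
      rw [le_div_iff₀ (by positivity)]
      linarith
    · rw [← hXs]
      gcongr
      exact sum_min_le hX0 hvp0 hB

set_option maxHeartbeats 800000 in
lemma counting (hP : ∀ p ∈ P, p.Prime) (hψ : ∀ v, 0 < ψ v) (hη : ∀ w, 0 < η w)
    (hA : Admissible P x ψ η E V W)
    (hk : ∀ v ∈ V, ∀ w ∈ W, E v w → ∀ p ∈ P, x v p = k p ∨ x w p = k p) :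
    edgeMass (fun v => ψ v * density P (x v)) (fun w => η w * density P (x w)) E V W ≤
      4 * Real.exp 8 * ((∑ v ∈ V, ψ v * density P (x v)) *
        ∑ w ∈ W, η w * density P (x w)) ^ (3 / 4 : ℝ) := by
  classical
  set μ : ι → ℝ := fun v => ψ v * density P (x v) with hμdef
  set ν : ι → ℝ := fun v => η v * density P (x v) with hνdef
  have hμ : ∀ v, 0 < μ v := fun v => mul_pos (hψ v) (density_pos hP _)
  have hν : ∀ v, 0 < ν v := fun v => mul_pos (hη v) (density_pos hP _)
  set c : ℝ := Real.exp 8 with hc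
  have hc1 : 1 ≤ c := Real.one_le_exp (by norm_num)
  by_contra! hcon
  obtain ⟨V', hV', W', hW', hM, hdv, hdw⟩ := exists_minDegree hμ hν (by positivity) hcon
  set M := edgeMass μ ν E V' W' with hMdef
  set m := ∑ v ∈ V', μ v
  set n := ∑ w ∈ W', ν w
  have hm0 : 0 ≤ m := Finset.sum_nonneg fun v _ => (hμ v).le
  have hn0 : 0 ≤ n := Finset.sum_nonneg fun v _ => (hν v).le
  have hM0 : 0 < M := lt_of_le_of_lt (by positivity) hM
  have hVne : V'.Nonempty := by
    by_contra h
    rw [Finset.not_nonempty_iff_eq_empty] at h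
    rw [hMdef, h] at hM0
    simp [edgeMass] at hM0
  have hWne : W'.Nonempty := by
    by_contra h
    rw [Finset.not_nonempty_iff_eq_empty] at h
    rw [hMdef, h] at hM0
    simp [edgeMass, degree] at hM0
  have hm : 0 < m := Finset.sum_pos (fun v _ => hμ v) hVne
  have hn : 0 < n := Finset.sum_pos (fun v _ => hν v) hWne
  obtain ⟨v₀, hv₀, hvmin⟩ := Finset.exists_min_image V' (fun v => spread P k (ψ v) (x v)) hVne
  obtain ⟨w₀, hw₀, hwmin⟩ := Finset.exists_min_image W' (fun w => spread P k (η w) (x w)) hWne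
  have hA' := hA.mono hV' hW' (fun _ _ h => h)
  have hk' : ∀ v ∈ V', ∀ w ∈ W', E v w → ∀ p ∈ P, x v p = k p ∨ x w p = k p :=
    fun v hv w hw => hk v (hV' hv) w (hW' hw)
  set S := spread P k (ψ v₀) (x v₀) with hS
  set T := spread P k (η w₀) (x w₀) with hT
  have hS0 : 0 < S := spread_pos hP k (hψ v₀) _
  have hT0 : 0 < T := spread_pos hP k (hη w₀) _
  obtain ⟨h1, h2⟩ := degree_le_spread hP hψ hη hA' hk' hT0 hwmin hv₀
  obtain ⟨h3, h4⟩ := degree_le_spread (k := k) hP hη hψ hA'.swap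
    (fun w hw v hv h p hp => (hk' v hv w hw h p hp).symm) hS0 hvmin hw₀
  have h5 := hdv v₀ hv₀
  have h6 := hdw w₀ hw₀
  have h7 := degree_le_sum (E := E) (W := W') hν v₀
  have h8 := degree_le_sum (E := fun w v => E v w) (W := V') hμ w₀
  set d := degree ν E W' v₀
  set e := degree μ (fun w v => E v w) V' w₀
  rw [← hS, ← hc] at h1 h2
  rw [← hT, ← hc] at h3 h4
  have hd0 : 0 < d := lt_of_lt_of_le (by positivity) h5
  have he0 : 0 < e := lt_of_lt_of_le (by positivity) h6
  set σ := S ^ (1 / 4 : ℝ) with hσ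
  set τ := T ^ (1 / 4 : ℝ) with hτ
  have hσ0 : 0 < σ := by positivity
  have hτ0 : 0 < τ := by positivity
  have hS3 : S ^ (3 / 4 : ℝ) = σ ^ 3 := by
    rw [hσ, ← Real.rpow_natCast, ← Real.rpow_mul hS0.le]; norm_num
  have hT3 : T ^ (3 / 4 : ℝ) = τ ^ 3 := by
    rw [hτ, ← Real.rpow_natCast, ← Real.rpow_mul hT0.le]; norm_num
  have hS4 : S = σ ^ 4 := by
    rw [hσ, ← Real.rpow_natCast, ← Real.rpow_mul hS0.le]; norm_num
  have hT4 : T = τ ^ 4 := by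
    rw [hτ, ← Real.rpow_natCast, ← Real.rpow_mul hT0.le]; norm_num
  rw [hT3] at h2
  rw [hS3] at h4
  set q := (m * n) ^ (1 / 4 : ℝ) with hq
  have hq0 : 0 < q := by positivity
  have hq3 : (m * n) ^ (3 / 4 : ℝ) = q ^ 3 := by
    rw [hq, ← Real.rpow_natCast, ← Real.rpow_mul (by positivity)]; norm_num
  have hq4 : m * n = q ^ 4 := by
    rw [hq, ← Real.rpow_natCast, ← Real.rpow_mul (by positivity)]; norm_num
  rw [hq3] at hM
  have hd1 : d * e ≤ c ^ 2 * (σ * τ) ^ 4 := by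
    calc d * e ≤ (c * S) * (c * T) := mul_le_mul h1 h3 he0.le (by positivity)
      _ = _ := by rw [hS4, hT4]; ring
  have hd2 : d * e * (σ * τ) ^ 2 ≤ 16 * c ^ 2 := by
    have : d * e ≤ (c * (4 * σ / τ ^ 3)) * (c * (4 * τ / σ ^ 3)) :=
      mul_le_mul h2 h4 he0.le (by positivity)
    refine (mul_le_mul_of_nonneg_right this (by positivity)).trans (le_of_eq ?_)
    field_simp
    ring
  have hd3 : (d * e) ^ 3 ≤ (8 * c ^ 2) ^ 3 := by
    have e1 : (d * e * (σ * τ) ^ 2) ^ 2 ≤ (16 * c ^ 2) ^ 2 := by gcongr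
    have e2 : (d * e) ^ 2 * (d * e) ≤ (d * e) ^ 2 * (c ^ 2 * (σ * τ) ^ 4) := by gcongr
    have e3 : c ^ 2 * (d * e * (σ * τ) ^ 2) ^ 2 ≤ c ^ 2 * (16 * c ^ 2) ^ 2 := by gcongr
    have e4 : 0 ≤ c ^ 6 := by positivity
    calc (d * e) ^ 3 = (d * e) ^ 2 * (d * e) := by ring
      _ ≤ (d * e) ^ 2 * (c ^ 2 * (σ * τ) ^ 4) := e2
      _ = c ^ 2 * (d * e * (σ * τ) ^ 2) ^ 2 := by ring
      _ ≤ c ^ 2 * (16 * c ^ 2) ^ 2 := e3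
      _ = 256 * c ^ 6 := by ring
      _ ≤ 512 * c ^ 6 := by linarith
      _ = (8 * c ^ 2) ^ 3 := by ring
  have hd4 : d * e ≤ 8 * c ^ 2 := le_of_pow_le_pow_left₀ (by norm_num) (by positivity) hd3
  have hd5 : (3 / 4) ^ 2 * M ^ 2 / q ^ 4 ≤ d * e := by
    have := mul_le_mul h5 h6 (by positivity) hd0.le
    refine le_trans (le_of_eq ?_) this
    rw [← hq4]; field_simp
  have hd6 : d * e ≤ q ^ 4 := by
    rw [← hq4, mul_comm m]; exact mul_le_mul h7 h8 he0.le hn0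
  have hd7 : 9 * c ^ 2 * q ^ 2 < d * e := by
    refine lt_of_lt_of_le ?_ hd5
    rw [lt_div_iff₀ (by positivity)]
    have : (4 * c * q ^ 3) ^ 2 < M ^ 2 := by gcongr
    calc 9 * c ^ 2 * q ^ 2 * q ^ 4 = (3 / 4) ^ 2 * (4 * c * q ^ 3) ^ 2 := by ring
      _ < (3 / 4) ^ 2 * M ^ 2 := by gcongr
  have hq2 : 9 * c ^ 2 < q ^ 2 := by
    have : 9 * c ^ 2 * q ^ 2 < q ^ 2 * q ^ 2 := by nlinarith
    exact lt_of_mul_lt_mul_right this (by positivity)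
  have hcc : 1 ≤ c ^ 2 := one_le_pow₀ hc1
  nlinarith

end Counting

/-- The sum of `1 / p` over the primes `p > t` in `P` at which two exponent vectors differ. -/
noncomputable def discrepancy (t : ℝ) (P : Finset ℕ) (f g : ℕ → ℕ) : ℝ :=
  ∑ p ∈ P.filter (fun p : ℕ => t < (p : ℝ)), if f p = g p then 0 else 1 / (p : ℝ)

/-- The bound for the number of weighted edges in graphs with exponents in `P` and discrepancy at
least `K` along edges. -/
def EdgeBound {ι : Type*} (x : ι → ℕ → ℕ) (l C t : ℝ) (P : Finset ℕ) : Prop :=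
  ∀ (ψ η : ι → ℝ) (E : ι → ι → Prop) (V W : Finset ι) (K : ℝ), (∀ v, 0 < ψ v) → (∀ w, 0 < η w) →
    Admissible P x ψ η E V W →
    (∀ v ∈ V, ∀ w ∈ W, E v w → K ≤ discrepancy t P (x v) (x w)) →
    edgeMass (fun v => ψ v * density P (x v)) (fun w => η w * density P (x w)) E V W ≤
      C * Real.exp (-(l * t * K)) * ((∑ v ∈ V, ψ v * density P (x v)) *
        ∑ w ∈ W, η w * density P (x w)) ^ (3 / 4 : ℝ)

section Freeze

variable {ι : Type*} {x : ι → ℕ → ℕ} {ψ η μ ν : ι → ℝ} {E : ι → ι → Prop} {V W : Finset ι}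
  {P : Finset ℕ} {K l C t : ℝ} {p : ℕ}

lemma edgeMass_scale {μ' ν' : ι → ℝ} {a b : ℝ} (hμ : ∀ v ∈ V, μ v = a * μ' v)
    (hν : ∀ w ∈ W, ν w = b * ν' w) : edgeMass μ ν E V W = a * b * edgeMass μ' ν' E V W := by
  rw [edgeMass_eq_sum, edgeMass_eq_sum, Finset.mul_sum]
  refine Finset.sum_congr rfl fun v hv => ?_
  rw [Finset.mul_sum]
  refine Finset.sum_congr rfl fun w hw => ?_
  split_ifs
  · rw [hμ v hv, hν w hw]; ring
  · simp

lemma primeProd_erase (hp : p ∈ P) (f : ℕ → ℕ) :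
    primeProd P f = p ^ f p * primeProd (P.erase p) f :=
  (Finset.mul_prod_erase P _ hp).symm

lemma density_erase (hp : p ∈ P) (f : ℕ → ℕ) :
    density P f = (if f p = 0 then 1 else 1 - 1 / (p : ℝ)) * density (P.erase p) f :=
  (Finset.mul_prod_erase P (fun p : ℕ => if f p = 0 then (1 : ℝ) else 1 - 1 / (p : ℝ)) hp).symm

lemma discrepancy_erase (hp : p ∈ P) (f g : ℕ → ℕ) :
    discrepancy t P f g =
      (if t < (p : ℝ) ∧ f p ≠ g p then 1 / (p : ℝ) else 0) + discrepancy t (P.erase p) f g := by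
  unfold discrepancy
  rw [Finset.sum_filter, Finset.sum_filter, ← Finset.add_sum_erase P _ hp]
  congr 1
  by_cases h1 : t < (p : ℝ) <;> by_cases h2 : f p = g p <;> simp [h1, h2]

lemma Admissible.freeze (hp : p ∈ P) (hA : Admissible P x ψ η E V W) (i j : ℕ) :
    Admissible (P.erase p) x (fun v => (p : ℝ) ^ (j - i) * ψ v)
      (fun w => (p : ℝ) ^ (i - j) * η w) E (V.filter fun v => x v p = i)
      (W.filter fun w => x w p = j) where
  left := by
    intro v hv w hw h
    rw [Finset.mem_filter] at hv hw
    have := hA.left v hv.1 w hw.1 h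
    rw [primeProd_erase hp, hv.2, hw.2] at this
    push_cast at this
    linarith
  right := by
    intro v hv w hw h
    rw [Finset.mem_filter] at hv hw
    have := hA.right v hv.1 w hw.1 h
    rw [primeProd_erase hp, hv.2, hw.2] at this
    push_cast at this
    linarith
  inj_left := by
    intro v hv w hw w' hw' h h' hx
    rw [Finset.mem_filter] at hv hw hw'
    refine hA.inj_left v hv.1 w hw.1 w' hw'.1 h h' fun q hq => ?_
    by_cases hqp : q = p
    · rw [hqp, hw.2, hw'.2]
    · exact hx q (Finset.mem_erase.2 ⟨hqp, hq⟩)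
  inj_right := by
    intro w hw v hv v' hv' h h' hx
    rw [Finset.mem_filter] at hw hv hv'
    refine hA.inj_right w hw.1 v hv.1 v' hv'.1 h h' fun q hq => ?_
    by_cases hqp : q = p
    · rw [hqp, hv.2, hv'.2]
    · exact hx q (Finset.mem_erase.2 ⟨hqp, hq⟩)

/-- Splitting off the prime `p`: the contribution of exponents `i` and `j` at `p` decays
with `|i - j|`. -/
lemma EdgeBound.freeze (hP : ∀ p ∈ P, p.Prime) (hp : p ∈ P) (hl : 0 ≤ l) (hC : 0 ≤ C)
    (hE : EdgeBound x l C t (P.erase p)) (hψ : ∀ v, 0 < ψ v) (hη : ∀ w, 0 < η w)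
    (hA : Admissible P x ψ η E V W)
    (hK : ∀ v ∈ V, ∀ w ∈ W, E v w → K ≤ discrepancy t P (x v) (x w)) (i j : ℕ) :
    edgeMass (fun v => ψ v * density P (x v)) (fun w => η w * density P (x w)) E
        (V.filter fun v => x v p = i) (W.filter fun w => x w p = j) ≤
      C * Real.exp (-(l * t * K)) *
        ((if i = j then 1 else Real.exp l) * ((p : ℝ) ^ (-(1 / 4) : ℝ)) ^ gap i j) *
        ((∑ v ∈ V.filter (fun v => x v p = i), ψ v * density P (x v)) *
          ∑ w ∈ W.filter (fun w => x w p = j), η w * density P (x w)) ^ (3 / 4 : ℝ) := by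
  have hp1 : (1 : ℝ) < p := by exact_mod_cast (hP p hp).one_lt
  have hp0 : (0 : ℝ) < p := by linarith
  have hq : 0 < 1 / (p : ℝ) ∧ 1 / (p : ℝ) < 1 :=
    ⟨by positivity, by rw [div_lt_one (by linarith)]; exact hp1⟩
  set V' := V.filter fun v => x v p = i with hV'
  set W' := W.filter fun w => x w p = j with hW'
  set e : ℝ := if t < (p : ℝ) ∧ i ≠ j then 1 / (p : ℝ) else 0 with he
  have hK' : ∀ v ∈ V', ∀ w ∈ W', E v w → K - e ≤ discrepancy t (P.erase p) (x v) (x w) := by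
    intro v hv w hw h
    rw [Finset.mem_filter] at hv hw
    have := hK v hv.1 w hw.1 h
    rw [discrepancy_erase hp, hv.2, hw.2, ← he] at this
    linarith
  have hmain := hE _ _ E V' W' (K - e) (fun v => mul_pos (pow_pos hp0 (j - i)) (hψ v))
    (fun w => mul_pos (pow_pos hp0 (i - j)) (hη w)) (hA.freeze hp i j) hK'
  set d : ℕ → ℝ := fun i => if i = 0 then 1 else 1 - 1 / (p : ℝ) with hd
  have hd0 : ∀ i, 0 < d i := fun i => by simp only [hd]; split_ifs <;> linarith
  have hd1 : ∀ i, d i ≤ 1 := fun i => by simp only [hd]; split_ifs <;> linarith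
  set a : ℝ := d i / (p : ℝ) ^ (j - i) with ha
  set b : ℝ := d j / (p : ℝ) ^ (i - j) with hb
  have ha0 : 0 < a := div_pos (hd0 i) (by positivity)
  have hb0 : 0 < b := div_pos (hd0 j) (by positivity)
  have hμ : ∀ v ∈ V', ψ v * density P (x v) =
      a * ((p : ℝ) ^ (j - i) * ψ v * density (P.erase p) (x v)) := by
    intro v hv
    rw [density_erase hp, (Finset.mem_filter.1 hv).2, ha]
    change ψ v * (d i * density (P.erase p) (x v)) = _
    generalize d i = D
    field_simp
  have hν : ∀ w ∈ W', η w * density P (x w) =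
      b * ((p : ℝ) ^ (i - j) * η w * density (P.erase p) (x w)) := by
    intro w hw
    rw [density_erase hp, (Finset.mem_filter.1 hw).2, hb]
    change η w * (d j * density (P.erase p) (x w)) = _
    generalize d j = D
    field_simp
  rw [edgeMass_scale hμ hν, Finset.sum_congr rfl hμ, Finset.sum_congr rfl hν, ← Finset.mul_sum,
    ← Finset.mul_sum]
  set m := ∑ v ∈ V', (p : ℝ) ^ (j - i) * ψ v * density (P.erase p) (x v)
  set n := ∑ w ∈ W', (p : ℝ) ^ (i - j) * η w * density (P.erase p) (x w)
  have hP' : ∀ q ∈ P.erase p, q.Prime := fun q hq => hP q (Finset.mem_of_mem_erase hq)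
  have hm0 : 0 ≤ m := Finset.sum_nonneg fun v _ =>
    mul_nonneg (mul_nonneg (by positivity) (hψ v).le) (density_pos hP' _).le
  have hn0 : 0 ≤ n := Finset.sum_nonneg fun v _ =>
    mul_nonneg (mul_nonneg (by positivity) (hη v).le) (density_pos hP' _).le
  set r : ℝ := (p : ℝ) ^ (-(1 / 4) : ℝ) with hr
  have hab : (a * b) ^ (1 / 4 : ℝ) ≤ r ^ gap i j := by
    have h1 : a * b ≤ ((p : ℝ) ^ gap i j)⁻¹ := by
      rw [ha, hb, gap, pow_add, div_mul_div_comm, ← one_div,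
        mul_comm ((p : ℝ) ^ (i - j))]
      gcongr
      exact mul_le_one₀ (hd1 i) (hd0 j).le (hd1 j)
    refine (Real.rpow_le_rpow (by positivity) h1 (by norm_num)).trans (le_of_eq ?_)
    rw [hr, Real.inv_rpow (by positivity), Real.rpow_neg hp0.le, inv_pow, ← Real.rpow_natCast,
      ← Real.rpow_mul hp0.le, ← Real.rpow_natCast, ← Real.rpow_mul hp0.le, mul_comm]
  have hexp : Real.exp (-(l * t * (K - e))) ≤
      Real.exp (-(l * t * K)) * (if i = j then 1 else Real.exp l) := by
    have hte : t * e ≤ if i = j then 0 else 1 := by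
      rw [he]
      by_cases h : i = j
      · simp [h]
      · by_cases h2 : t < (p : ℝ)
        · rw [if_pos ⟨h2, h⟩, if_neg h, mul_one_div, div_le_one hp0]; exact h2.le
        · rw [if_neg (fun h' => h2 h'.1), if_neg h]; norm_num
    have h1 : (if i = j then 1 else Real.exp l) = Real.exp (l * if i = j then 0 else 1) := by
      split_ifs <;> simp
    rw [h1, ← Real.exp_add]
    gcongr
    nlinarith
  have hfac : a * b = (a * b) ^ (1 / 4 : ℝ) * (a * b) ^ (3 / 4 : ℝ) := by
    rw [← Real.rpow_add (by positivity)]; norm_num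
  have hsplit : (a * m * (b * n)) ^ (3 / 4 : ℝ) =
      (a * b) ^ (3 / 4 : ℝ) * (m * n) ^ (3 / 4 : ℝ) := by
    rw [← Real.mul_rpow (by positivity) (by positivity)]; congr 1; ring
  rw [hsplit]
  calc a * b * edgeMass _ _ E V' W' ≤ a * b * (C * Real.exp (-(l * t * (K - e))) *
        (m * n) ^ (3 / 4 : ℝ)) := by gcongr
    _ = (a * b) ^ (1 / 4 : ℝ) * (a * b) ^ (3 / 4 : ℝ) * (C * Real.exp (-(l * t * (K - e))) *
        (m * n) ^ (3 / 4 : ℝ)) := by rw [← hfac]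
    _ ≤ r ^ gap i j * (a * b) ^ (3 / 4 : ℝ) * (C * (Real.exp (-(l * t * K)) *
        (if i = j then 1 else Real.exp l)) * (m * n) ^ (3 / 4 : ℝ)) := by gcongr
    _ = _ := by ring

open Classical in
lemma edgeMass_fiber (μ ν : ι → ℝ) (E : ι → ι → Prop) (Q : ℕ → ℕ → Prop) {I : Finset ℕ}
    (y : ι → ℕ) (hV : ∀ v ∈ V, y v ∈ I) (hW : ∀ w ∈ W, y w ∈ I) :
    edgeMass μ ν (fun v w => E v w ∧ Q (y v) (y w)) V W = ∑ i ∈ I, ∑ j ∈ I,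
      if Q i j then edgeMass μ ν E (V.filter fun v => y v = i) (W.filter fun w => y w = j)
      else 0 := by
  rw [edgeMass_eq_sum, ← Finset.sum_fiberwise_of_maps_to hV]
  refine Finset.sum_congr rfl fun i _ => ?_
  have h1 : ∀ v ∈ V.filter (fun v => y v = i),
      (∑ w ∈ W, if E v w ∧ Q (y v) (y w) then μ v * ν w else 0) =
      ∑ j ∈ I, if Q i j then ∑ w ∈ W.filter (fun w => y w = j),
        (if E v w then μ v * ν w else 0) else 0 := by
    intro v hv
    rw [← Finset.sum_fiberwise_of_maps_to hW]
    refine Finset.sum_congr rfl fun j _ => ?_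
    rw [(Finset.mem_filter.1 hv).2]
    by_cases hQ : Q i j
    · rw [if_pos hQ]
      refine Finset.sum_congr rfl fun w hw => ?_
      rw [(Finset.mem_filter.1 hw).2]; simp [hQ]
    · rw [if_neg hQ]
      refine Finset.sum_eq_zero fun w hw => ?_
      rw [(Finset.mem_filter.1 hw).2]; simp [hQ]
  have h2 := (Finset.sum_congr rfl h1).trans Finset.sum_comm
  refine Eq.trans ?_ (h2.trans ?_)
  · refine Finset.sum_congr rfl fun v _ => Finset.sum_congr rfl fun w _ => ?_
    congr
  refine Finset.sum_congr rfl fun j _ => ?_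
  by_cases hQ : Q i j
  · simp only [if_pos hQ]; rw [edgeMass_eq_sum]
  · simp [hQ]

lemma edgeMass_fiber' (μ ν : ι → ℝ) (E : ι → ι → Prop) {I : Finset ℕ}
    (y : ι → ℕ) (hV : ∀ v ∈ V, y v ∈ I) (hW : ∀ w ∈ W, y w ∈ I) :
    edgeMass μ ν E V W = ∑ i ∈ I, ∑ j ∈ I,
      edgeMass μ ν E (V.filter fun v => y v = i) (W.filter fun w => y w = j) := by
  have := edgeMass_fiber μ ν E (fun _ _ => True) y hV hW
  simpa using this

end Freeze

/-- Fourth root of the proportion of the mass of `V` lying over `i`. -/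
noncomputable def fiberRoot {ι : Type*} (μ : ι → ℝ) (V : Finset ι) (y : ι → ℕ) (i : ℕ) : ℝ :=
  ((∑ v ∈ V.filter (fun v => y v = i), μ v) / ∑ v ∈ V, μ v) ^ (1 / 4 : ℝ)

section FiberRoot

variable {ι : Type*} {μ ν : ι → ℝ} {V W : Finset ι} {y : ι → ℕ}

lemma fiberRoot_nonneg (hμ : ∀ v, 0 < μ v) (i : ℕ) : 0 ≤ fiberRoot μ V y i :=
  Real.rpow_nonneg (div_nonneg (Finset.sum_nonneg fun v _ => (hμ v).le)
    (Finset.sum_nonneg fun v _ => (hμ v).le)) _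

lemma sum_fiberRoot_pow_four (hμ : ∀ v, 0 < μ v) {I : Finset ℕ} (hI : ∀ v ∈ V, y v ∈ I) :
    ∑ i ∈ I, fiberRoot μ V y i ^ 4 ≤ 1 := by
  have h : ∀ i, fiberRoot μ V y i ^ 4 =
      (∑ v ∈ V.filter (fun v => y v = i), μ v) / ∑ v ∈ V, μ v := fun i => by
    unfold fiberRoot
    rw [← Real.rpow_natCast, ← Real.rpow_mul (div_nonneg (Finset.sum_nonneg fun v _ => (hμ v).le)
      (Finset.sum_nonneg fun v _ => (hμ v).le))]
    norm_num
  simp_rw [h]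
  rw [← Finset.sum_div, Finset.sum_fiberwise_of_maps_to hI]
  exact div_self_le_one _

lemma rpow_fiber (hμ : ∀ v, 0 < μ v) (hν : ∀ v, 0 < ν v) (hV : V.Nonempty) (hW : W.Nonempty)
    (i j : ℕ) :
    ((∑ v ∈ V.filter (fun v => y v = i), μ v) *
      ∑ w ∈ W.filter (fun w => y w = j), ν w) ^ (3 / 4 : ℝ) =
    ((∑ v ∈ V, μ v) * ∑ w ∈ W, ν w) ^ (3 / 4 : ℝ) *
      (fiberRoot μ V y i ^ 3 * fiberRoot ν W y j ^ 3) := by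
  have hm : 0 < ∑ v ∈ V, μ v := Finset.sum_pos (fun v _ => hμ v) hV
  have hn : 0 < ∑ v ∈ W, ν v := Finset.sum_pos (fun v _ => hν v) hW
  have hi : 0 ≤ ∑ v ∈ V.filter (fun v => y v = i), μ v := Finset.sum_nonneg fun v _ => (hμ v).le
  have hj : 0 ≤ ∑ w ∈ W.filter (fun w => y w = j), ν w := Finset.sum_nonneg fun v _ => (hν v).le
  unfold fiberRoot
  rw [← Real.rpow_natCast, ← Real.rpow_natCast, ← Real.rpow_mul (div_nonneg hi hm.le),
    ← Real.rpow_mul (div_nonneg hj hn.le)]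
  have : (1 / 4 : ℝ) * (3 : ℕ) = 3 / 4 := by norm_num
  rw [this, ← Real.mul_rpow (div_nonneg hi hm.le) (div_nonneg hj hn.le),
    ← Real.mul_rpow (by positivity) (mul_nonneg (div_nonneg hi hm.le) (div_nonneg hj hn.le))]
  congr 1
  field_simp

end FiberRoot

section Primes

variable {ι : Type*} {x : ι → ℕ → ℕ} {P : Finset ℕ} {l C t : ℝ} {p : ℕ}

lemma EdgeBound.mono {C' : ℝ} (h : EdgeBound x l C t P) (hP : ∀ p ∈ P, p.Prime) (hC : C ≤ C') :
    EdgeBound x l C' t P := by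
  intro ψ η E V W K hψ hη hA hK
  refine (h ψ η E V W K hψ hη hA hK).trans ?_
  have h1 : 0 ≤ (∑ v ∈ V, ψ v * density P (x v)) := Finset.sum_nonneg fun v _ =>
    mul_nonneg (hψ v).le (density_pos hP _).le
  have h2 : 0 ≤ (∑ v ∈ W, η v * density P (x v)) := Finset.sum_nonneg fun v _ =>
    mul_nonneg (hη v).le (density_pos hP _).le
  gcongr

/-- Adding a prime, with a constant loss. -/
lemma EdgeBound.insert_small (hP : ∀ p ∈ P, p.Prime) (hp : p ∈ P) (hl : 0 ≤ l) (hC : 0 ≤ C)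
    (hE : EdgeBound x l C t (P.erase p)) : EdgeBound x l (16 * Real.exp l * C) t P := by
  intro ψ η E V W K hψ hη hA hK
  have hF := fun i j => hE.freeze hP hp hl hC hψ hη hA hK i j
  set μ : ι → ℝ := fun v => ψ v * density P (x v) with hμdef
  set ν : ι → ℝ := fun v => η v * density P (x v) with hνdef
  have hμ : ∀ v, 0 < μ v := fun v => mul_pos (hψ v) (density_pos hP _)
  have hν : ∀ v, 0 < ν v := fun v => mul_pos (hη v) (density_pos hP _)
  rcases V.eq_empty_or_nonempty with rfl | hV
  · simp [edgeMass]
  rcases W.eq_empty_or_nonempty with rfl | hW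
  · simp [edgeMass, degree]
  set Q := ((∑ v ∈ V, μ v) * ∑ w ∈ W, ν w) ^ (3 / 4 : ℝ) with hQ
  have hQ0 : 0 ≤ Q := Real.rpow_nonneg (mul_nonneg (Finset.sum_nonneg fun v _ => (hμ v).le)
    (Finset.sum_nonneg fun v _ => (hν v).le)) _
  set I := V.image (fun v => x v p) ∪ W.image (fun w => x w p) with hI
  have hVI : ∀ v ∈ V, x v p ∈ I := fun v hv =>
    Finset.mem_union_left _ (Finset.mem_image_of_mem (fun v => x v p) hv)
  have hWI : ∀ w ∈ W, x w p ∈ I := fun w hw =>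
    Finset.mem_union_right _ (Finset.mem_image_of_mem (fun w => x w p) hw)
  rw [edgeMass_fiber' μ ν E (fun v => x v p) hVI hWI]
  set a := fiberRoot μ V fun v => x v p with ha
  set b := fiberRoot ν W fun v => x v p with hb
  have ha0 : ∀ i, 0 ≤ a i := fiberRoot_nonneg hμ
  have hb0 : ∀ i, 0 ≤ b i := fiberRoot_nonneg hν
  have ha6 : ∑ i ∈ I, a i ^ 6 ≤ 1 := by
    simpa using sum_pow_six_le I ha0 (sum_fiberRoot_pow_four hμ hVI)
  have hb6 : ∑ i ∈ I, b i ^ 6 ≤ 1 := by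
    simpa using sum_pow_six_le I hb0 (sum_fiberRoot_pow_four hν hWI)
  have hp2 : (2 : ℝ) ≤ p := by exact_mod_cast (hP p hp).two_le
  set r : ℝ := (p : ℝ) ^ (-(1 / 4) : ℝ) with hr
  have hr0 : 0 ≤ r := by positivity
  have hr7 : r ≤ 7 / 8 := by
    have h4 : r ^ 4 = 1 / p := by
      rw [hr, ← Real.rpow_natCast, ← Real.rpow_mul (by positivity)]
      norm_num [Real.rpow_neg_one]
    have : r ^ 4 ≤ (7 / 8) ^ 4 := by
      rw [h4]
      calc 1 / (p : ℝ) ≤ 1 / 2 := by gcongr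
        _ ≤ _ := by norm_num
    exact le_of_pow_le_pow_left₀ (by norm_num) (by norm_num) this
  have hS : ∀ n, ∑ j ∈ Finset.range n, r ^ (j + 1) ≤ 7 := by
    intro n
    have h : (1 - r) * ∑ j ∈ Finset.range n, r ^ j = 1 - r ^ n := mul_neg_geom_sum r n
    have h3 : 0 ≤ r ^ n := by positivity
    simp_rw [pow_succ]
    rw [← Finset.sum_mul]
    have h2 : 0 ≤ ∑ j ∈ Finset.range n, r ^ j := Finset.sum_nonneg fun _ _ => by positivity
    nlinarith
  have hsch := schur_offdiag hr0 hS I a b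
  have hdiag : ∑ i ∈ I, a i ^ 3 * b i ^ 3 ≤ 1 := by
    have : ∑ i ∈ I, a i ^ 3 * b i ^ 3 ≤ (∑ i ∈ I, a i ^ 6 + ∑ i ∈ I, b i ^ 6) / 2 := by
      rw [← Finset.sum_add_distrib, Finset.sum_div]
      exact Finset.sum_le_sum fun i _ => mul_three_le_six
    linarith
  have htot : ∑ i ∈ I, ∑ j ∈ I, r ^ gap i j * (a i ^ 3 * b j ^ 3) ≤ 16 := by
    have : ∑ i ∈ I, ∑ j ∈ I, r ^ gap i j * (a i ^ 3 * b j ^ 3) = ∑ i ∈ I, a i ^ 3 * b i ^ 3 +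
        ∑ i ∈ I, ∑ j ∈ I.erase i, r ^ gap i j * (a i ^ 3 * b j ^ 3) := by
      rw [← Finset.sum_add_distrib]
      refine Finset.sum_congr rfl fun i hi => ?_
      rw [← Finset.add_sum_erase I _ hi, gap_self, pow_zero, one_mul]
    linarith
  have hl1 : 1 ≤ Real.exp l := Real.one_le_exp hl
  have hmain : ∑ i ∈ I, ∑ j ∈ I, edgeMass μ ν E (V.filter fun v => x v p = i)
      (W.filter fun w => x w p = j) ≤ ∑ i ∈ I, ∑ j ∈ I,
        C * Real.exp (-(l * t * K)) * Real.exp l * Q * (r ^ gap i j * (a i ^ 3 * b j ^ 3)) := by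
    refine Finset.sum_le_sum fun i _ => Finset.sum_le_sum fun j _ => ?_
    refine (hF i j).trans ?_
    have := rpow_fiber (y := fun v => x v p) hμ hν hV hW i j
    simp only [hμdef, hνdef] at this
    rw [this]
    have hif : (if i = j then 1 else Real.exp l) ≤ Real.exp l := by split_ifs <;> linarith
    have h3 : 0 ≤ a i ^ 3 * b j ^ 3 := mul_nonneg (pow_nonneg (ha0 i) 3) (pow_nonneg (hb0 j) 3)
    calc C * Real.exp (-(l * t * K)) * ((if i = j then 1 else Real.exp l) * r ^ gap i j) *
        (Q * (a i ^ 3 * b j ^ 3)) ≤ C * Real.exp (-(l * t * K)) * (Real.exp l * r ^ gap i j) *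
        (Q * (a i ^ 3 * b j ^ 3)) := by gcongr
      _ = _ := by ring
  simp_rw [← Finset.mul_sum] at hmain
  refine hmain.trans ((mul_le_mul_of_nonneg_left htot (by positivity)).trans (le_of_eq ?_))
  ring

open Classical in
lemma edgeMass_le_add {μ ν : ι → ℝ} {E E' : ι → ι → Prop} {V W : Finset ι} {P : Finset ℕ}
    (F : ℕ → ι → ι → Prop) (hμ : ∀ v, 0 < μ v) (hν : ∀ v, 0 < ν v)
    (h : ∀ v ∈ V, ∀ w ∈ W, E v w → E' v w ∨ ∃ p ∈ P, F p v w) :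
    edgeMass μ ν E V W ≤ edgeMass μ ν E' V W + ∑ p ∈ P, edgeMass μ ν (F p) V W := by
  simp_rw [edgeMass_eq_sum]
  rw [Finset.sum_comm (s := P), ← Finset.sum_add_distrib]
  refine Finset.sum_le_sum fun v hv => ?_
  rw [Finset.sum_comm (s := P), ← Finset.sum_add_distrib]
  refine Finset.sum_le_sum fun w hw => ?_
  have h0 : 0 < μ v * ν w := mul_pos (hμ v) (hν w)
  have hs : ∀ p ∈ P, 0 ≤ if F p v w then μ v * ν w else 0 := fun p _ => by
    split_ifs; exacts [h0.le, le_rfl]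
  have hs' := Finset.sum_nonneg hs
  by_cases hE : E v w
  · rcases h v hv w hw hE with h1 | ⟨p, hp, h1⟩
    · rw [if_pos hE, if_pos h1]; linarith
    · have := Finset.single_le_sum hs hp
      rw [if_pos h1] at this
      rw [if_pos hE]
      split_ifs <;> linarith
  · rw [if_neg hE]
    split_ifs <;> linarith

open Classical in
lemma edgeMass_mono {μ ν : ι → ℝ} {E E' : ι → ι → Prop} {V W : Finset ι}
    (hμ : ∀ v, 0 < μ v) (hν : ∀ v, 0 < ν v) (h : ∀ v ∈ V, ∀ w ∈ W, E v w → E' v w) :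
    edgeMass μ ν E V W ≤ edgeMass μ ν E' V W := by
  simpa using edgeMass_le_add (P := ∅) (fun _ _ _ => False) hμ hν
    fun v hv w hw hE => Or.inl (h v hv w hw hE)

open Classical in
lemma mul_edgeMass_le_sum {μ ν : ι → ℝ} {E : ι → ι → Prop} {V W : Finset ι} {K : ℝ}
    (hμ : ∀ v, 0 < μ v) (hν : ∀ v, 0 < ν v)
    (hK : ∀ v ∈ V, ∀ w ∈ W, E v w → K ≤ discrepancy t P (x v) (x w)) :
    K * edgeMass μ ν E V W ≤ ∑ p ∈ P.filter (fun p : ℕ => t < (p : ℝ)),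
      1 / (p : ℝ) * edgeMass μ ν (fun v w => E v w ∧ x v p ≠ x w p) V W := by
  simp_rw [edgeMass_eq_sum, Finset.mul_sum]
  rw [Finset.sum_comm (s := P.filter _)]
  refine Finset.sum_le_sum fun v hv => ?_
  rw [Finset.sum_comm (s := P.filter _)]
  refine Finset.sum_le_sum fun w hw => ?_
  have h0 : 0 < μ v * ν w := mul_pos (hμ v) (hν w)
  by_cases hE : E v w
  · have h1 := hK v hv w hw hE
    rw [if_pos hE]
    refine (mul_le_mul_of_nonneg_right h1 h0.le).trans (le_of_eq ?_)
    rw [discrepancy, Finset.sum_mul]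
    refine Finset.sum_congr rfl fun p _ => ?_
    by_cases h2 : x v p = x w p <;> simp [h2, hE]
  · simp [hE]

end Primes

section LargePrimes

variable {ι : Type*} {x : ι → ℕ → ℕ} {ψ η : ι → ℝ} {E : ι → ι → Prop} {V W : Finset ι}
  {P : Finset ℕ} {K l C t : ℝ} {p : ℕ}

/-- If the edge bound fails, then at every large prime almost all edges have the same pair of equal
exponents. -/
lemma exists_common_exponent (hl : 0 ≤ l) : ∃ D r₀ : ℝ, 0 < D ∧ 0 < r₀ ∧
    ∀ {ι : Type} {x : ι → ℕ → ℕ} {ψ η : ι → ℝ} {E : ι → ι → Prop} {V W : Finset ι}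
      {P : Finset ℕ} {K C t : ℝ} {p : ℕ}, (∀ p ∈ P, p.Prime) → p ∈ P → 0 ≤ C →
      (p : ℝ) ^ (-(1 / 4) : ℝ) ≤ r₀ → EdgeBound x l C t (P.erase p) →
      (∀ v, 0 < ψ v) → (∀ w, 0 < η w) → Admissible P x ψ η E V W →
      (∀ v ∈ V, ∀ w ∈ W, E v w → K ≤ discrepancy t P (x v) (x w)) →
      C * Real.exp (-(l * t * K)) * ((∑ v ∈ V, ψ v * density P (x v)) *
        ∑ w ∈ W, η w * density P (x w)) ^ (3 / 4 : ℝ) <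
        edgeMass (fun v => ψ v * density P (x v)) (fun w => η w * density P (x w)) E V W →
      ∃ k : ℕ, edgeMass (fun v => ψ v * density P (x v)) (fun w => η w * density P (x w))
          (fun v w => E v w ∧ ¬ (x v p = k ∧ x w p = k)) V W ≤ D * (1 / p) *
          edgeMass (fun v => ψ v * density P (x v)) (fun w => η w * density P (x w)) E V W ∧
        edgeMass (fun v => ψ v * density P (x v)) (fun w => η w * density P (x w))
          (fun v w => E v w ∧ (x v p ≠ k ∧ x w p ≠ k)) V W ≤ D * (p : ℝ) ^ (-(3 / 2) : ℝ) *
          edgeMass (fun v => ψ v * density P (x v)) (fun w => η w * density P (x w)) E V W := by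
  classical
  obtain ⟨D, r₀, hD, hr₀, h⟩ := exists_concentration (Real.one_le_exp hl)
  refine ⟨D, r₀, hD, hr₀, ?_⟩
  intro ι x ψ η E V W P K C t p hP hp hC hr hE hψ hη hA hK hM
  have hF := fun i j => hE.freeze hP hp hl hC hψ hη hA hK i j
  set μ : ι → ℝ := fun v => ψ v * density P (x v) with hμdef
  set ν : ι → ℝ := fun v => η v * density P (x v) with hνdef
  have hμ : ∀ v, 0 < μ v := fun v => mul_pos (hψ v) (density_pos hP _)
  have hν : ∀ v, 0 < ν v := fun v => mul_pos (hη v) (density_pos hP _)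
  set Q := ((∑ v ∈ V, μ v) * ∑ w ∈ W, ν w) ^ (3 / 4 : ℝ) with hQ
  have hQ0 : 0 ≤ Q := Real.rpow_nonneg (mul_nonneg (Finset.sum_nonneg fun v _ => (hμ v).le)
    (Finset.sum_nonneg fun v _ => (hν v).le)) _
  set B := C * Real.exp (-(l * t * K)) * Q with hB
  set M := edgeMass μ ν E V W with hMdef
  have hB0 : 0 ≤ B := by positivity
  have hM0 : 0 < M := hB0.trans_lt hM
  rcases V.eq_empty_or_nonempty with rfl | hV
  · simp [hMdef, edgeMass] at hM0
  rcases W.eq_empty_or_nonempty with rfl | hW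
  · simp [hMdef, edgeMass, degree] at hM0
  set I := V.image (fun v => x v p) ∪ W.image (fun w => x w p) with hI
  have hVI : ∀ v ∈ V, x v p ∈ I := fun v hv =>
    Finset.mem_union_left _ (Finset.mem_image_of_mem (fun v => x v p) hv)
  have hWI : ∀ w ∈ W, x w p ∈ I := fun w hw =>
    Finset.mem_union_right _ (Finset.mem_image_of_mem (fun w => x w p) hw)
  set N : ℕ → ℕ → ℝ := fun i j => edgeMass μ ν E (V.filter fun v => x v p = i)
    (W.filter fun w => x w p = j) with hN
  have hN0 : ∀ i j, 0 ≤ N i j := fun i j => edgeMass_nonneg hμ hν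
  have hp0 : (0 : ℝ) < p := by exact_mod_cast (hP p hp).pos
  have hNle : ∀ i j, N i j ≤ M * ((if i = j then 1 else Real.exp l) *
      ((p : ℝ) ^ (-(1 / 4) : ℝ)) ^ gap i j *
      (fiberRoot μ V (fun v => x v p) i ^ 3 * fiberRoot ν W (fun v => x v p) j ^ 3)) := by
    intro i j
    refine (hF i j).trans ?_
    have := rpow_fiber (y := fun v => x v p) hμ hν hV hW i j
    simp only [hμdef, hνdef] at this
    rw [this]
    have h3 : 0 ≤ (if i = j then 1 else Real.exp l) * ((p : ℝ) ^ (-(1 / 4) : ℝ)) ^ gap i j *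
      (fiberRoot μ V (fun v => x v p) i ^ 3 * fiberRoot ν W (fun v => x v p) j ^ 3) := by
      have h1 := fiberRoot_nonneg (V := V) (y := fun v => x v p) hμ i
      have h2 := fiberRoot_nonneg (V := W) (y := fun v => x v p) hν j
      have : 0 ≤ (if i = j then 1 else Real.exp l) := by split_ifs <;> positivity
      positivity
    refine le_trans (le_of_eq ?_) (mul_le_mul_of_nonneg_right hM.le h3)
    rw [hB]; ring
  obtain ⟨k, hkI, hk1, hk2⟩ := h I (fiberRoot μ V fun v => x v p) (fiberRoot ν W fun v => x v p)
    (fun i j => N i j / M) ((p : ℝ) ^ (-(1 / 4) : ℝ)) (by positivity) hr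
    (fiberRoot_nonneg hμ) (fiberRoot_nonneg hν) (fun i j => div_nonneg (hN0 i j) hM0.le)
    (sum_fiberRoot_pow_four hμ hVI) (sum_fiberRoot_pow_four hν hWI)
    (by
      simp_rw [← Finset.sum_div]
      rw [div_eq_one_iff_eq hM0.ne']
      exact (edgeMass_fiber' μ ν E (fun v => x v p) hVI hWI).symm)
    (fun i _ => by
      rw [div_le_iff₀ hM0]
      refine (hNle i i).trans (le_of_eq ?_)
      rw [if_pos rfl, gap_self]; ring)
    (fun i _ j _ hij => by
      rw [div_le_iff₀ hM0]
      refine (hNle i j).trans (le_of_eq ?_)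
      rw [if_neg hij]; ring)
  have e4 : ((p : ℝ) ^ (-(1 / 4) : ℝ)) ^ 4 = 1 / p := by
    rw [← Real.rpow_natCast, ← Real.rpow_mul hp0.le]
    norm_num [Real.rpow_neg_one]
  have e6 : ((p : ℝ) ^ (-(1 / 4) : ℝ)) ^ 6 = (p : ℝ) ^ (-(3 / 2) : ℝ) := by
    rw [← Real.rpow_natCast, ← Real.rpow_mul hp0.le]
    norm_num
  rw [e4] at hk1
  rw [e6] at hk2
  simp_rw [← Finset.sum_div] at hk1 hk2
  rw [← add_div, ← add_div, div_le_iff₀ hM0] at hk1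
  rw [div_le_iff₀ hM0] at hk2
  refine ⟨k, le_trans (le_of_eq ?_) hk1, le_trans (le_of_eq ?_) hk2⟩
  · rw [edgeMass_fiber μ ν E (fun i j => ¬ (i = k ∧ j = k)) (fun v => x v p) hVI hWI,
      ← Finset.add_sum_erase I _ hkI, ← Finset.add_sum_erase I _ hkI]
    rw [if_neg (by simp), zero_add, add_assoc (∑ j ∈ I.erase k, N k j),
      ← Finset.sum_add_distrib (f := fun i => N i k)]
    refine congrArg₂ (HAdd.hAdd (α := ℝ) (β := ℝ) (γ := ℝ))
      (Finset.sum_congr rfl fun j hj => ?_) (Finset.sum_congr rfl fun i hi => ?_)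
    · rw [if_pos (by simp [Finset.ne_of_mem_erase hj])]
    · rw [← Finset.add_sum_erase I _ hkI, if_pos (by simp [Finset.ne_of_mem_erase hi])]
      refine congrArg _ (Finset.sum_congr rfl fun j hj => ?_)
      rw [if_pos (by simp [Finset.ne_of_mem_erase hi])]
  · rw [edgeMass_fiber μ ν E (fun i j => (i ≠ k ∧ j ≠ k)) (fun v => x v p) hVI hWI,
      ← Finset.add_sum_erase I _ hkI]
    simp only [ne_eq, not_true_eq_false, false_and, if_false, Finset.sum_const_zero, zero_add]
    refine Finset.sum_congr rfl fun i hi => ?_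
    rw [← Finset.add_sum_erase I _ hkI, if_neg (by simp), zero_add]
    refine Finset.sum_congr rfl fun j hj => ?_
    rw [if_pos (by simp [Finset.ne_of_mem_erase hi, Finset.ne_of_mem_erase hj])]

lemma exists_large_threshold {D r₀ : ℝ} (hD : 0 < D) (hr₀ : 0 < r₀) : ∃ N : ℕ,
    (∀ p : ℕ, N ≤ p → (p : ℝ) ^ (-(1 / 4) : ℝ) ≤ r₀) ∧ ∀ P : Finset ℕ, (∀ p ∈ P, N ≤ p) →
      D * ∑ p ∈ P, (p : ℝ) ^ (-(3 / 2) : ℝ) ≤ 1 / 2 := by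
  have h1 : Summable fun p : ℕ => (p : ℝ) ^ (-(3 / 2) : ℝ) :=
    Real.summable_nat_rpow.2 (by norm_num)
  obtain ⟨s, hs⟩ := summable_iff_vanishing_norm.1 h1 (1 / (2 * D)) (by positivity)
  have h2 : ∀ᶠ p : ℕ in atTop, (p : ℝ) ^ (-(1 / 4) : ℝ) ≤ r₀ :=
    ((tendsto_rpow_neg_atTop (by norm_num : (0 : ℝ) < 1 / 4)).comp
      tendsto_natCast_atTop_atTop).eventually_le_const hr₀
  obtain ⟨N, hN⟩ := eventually_atTop.1 h2
  refine ⟨max N (s.sup id + 1), fun p hp => hN p (le_of_max_le_left hp), fun P hP => ?_⟩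
  have := hs P (Finset.disjoint_left.2 fun p hp hps => by
    have h3 := le_of_max_le_right (hP p hp)
    have h4 : p ≤ s.sup id := Finset.le_sup (f := id) hps
    omega)
  have h5 := (le_abs_self _).trans this.le
  calc D * _ ≤ D * (1 / (2 * D)) := by gcongr
    _ = 1 / 2 := by field_simp

/-- The edge bound for large primes. -/
lemma exists_edgeBound_large (hl : 0 ≤ l) : ∃ (C : ℝ) (N : ℕ), 0 < C ∧
    ∀ (ι : Type) (x : ι → ℕ → ℕ) (t : ℝ) (P : Finset ℕ), 1 ≤ t → (∀ p ∈ P, p.Prime) →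
      (∀ p ∈ P, N ≤ p) → EdgeBound x l C t P := by
  obtain ⟨D, r₀, hD, hr₀, h⟩ := exists_common_exponent hl
  obtain ⟨N, hN1, hN2⟩ := exists_large_threshold hD hr₀
  refine ⟨8 * Real.exp 8 * Real.exp (2 * l * D), N, by positivity, ?_⟩
  intro ι x t P ht
  have ht0 : 0 < t := by linarith
  induction P using Finset.strongInduction with
  | H P ih =>
  intro hP hPN ψ η E V W K hψ hη hA hK
  by_contra! hM
  have hk : ∀ p, ∃ k : ℕ, p ∈ P → _ ∧ _ := fun p => by
    by_cases hp : p ∈ P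
    · obtain ⟨k, hk⟩ := h hP hp (by positivity) (hN1 p (hPN p hp))
        (ih _ (Finset.erase_ssubset hp) (fun q hq => hP q (Finset.mem_of_mem_erase hq))
          (fun q hq => hPN q (Finset.mem_of_mem_erase hq))) hψ hη hA hK hM
      exact ⟨k, fun _ => hk⟩
    · exact ⟨0, fun h => absurd h hp⟩
  choose k hk using hk
  set μ : ι → ℝ := fun v => ψ v * density P (x v) with hμdef
  set ν : ι → ℝ := fun v => η v * density P (x v) with hνdef
  have hμ : ∀ v, 0 < μ v := fun v => mul_pos (hψ v) (density_pos hP _)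
  have hν : ∀ v, 0 < ν v := fun v => mul_pos (hη v) (density_pos hP _)
  set Q := ((∑ v ∈ V, μ v) * ∑ w ∈ W, ν w) ^ (3 / 4 : ℝ) with hQ
  have hQ0 : 0 ≤ Q := Real.rpow_nonneg (mul_nonneg (Finset.sum_nonneg fun v _ => (hμ v).le)
    (Finset.sum_nonneg fun v _ => (hν v).le)) _
  set M := edgeMass μ ν E V W with hMdef
  have hM0 : 0 < M := lt_of_le_of_lt (by positivity) hM
  have hKM : K * M ≤ D * M * (2 / t) := by
    refine (mul_edgeMass_le_sum hμ hν hK).trans ?_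
    have h1 : ∀ p ∈ P.filter (fun p : ℕ => t < (p : ℝ)), 1 / (p : ℝ) *
        edgeMass μ ν (fun v w => E v w ∧ x v p ≠ x w p) V W ≤ D * M * (1 / (p : ℝ) ^ 2) := by
      intro p hp
      have hpP := (Finset.mem_filter.1 hp).1
      have := (edgeMass_mono hμ hν (E' := fun v w => E v w ∧ ¬ (x v p = k p ∧ x w p = k p))
        (V := V) (W := W) (E := fun v w => E v w ∧ x v p ≠ x w p)
        fun v _ w _ hvw => ⟨hvw.1, fun h => hvw.2 (h.1.trans h.2.symm)⟩).trans (hk p hpP).1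
      calc 1 / (p : ℝ) * _ ≤ 1 / (p : ℝ) * (D * (1 / p) * M) := by gcongr
        _ = D * M * (1 / (p : ℝ) ^ 2) := by ring
    refine (Finset.sum_le_sum h1).trans ?_
    rw [← Finset.mul_sum]
    have := sum_inv_sq_le P ht0
    gcongr
  have hKt : t * K ≤ 2 * D := by
    have h1 : M * K ≤ M * (D * (2 / t)) := by linarith
    have h2 : K ≤ D * (2 / t) := le_of_mul_le_mul_left h1 hM0
    calc t * K ≤ t * (D * (2 / t)) := by gcongr
      _ = 2 * D := by field_simp
  have hexp : 1 ≤ Real.exp (2 * l * D) * Real.exp (-(l * t * K)) := by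
    rw [← Real.exp_add]
    apply Real.one_le_exp
    nlinarith
  have hcount := counting (k := k) hP hψ hη
    (hA.mono (Finset.Subset.refl V) (Finset.Subset.refl W)
      (E' := fun v w => E v w ∧ ∀ p ∈ P, x v p = k p ∨ x w p = k p) fun v w h => h.1)
    fun v _ w _ h => h.2
  have hsplit := edgeMass_le_add (μ := μ) (ν := ν) (E := E)
    (E' := fun v w => E v w ∧ ∀ p ∈ P, x v p = k p ∨ x w p = k p) (V := V) (W := W) (P := P)
    (fun p v w => E v w ∧ (x v p ≠ k p ∧ x w p ≠ k p)) hμ hν (fun v _ w _ h => by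
      by_cases h1 : ∀ p ∈ P, x v p = k p ∨ x w p = k p
      · exact Or.inl ⟨h, h1⟩
      · push Not at h1
        obtain ⟨p, hp, h2⟩ := h1
        exact Or.inr ⟨p, hp, h, h2⟩)
  have hbad : ∑ p ∈ P, edgeMass μ ν (fun v w => E v w ∧ (x v p ≠ k p ∧ x w p ≠ k p)) V W ≤
      1 / 2 * M := by
    refine (Finset.sum_le_sum fun p hp => (hk p hp).2).trans ?_
    rw [← Finset.sum_mul, ← Finset.mul_sum]
    exact mul_le_mul_of_nonneg_right (hN2 P hPN) hM0.le
  have hM1 : M ≤ 8 * Real.exp 8 * Q := by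
    change _ ≤ 4 * Real.exp 8 * Q at hcount
    linarith
  have : 8 * Real.exp 8 * Q ≤ 8 * Real.exp 8 * Real.exp (2 * l * D) *
      Real.exp (-(l * t * K)) * Q := by
    calc 8 * Real.exp 8 * Q = 8 * Real.exp 8 * Q * 1 := by ring
      _ ≤ 8 * Real.exp 8 * Q * (Real.exp (2 * l * D) * Real.exp (-(l * t * K))) := by gcongr
      _ = _ := by ring
  linarith

/-- The edge bound for all sets of primes. -/
lemma exists_edgeBound (hl : 0 ≤ l) : ∃ C : ℝ, 0 < C ∧
    ∀ (ι : Type) (x : ι → ℕ → ℕ) (t : ℝ) (P : Finset ℕ), 1 ≤ t → (∀ p ∈ P, p.Prime) →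
      EdgeBound x l C t P := by
  obtain ⟨C, N, hC, h⟩ := exists_edgeBound_large hl
  have hl1 : 1 ≤ Real.exp l := Real.one_le_exp hl
  refine ⟨(16 * Real.exp l) ^ N * C, by positivity, fun ι x t P ht hP => ?_⟩
  have key : ∀ (n : ℕ) (P : Finset ℕ), (∀ p ∈ P, p.Prime) →
      (P.filter fun p => p < N).card = n → EdgeBound x l ((16 * Real.exp l) ^ n * C) t P := by
    intro n
    induction n with
    | zero =>
      intro P hP hn
      rw [Finset.card_eq_zero, Finset.filter_eq_empty_iff] at hn
      simpa using h ι x t P ht hP fun p hp => not_lt.1 (hn hp)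
    | succ n ih =>
      intro P hP hn
      obtain ⟨p, hp⟩ := Finset.card_pos.1 (by omega : 0 < (P.filter fun p => p < N).card)
      have hpP := (Finset.mem_filter.1 hp).1
      have := EdgeBound.insert_small hP hpP hl (by positivity)
        (ih (P.erase p) (fun q hq => hP q (Finset.mem_of_mem_erase hq)) (by
          rw [Finset.filter_erase, Finset.card_erase_of_mem hp, hn]; rfl))
      rwa [← mul_assoc, ← pow_succ'] at this
  refine (key _ P hP rfl).mono hP ?_
  have : (P.filter fun p => p < N).card ≤ N := by
    calc _ ≤ (Finset.range N).card := Finset.card_le_card fun p hp => by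
          simpa using (Finset.mem_filter.1 hp).2
      _ = N := by simp
  gcongr
  linarith

end LargePrimes

section Residues

lemma card_filter_mod_le_prod {Q : Finset ℕ} (hQ : ∀ p ∈ Q, p.Prime) (R : ℕ → Finset ℕ) :
    ((Finset.range (∏ p ∈ Q, p)).filter fun t => ∀ p ∈ Q, t % p ∈ R p).card ≤
      ∏ p ∈ Q, (R p).card := by
  classical
  induction Q using Finset.induction_on with
  | empty => simp
  | insert p Q hp ih =>
    have ih := ih fun q hq => hQ q (Finset.mem_insert_of_mem hq)
    rw [Finset.prod_insert hp, Finset.prod_insert hp]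
    set M := ∏ p ∈ Q, p with hM
    have hM0 : 0 < M := Finset.prod_pos fun q hq => (hQ q (Finset.mem_insert_of_mem hq)).pos
    have hcop : Nat.Coprime p M := Nat.Coprime.prod_right fun q hq =>
      (Nat.coprime_primes (hQ p (Finset.mem_insert_self _ _))
        (hQ q (Finset.mem_insert_of_mem hq))).2 fun h => hp (h ▸ hq)
    have : ((Finset.range (p * M)).filter fun t => ∀ q ∈ insert p Q, t % q ∈ R q).card ≤
        (R p ×ˢ (Finset.range M).filter fun t => ∀ p ∈ Q, t % p ∈ R p).card := by
      refine Finset.card_le_card_of_injOn (fun t => (t % p, t % M)) ?_ ?_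
      · intro t ht
        simp only [Finset.coe_filter, Finset.mem_range, Set.mem_ofPred_eq] at ht
        simp only [Finset.coe_product, Set.mem_prod, Finset.mem_coe, Finset.mem_filter,
          Finset.mem_range]
        refine ⟨ht.2 p (Finset.mem_insert_self _ _), Nat.mod_lt _ hM0, fun q hq => ?_⟩
        rw [Nat.mod_mod_of_dvd _ (Finset.dvd_prod_of_mem _ hq)]
        exact ht.2 q (Finset.mem_insert_of_mem hq)
      · intro s hs t ht hst
        simp only [Finset.coe_filter, Finset.mem_range, Set.mem_ofPred_eq] at hs ht
        simp only [Prod.mk.injEq] at hst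
        have := (Nat.modEq_and_modEq_iff_modEq_mul hcop).1 hst
        exact Nat.ModEq.eq_of_lt_of_lt this hs.1 ht.1
    refine this.trans ?_
    rw [Finset.card_product]
    gcongr

lemma card_filter_mod_le {Q : Finset ℕ} (hQ : ∀ p ∈ Q, p.Prime) (R : ℕ → Finset ℕ) (k : ℕ) :
    ((Finset.range (k * ∏ p ∈ Q, p)).filter fun t => ∀ p ∈ Q, t % p ∈ R p).card ≤
      k * ∏ p ∈ Q, (R p).card := by
  classical
  set M := ∏ p ∈ Q, p with hM
  have hM0 : 0 < M := Finset.prod_pos fun q hq => (hQ q hq).pos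
  refine le_trans (Finset.card_le_card_of_injOn (t := Finset.range k ×ˢ
    (Finset.range M).filter fun t => ∀ p ∈ Q, t % p ∈ R p) (fun t => (t / M, t % M)) ?_ ?_) ?_
  · intro t ht
    simp only [Finset.coe_filter, Finset.mem_range, Set.mem_ofPred_eq] at ht
    simp only [Finset.coe_product, Set.mem_prod, Finset.mem_coe, Finset.mem_filter,
      Finset.mem_range]
    refine ⟨(Nat.div_lt_iff_lt_mul hM0).2 ht.1, Nat.mod_lt _ hM0, fun q hq => ?_⟩
    rw [Nat.mod_mod_of_dvd _ (Finset.dvd_prod_of_mem _ hq)]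
    exact ht.2 q hq
  · intro s _ t _ hst
    simp only [Prod.mk.injEq] at hst
    rw [← Nat.div_add_mod s M, ← Nat.div_add_mod t M, hst.1, hst.2]
  · rw [Finset.card_product, Finset.card_range]
    exact Nat.mul_le_mul_left _ (card_filter_mod_le_prod hQ R)

lemma exists_dvd_add_mul {p a v : ℕ} (hp : p.Prime) (hv : ¬ p ∣ v) : ∃ r < p, p ∣ a + v * r := by
  have := Fact.mk hp
  have hv' : (v : ZMod p) ≠ 0 := by rwa [Ne, ZMod.natCast_eq_zero_iff]
  refine ⟨(-(a : ZMod p) * (v : ZMod p)⁻¹).val, ZMod.val_lt _, ?_⟩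
  rw [← ZMod.natCast_eq_zero_iff]
  push_cast
  rw [ZMod.natCast_zmod_val]
  field_simp
  ring

/-- The residues `r` modulo `p` such that `p` divides neither `a + v * r` nor `b + u * r`. -/
def goodResidues (a b u v p : ℕ) : Finset ℕ :=
  (Finset.range p).filter fun r => ¬ p ∣ a + v * r ∧ ¬ p ∣ b + u * r

lemma card_goodResidues_le {a b u v p : ℕ} (hp : p.Prime) (huv : Nat.Coprime u v) :
    ((goodResidues a b u v p).card : ℝ) ≤ p * (1 - 1 / p) := by
  have hp0 : (0 : ℝ) < p := by exact_mod_cast hp.pos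
  have : ∃ r < p, p ∣ a + v * r ∨ p ∣ b + u * r := by
    by_cases hv : p ∣ v
    · have hu : ¬ p ∣ u := fun hu => hp.one_lt.ne' (Nat.dvd_one.1 (huv ▸ Nat.dvd_gcd hu hv))
      obtain ⟨r, hr, h⟩ := exists_dvd_add_mul (a := b) hp hu
      exact ⟨r, hr, Or.inr h⟩
    · obtain ⟨r, hr, h⟩ := exists_dvd_add_mul (a := a) hp hv
      exact ⟨r, hr, Or.inl h⟩
  obtain ⟨r, hr, h⟩ := this
  have h1 : (goodResidues a b u v p).card ≤ ((Finset.range p).erase r).card := by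
    refine Finset.card_le_card fun s hs => ?_
    simp only [goodResidues, Finset.mem_filter] at hs
    refine Finset.mem_erase.2 ⟨?_, hs.1⟩
    rintro rfl
    tauto
  rw [Finset.card_erase_of_mem (Finset.mem_range.2 hr), Finset.card_range] at h1
  have h2 : ((goodResidues a b u v p).card : ℝ) ≤ ((p - 1 : ℕ) : ℝ) := by exact_mod_cast h1
  rw [Nat.cast_sub hp.one_lt.le] at h2
  calc _ ≤ (p : ℝ) - 1 := by simpa using h2
    _ = _ := by field_simp

lemma card_goodResidues_le_sq {a b u v p : ℕ} {h : ℤ} (hp : p.Prime) (hu : ¬ p ∣ u)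
    (hv : ¬ p ∣ v) (hab : (a * u - b * v : ℤ) = h) (hh : ¬ (p : ℤ) ∣ h) :
    ((goodResidues a b u v p).card : ℝ) ≤ p * (1 - 1 / p) ^ 2 := by
  have hp0 : (0 : ℝ) < p := by exact_mod_cast hp.pos
  obtain ⟨r, hr, hra⟩ := exists_dvd_add_mul (a := a) hp hv
  obtain ⟨s, hs, hsb⟩ := exists_dvd_add_mul (a := b) hp hu
  have hrs : s ≠ r := by
    rintro rfl
    apply hh
    have h1 : (p : ℤ) ∣ ((a + v * s : ℕ) : ℤ) * u - ((b + u * s : ℕ) : ℤ) * v :=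
      dvd_sub (Dvd.dvd.mul_right (Int.natCast_dvd_natCast.2 hra) _)
        (Dvd.dvd.mul_right (Int.natCast_dvd_natCast.2 hsb) _)
    rw [← hab]
    convert h1 using 1
    push_cast; ring
  have h1 : (goodResidues a b u v p).card ≤ (((Finset.range p).erase r).erase s).card := by
    refine Finset.card_le_card fun t ht => ?_
    simp only [goodResidues, Finset.mem_filter] at ht
    refine Finset.mem_erase.2 ⟨?_, Finset.mem_erase.2 ⟨?_, ht.1⟩⟩
    · rintro rfl; tauto
    · rintro rfl; tauto
  rw [Finset.card_erase_of_mem (Finset.mem_erase.2 ⟨hrs, Finset.mem_range.2 hs⟩),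
    Finset.card_erase_of_mem (Finset.mem_range.2 hr), Finset.card_range] at h1
  have h2 : ((goodResidues a b u v p).card : ℝ) ≤ ((p - 1 - 1 : ℕ) : ℝ) := by exact_mod_cast h1
  have h3 := hp.two_le
  rw [Nat.cast_sub (by omega), Nat.cast_sub (by omega)] at h2
  have h4 : (p : ℝ) * (1 - 1 / p) ^ 2 = p - 2 + 1 / p := by field_simp; ring
  have h5 : 0 < 1 / (p : ℝ) := by positivity
  rw [h4]
  push_cast at h2
  linarith

end Residues

/-- The residues modulo `n` prime to all primes of `P` dividing `n`. -/
def reducedResidues (P : Finset ℕ) (n : ℕ) : Finset ℕ :=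
  (Finset.range n).filter fun a => ∀ p ∈ P, p ∣ n → ¬ p ∣ a

section Lattice

variable {P : Finset ℕ} {g u v : ℕ} {h : ℤ}

/-- The pairs of reduced residues modulo `g * v` and `g * u` with `a * u - b * v = h`. -/
def latticePairs (P : Finset ℕ) (g u v : ℕ) (h : ℤ) : Finset (ℕ × ℕ) :=
  (reducedResidues P (g * v) ×ˢ reducedResidues P (g * u)).filter fun c =>
    (c.1 * u - c.2 * v : ℤ) = h

lemma latticePairs_param (hv : 0 < v) (huv : Nat.Coprime u v) {c : ℕ × ℕ}
    (hc : c ∈ latticePairs P g u v h) : ∃ a b : ℕ, (a * u - b * v : ℤ) = h ∧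
      ∀ c' ∈ latticePairs P g u v h, ∃ t < g, c' = (a + v * t, b + u * t) := by
  obtain ⟨c₀, hc₀, hmin⟩ := Finset.exists_min_image (latticePairs P g u v h) Prod.fst ⟨c, hc⟩
  have hmem : ∀ c ∈ latticePairs P g u v h, c.1 < g * v ∧ (c.1 * u - c.2 * v : ℤ) = h := by
    intro c hc
    simp only [latticePairs, reducedResidues, Finset.mem_filter, Finset.mem_product,
      Finset.mem_range] at hc
    exact ⟨hc.1.1.1, hc.2⟩
  refine ⟨c₀.1, c₀.2, (hmem c₀ hc₀).2, fun c' hc' => ?_⟩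
  obtain ⟨h1, h2⟩ := hmem c' hc'
  have h3 := hmin c' hc'
  have h4 := (hmem c₀ hc₀).2
  obtain ⟨d, hd⟩ := Nat.exists_eq_add_of_le h3
  have h5 : (d : ℤ) * u = ((c'.2 : ℤ) - c₀.2) * v := by
    have : (c'.1 : ℤ) = c₀.1 + d := by exact_mod_cast hd
    rw [this] at h2
    linear_combination h2 - h4
  have h6 : (v : ℤ) ∣ d := by
    refine IsCoprime.dvd_of_dvd_mul_right (Nat.isCoprime_iff_coprime.2 huv.symm) ?_ (y := (d : ℤ))
    exact ⟨_, h5.trans (mul_comm _ _)⟩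
  obtain ⟨t, ht⟩ := Int.natCast_dvd_natCast.1 h6
  refine ⟨t, ?_, ?_⟩
  · have : v * t < v * g := by rw [← ht, mul_comm v g]; omega
    exact lt_of_mul_lt_mul_left this (Nat.zero_le _)
  · have h7 : (c'.2 : ℤ) = c₀.2 + u * t := by
      have hv' : (v : ℤ) ≠ 0 := by exact_mod_cast hv.ne'
      apply mul_right_cancel₀ hv'
      rw [ht] at h5
      push_cast at h5
      linear_combination -h5
    ext
    · rw [hd, ht]
    · exact_mod_cast h7

lemma not_dvd_of_mem_latticePairs (hP : ∀ p ∈ P, p.Prime) (huv : Nat.Coprime u v) {c : ℕ × ℕ}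
    (hc : c ∈ latticePairs P g u v h) {p : ℕ} (hp : p ∈ P) (hpuv : p ∣ u * v) : ¬ (p : ℤ) ∣ h := by
  simp only [latticePairs, reducedResidues, Finset.mem_filter, Finset.mem_product,
      Finset.mem_range] at hc
  obtain ⟨⟨⟨-, h1⟩, ⟨-, h2⟩⟩, h3⟩ := hc
  have hpp := hP p hp
  intro hph
  have hn : ¬ (p ∣ u ∧ p ∣ v) := fun hh =>
    hpp.one_lt.ne' (Nat.dvd_one.1 (huv ▸ Nat.dvd_gcd hh.1 hh.2))
  rcases (Nat.Prime.dvd_mul hpp).1 hpuv with hpu | hpv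
  · have h4 : (p : ℤ) ∣ ((c.2 * v : ℕ) : ℤ) := by
      have : ((c.2 * v : ℕ) : ℤ) = c.1 * u - h := by push_cast; linarith
      rw [this]
      exact dvd_sub (Dvd.dvd.mul_left (Int.natCast_dvd_natCast.2 hpu) _) hph
    rcases (Nat.Prime.dvd_mul hpp).1 (Int.natCast_dvd_natCast.1 h4) with h5 | h5
    · exact h2 p hp (Dvd.dvd.mul_left hpu g) h5
    · exact hn ⟨hpu, h5⟩
  · have h4 : (p : ℤ) ∣ ((c.1 * u : ℕ) : ℤ) := by
      have : ((c.1 * u : ℕ) : ℤ) = c.2 * v + h := by push_cast; linarith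
      rw [this]
      exact dvd_add (Dvd.dvd.mul_left (Int.natCast_dvd_natCast.2 hpv) _) hph
    rcases (Nat.Prime.dvd_mul hpp).1 (Int.natCast_dvd_natCast.1 h4) with h5 | h5
    · exact h1 p hp (Dvd.dvd.mul_left hpv g) h5
    · exact hn ⟨h5, hpv⟩

lemma card_latticePairs_le_self (hv : 0 < v) (huv : Nat.Coprime u v) :
    (latticePairs P g u v h).card ≤ g := by
  rcases (latticePairs P g u v h).eq_empty_or_nonempty with h0 | ⟨c, hc⟩
  · simp [h0]
  obtain ⟨a, b, -, hp⟩ := latticePairs_param hv huv hc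
  calc _ ≤ ((Finset.range g).image fun t => (a + v * t, b + u * t)).card := by
        refine Finset.card_le_card fun c hc => ?_
        obtain ⟨t, ht, rfl⟩ := hp c hc
        exact Finset.mem_image_of_mem (fun t => (a + v * t, b + u * t)) (Finset.mem_range.2 ht)
    _ ≤ _ := Finset.card_image_le.trans (by simp)

lemma card_latticePairs_le (hP : ∀ p ∈ P, p.Prime) (hv : 0 < v)
    (huv : Nat.Coprime u v) :
    ((latticePairs P g u v h).card : ℝ) ≤ g * ∏ p ∈ P.filter (fun p => p ∣ g),
      if p ∣ u * v ∨ (p : ℤ) ∣ h then (1 - 1 / (p : ℝ)) else (1 - 1 / (p : ℝ)) ^ 2 := by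
  classical
  set Q := P.filter (fun p => p ∣ g) with hQ
  have hQP : ∀ p ∈ Q, p.Prime := fun p hp => hP p (Finset.mem_filter.1 hp).1
  have hdvd : ∏ p ∈ Q, p ∣ g := Finset.prod_primes_dvd g (fun p hp => (hQP p hp).prime)
    fun p hp => (Finset.mem_filter.1 hp).2
  rcases (latticePairs P g u v h).eq_empty_or_nonempty with h0 | ⟨c, hc⟩
  · rw [h0, Finset.card_empty, Nat.cast_zero]
    refine mul_nonneg (Nat.cast_nonneg _) (Finset.prod_nonneg fun p hp => ?_)
    have : 0 ≤ 1 - 1 / (p : ℝ) := by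
      have h1 : (1 : ℝ) ≤ p := by exact_mod_cast (hQP p hp).one_lt.le
      have : 1 / (p : ℝ) ≤ 1 := by rw [div_le_one (by linarith)]; exact h1
      linarith
    split_ifs <;> positivity
  obtain ⟨a, b, hab, hp⟩ := latticePairs_param hv huv hc
  obtain ⟨k, hk⟩ := hdvd
  have h1 : (latticePairs P g u v h).card ≤ ((Finset.range (k * ∏ p ∈ Q, p)).filter
      fun t => ∀ p ∈ Q, t % p ∈ goodResidues a b u v p).card := by
    refine (Finset.card_le_card (t := ((Finset.range (k * ∏ p ∈ Q, p)).filter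
      fun t => ∀ p ∈ Q, t % p ∈ goodResidues a b u v p).image
        fun t => (a + v * t, b + u * t)) fun c hc => ?_).trans Finset.card_image_le
    obtain ⟨t, ht, rfl⟩ := hp c hc
    refine Finset.mem_image_of_mem (fun t => (a + v * t, b + u * t)) ?_
    refine Finset.mem_filter.2 ⟨Finset.mem_range.2 (by rw [mul_comm, ← hk]; exact ht), ?_⟩
    intro p hpQ
    have hpP := (Finset.mem_filter.1 hpQ).1
    have hpg := (Finset.mem_filter.1 hpQ).2
    simp only [latticePairs, reducedResidues, Finset.mem_filter, Finset.mem_product,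
      Finset.mem_range] at hc
    refine Finset.mem_filter.2 ⟨Finset.mem_range.2 (Nat.mod_lt _ (hQP p hpQ).pos), ?_, ?_⟩
    · intro hd
      refine hc.1.1.2 p hpP (Dvd.dvd.mul_right hpg v) ?_
      rw [Nat.dvd_iff_mod_eq_zero] at hd ⊢
      simpa [Nat.add_mod, Nat.mul_mod] using hd
    · intro hd
      refine hc.1.2.2 p hpP (Dvd.dvd.mul_right hpg u) ?_
      rw [Nat.dvd_iff_mod_eq_zero] at hd ⊢
      simpa [Nat.add_mod, Nat.mul_mod] using hd
  have h2 : ((latticePairs P g u v h).card : ℝ) ≤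
      k * ∏ p ∈ Q, ((goodResidues a b u v p).card : ℝ) := by
    exact_mod_cast h1.trans (card_filter_mod_le hQP _ k)
  have hg' : (g : ℝ) = k * ∏ p ∈ Q, (p : ℝ) := by
    rw [mul_comm, hk]; push_cast; rfl
  refine h2.trans ?_
  rw [hg', mul_assoc, ← Finset.prod_mul_distrib]
  refine mul_le_mul_of_nonneg_left (Finset.prod_le_prod (fun _ _ => Nat.cast_nonneg _)
    fun p hpQ => ?_) (Nat.cast_nonneg _)
  split_ifs with hd
  · exact card_goodResidues_le (hQP p hpQ) huv
  · push Not at hd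
    exact card_goodResidues_le_sq (hQP p hpQ) (fun h => hd.1 (Dvd.dvd.mul_right h v))
      (fun h => hd.1 (Dvd.dvd.mul_left h u)) hab hd.2

end Lattice

/-- The product of `(1 - 1 / p)⁻¹` over the `p ∈ P` dividing `n`. -/
noncomputable def sieveFactor (P : Finset ℕ) (n : ℕ) : ℝ :=
  ∏ p ∈ P.filter (fun p => p ∣ n), (1 - 1 / (p : ℝ))⁻¹

section SieveFactor

variable {P : Finset ℕ} {g u v : ℕ} {h : ℤ}

lemma one_sub_inv_mem {p : ℕ} (hp : p.Prime) : 0 < 1 - 1 / (p : ℝ) ∧ 1 - 1 / (p : ℝ) ≤ 1 := by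
  have h1 : (1 : ℝ) < p := by exact_mod_cast hp.one_lt
  have h2 : 1 / (p : ℝ) < 1 := by rw [div_lt_one (by linarith)]; exact h1
  have h3 : 0 < 1 / (p : ℝ) := by positivity
  constructor <;> linarith

lemma sieveFactor_nonneg (hP : ∀ p ∈ P, p.Prime) (n : ℕ) : 0 ≤ sieveFactor P n :=
  Finset.prod_nonneg fun p hp =>
    inv_nonneg.2 (one_sub_inv_mem (hP p (Finset.mem_filter.1 hp).1)).1.le

lemma density_factorization (hP : ∀ p ∈ P, p.Prime) {n : ℕ} (hn : n ≠ 0) :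
    density P n.factorization = ∏ p ∈ P, if p ∣ n then 1 - 1 / (p : ℝ) else 1 := by
  refine Finset.prod_congr rfl fun p hp => ?_
  have : n.factorization p = 0 ↔ ¬ p ∣ n := by
    rw [Nat.factorization_eq_zero_iff]
    have := hP p hp
    tauto
  by_cases h : p ∣ n <;> simp [this, h]

lemma card_latticePairs_le_density (hP : ∀ p ∈ P, p.Prime) (hg : 0 < g) (hu : 0 < u) (hv : 0 < v)
    (huv : Nat.Coprime u v) :
    ((latticePairs P g u v h).card : ℝ) ≤ g * (density P (g * v).factorization *
      density P (g * u).factorization) * sieveFactor P (u * v) * sieveFactor P h.natAbs := by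
  refine (card_latticePairs_le hP hv huv).trans ?_
  rw [mul_assoc, mul_assoc]
  refine mul_le_mul_of_nonneg_left ?_ (Nat.cast_nonneg g)
  rw [density_factorization hP (by positivity), density_factorization hP (by positivity),
    sieveFactor, sieveFactor, Finset.prod_filter, Finset.prod_filter, Finset.prod_filter,
    ← Finset.prod_mul_distrib, ← Finset.prod_mul_distrib, ← Finset.prod_mul_distrib]
  have hpos : ∀ p ∈ P, 0 < 1 - 1 / (p : ℝ) ∧ 1 - 1 / (p : ℝ) ≤ 1 := fun p hp =>
    one_sub_inv_mem (hP p hp)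
  refine Finset.prod_le_prod (fun p hp => ?_) fun p hp => ?_
  · have := (hpos p hp).1
    split_ifs <;> positivity
  obtain ⟨h0, h1⟩ := hpos p hp
  have hpp := hP p hp
  simp only [hpp.dvd_mul, ← Int.natCast_dvd]
  have hn : ¬ (p ∣ u ∧ p ∣ v) := fun hh =>
    hpp.one_lt.ne' (Nat.dvd_one.1 (huv ▸ Nat.dvd_gcd hh.1 hh.2))
  generalize 1 - 1 / (p : ℝ) = q at h0 h1
  have h2 : 1 ≤ q⁻¹ := (one_le_inv₀ h0).2 h1
  have h3 : q * q⁻¹ = 1 := mul_inv_cancel₀ h0.ne'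
  have h4 : q * q ≤ q := by nlinarith
  have h5 : 1 ≤ q⁻¹ * q⁻¹ := one_le_mul_of_one_le_of_one_le h2 h2
  have h6 : q * q * q⁻¹ = q := by rw [mul_assoc, h3, mul_one]
  have h7 : q ≤ q * q⁻¹ * q⁻¹ * q := by
    have : q * q⁻¹ * q⁻¹ * q = (q * q⁻¹) * (q * q⁻¹) := by ring
    rw [this, h3]; linarith
  have h8 : q * q⁻¹ * q⁻¹ = q⁻¹ := by rw [h3, one_mul]
  by_cases hg' : p ∣ g <;> by_cases hu' : p ∣ u <;> by_cases hv' : p ∣ v <;>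
    by_cases hh : (p : ℤ) ∣ h <;> simp only [hg', hu', hv', hh, true_or, or_true, or_self, if_true,
      if_false, one_mul, mul_one] <;> first | (exfalso; tauto) | nlinarith

end SieveFactor

section SieveSum

variable {P : Finset ℕ} {g u v : ℕ} {h : ℤ}

lemma sum_Icc_inv_sq_le (N : ℕ) : ∑ d ∈ Finset.Icc 1 N, 1 / (d : ℝ) ^ 2 ≤ 2 - 1 / (N : ℝ) := by
  induction N with
  | zero => norm_num
  | succ N ih =>
    rw [Finset.sum_Icc_succ_top (by omega)]
    rcases Nat.eq_zero_or_pos N with rfl | hN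
    · norm_num
    have hN' : (0 : ℝ) < N := by exact_mod_cast hN
    have h1 : 1 / ((N + 1 : ℕ) : ℝ) ^ 2 ≤ 1 / (N : ℝ) - 1 / ((N + 1 : ℕ) : ℝ) := by
      push_cast
      rw [div_sub_div _ _ (by positivity) (by positivity), div_le_div_iff₀ (by positivity)
        (by positivity)]
      nlinarith
    linarith

lemma half_le_prod_one_sub_inv_sq (N : ℕ) :
    (1 / 2 : ℝ) ≤ ∏ p ∈ Finset.Icc 2 (N + 1), (1 - 1 / (p : ℝ) ^ 2) := by
  have : ∏ p ∈ Finset.Icc 2 (N + 1), (1 - 1 / (p : ℝ) ^ 2) =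
      ((N : ℝ) + 2) / (2 * ((N : ℝ) + 1)) := by
    induction N with
    | zero => norm_num
    | succ N ih =>
      rw [Finset.prod_Icc_succ_top (by omega), ih]
      push_cast
      field_simp
      ring
  rw [this, div_le_div_iff₀ (by positivity) (by positivity)]
  linarith

lemma sieveFactor_le (hP : ∀ p ∈ P, p.Prime) {n : ℕ} (hn : n ≠ 0) :
    sieveFactor P n ≤ 2 * ∑ d ∈ n.divisors, 1 / (d : ℝ) := by
  classical
  set S := P.filter (fun p => p ∣ n) with hS
  have hSP : ∀ p ∈ S, p.Prime := fun p hp => hP p (Finset.mem_filter.1 hp).1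
  have h1 : sieveFactor P n * ∏ p ∈ S, (1 - 1 / (p : ℝ) ^ 2) = ∏ p ∈ S, (1 + 1 / (p : ℝ)) := by
    rw [sieveFactor, ← Finset.prod_mul_distrib]
    refine Finset.prod_congr rfl fun p hp => ?_
    have := (one_sub_inv_mem (hSP p hp)).1
    have e : 1 - 1 / (p : ℝ) ^ 2 = (1 - 1 / p) * (1 + 1 / p) := by ring
    rw [e, ← mul_assoc, inv_mul_cancel₀ this.ne', one_mul]
  have h2 : 1 / 2 ≤ ∏ p ∈ S, (1 - 1 / (p : ℝ) ^ 2) := by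
    refine (half_le_prod_one_sub_inv_sq n).trans ?_
    have hsub : S ⊆ Finset.Icc 2 (n + 1) := by
      intro p hp
      have h3 := Nat.le_of_dvd (Nat.pos_of_ne_zero hn) (Finset.mem_filter.1 hp).2
      exact Finset.mem_Icc.2 ⟨(hSP p hp).two_le, by omega⟩
    have hle : ∀ p ∈ Finset.Icc 2 (n + 1), 0 ≤ 1 - 1 / (p : ℝ) ^ 2 ∧
        1 - 1 / (p : ℝ) ^ 2 ≤ 1 := by
      intro p hp
      have : (1 : ℝ) ≤ p := by exact_mod_cast (by omega : 1 ≤ 2).trans (Finset.mem_Icc.1 hp).1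
      have h3 : 1 / (p : ℝ) ^ 2 ≤ 1 := by
        rw [div_le_one (by positivity)]; exact one_le_pow₀ this
      have h4 : 0 ≤ 1 / (p : ℝ) ^ 2 := by positivity
      constructor <;> linarith
    rw [← Finset.prod_sdiff hsub]
    refine mul_le_of_le_one_left (Finset.prod_nonneg fun p hp => (hle p (hsub hp)).1)
      (Finset.prod_le_one (fun p hp => ?_) fun p hp => ?_)
    · exact (hle p (Finset.sdiff_subset hp)).1
    · exact (hle p (Finset.sdiff_subset hp)).2
  have h3 : ∏ p ∈ S, (1 + 1 / (p : ℝ)) ≤ ∑ d ∈ n.divisors, 1 / (d : ℝ) := by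
    rw [Finset.prod_one_add]
    have : ∀ T ∈ S.powerset, ∏ p ∈ T, 1 / (p : ℝ) = 1 / ((∏ p ∈ T, p : ℕ) : ℝ) := fun T _ => by
      rw [Finset.prod_div_distrib]; simp
    rw [Finset.sum_congr rfl this]
    have hinj : Set.InjOn (fun T : Finset ℕ => ∏ p ∈ T, p) S.powerset := by
      intro T hT T' hT' h
      rw [Finset.mem_coe, Finset.mem_powerset] at hT hT'
      rw [← Nat.primeFactors_prod fun p hp => hSP p (hT hp),
        ← Nat.primeFactors_prod fun p hp => hSP p (hT' hp)]
      exact congrArg _ h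
    rw [← Finset.sum_image (f := fun d : ℕ => 1 / (d : ℝ)) hinj]
    refine Finset.sum_le_sum_of_subset_of_nonneg ?_ fun _ _ _ => by positivity
    intro d hd
    obtain ⟨T, hT, rfl⟩ := Finset.mem_image.1 hd
    rw [Finset.mem_powerset] at hT
    exact Nat.mem_divisors.2 ⟨Finset.prod_primes_dvd n (fun p hp => (hSP p (hT hp)).prime)
      fun p hp => (Finset.mem_filter.1 (hT hp)).2, hn⟩
  have h4 := sieveFactor_nonneg hP n
  nlinarith

lemma sum_sieveFactor_coprime_le (hP : ∀ p ∈ P, p.Prime) {k : ℕ} (hk : 0 < k) {D : ℝ}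
    (hD : 1 / 2 ≤ D) (hkD : (k : ℝ) ^ 2 ≤ 2 * D) {N : ℕ} (hN : (N : ℝ) ≤ 2 * D) :
    ∑ h ∈ (Finset.Icc 1 N).filter (fun h => Nat.Coprime k h), sieveFactor P h ≤
      24 * D * (k.totient / k) := by
  classical
  have hk0 : (0 : ℝ) < k := by exact_mod_cast hk
  rcases Nat.eq_zero_or_pos N with rfl | hN0
  · simp; positivity
  have h1 : ∑ h ∈ (Finset.Icc 1 N).filter (fun h => Nat.Coprime k h), sieveFactor P h ≤
      ∑ h ∈ (Finset.Icc 1 N).filter (fun h => Nat.Coprime k h),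
        2 * ∑ d ∈ Finset.Icc 1 N, if d ∣ h then 1 / (d : ℝ) else 0 := by
    refine Finset.sum_le_sum fun h hh => ?_
    rw [Finset.mem_filter, Finset.mem_Icc] at hh
    refine (sieveFactor_le hP (by omega)).trans ?_
    rw [← Finset.sum_filter]
    refine mul_le_mul_of_nonneg_left (Finset.sum_le_sum_of_subset_of_nonneg ?_
      fun _ _ _ => by positivity) (by norm_num)
    intro d hd
    rw [Nat.mem_divisors] at hd
    have h2 := Nat.le_of_dvd (by omega) hd.1
    have h3 := Nat.pos_of_dvd_of_pos hd.1 (by omega)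
    exact Finset.mem_filter.2 ⟨Finset.mem_Icc.2 ⟨h3, by omega⟩, hd.1⟩
  have h2 : ∀ d ∈ Finset.Icc 1 N, (∑ h ∈ (Finset.Icc 1 N).filter (fun h => Nat.Coprime k h),
      if d ∣ h then 1 / (d : ℝ) else 0) ≤
        (k.totient / k) * (2 * D * (1 / (d : ℝ) ^ 2) + k * (1 / (d : ℝ))) := by
    intro d hd
    rw [Finset.mem_Icc] at hd
    have hd0 : (0 : ℝ) < d := by exact_mod_cast hd.1
    rw [← Finset.sum_filter, Finset.sum_const, nsmul_eq_mul]
    have h3 : (((Finset.Icc 1 N).filter (fun h => Nat.Coprime k h)).filter fun h => d ∣ h).card ≤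
        ((Finset.Ico 1 (1 + N / d)).filter fun h => Nat.Coprime k h).card := by
      refine Finset.card_le_card_of_injOn (fun h => h / d) ?_ ?_
      · intro h hh
        simp only [Finset.coe_filter, Set.mem_ofPred_eq, Finset.mem_filter, Finset.mem_Icc] at hh
        simp only [Finset.coe_filter, Set.mem_ofPred_eq, Finset.mem_Ico]
        obtain ⟨e, he⟩ := hh.2
        have h4 : h / d = e := by rw [he, Nat.mul_div_cancel_left _ (by omega)]
        have h5 : h / d ≤ N / d := Nat.div_le_div_right hh.1.1.2
        have h6 : e ≠ 0 := by rintro rfl; omega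
        refine ⟨by omega, ?_⟩
        rw [h4]
        exact Nat.Coprime.coprime_dvd_right ⟨d, by rw [he, mul_comm]⟩ hh.1.2
      · intro h hh h' hh' he
        simp only [Finset.coe_filter, Set.mem_ofPred_eq] at hh hh'
        rw [← Nat.div_mul_cancel hh.2, ← Nat.div_mul_cancel hh'.2]
        simp only at he
        rw [he]
    have h4 := h3.trans (Nat.Ico_filter_coprime_le 1 (N / d) hk.ne')
    have h5 : ((((Finset.Icc 1 N).filter (fun h => Nat.Coprime k h)).filter
        fun h => d ∣ h).card : ℝ) ≤ k.totient * (2 * D / d / k + 1) := by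
      refine (Nat.cast_le.2 h4).trans ?_
      push_cast
      have : ((N / d / k : ℕ) : ℝ) ≤ (N : ℝ) / d / k :=
        Nat.cast_div_le.trans (div_le_div_of_nonneg_right Nat.cast_div_le hk0.le)
      gcongr
      exact this.trans (by gcongr)
    calc _ ≤ (k.totient * (2 * D / d / k + 1)) * (1 / (d : ℝ)) := by gcongr
      _ = _ := by field_simp
  have hlog : (k : ℝ) * ∑ d ∈ Finset.Icc 1 N, 1 / (d : ℝ) ≤ 4 * D := by
    have h3 : ∑ d ∈ Finset.Icc 1 N, 1 / (d : ℝ) ≤ 1 + Real.log N := by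
      have := harmonic_le_one_add_log N
      rw [harmonic_eq_sum_Icc] at this
      push_cast at this
      simpa [one_div] using this
    have h4 : Real.log N ≤ 2 * (√(2 * D) - 1) := by
      have h5 : Real.log N ≤ Real.log (2 * D) :=
        Real.log_le_log (by exact_mod_cast hN0) hN
      have h6 := Real.log_le_sub_one_of_pos (Real.sqrt_pos.2 (by linarith : 0 < 2 * D))
      rw [Real.log_sqrt (by linarith)] at h6
      linarith
    have h7 : (k : ℝ) ≤ √(2 * D) := Real.le_sqrt_of_sq_le hkD
    have h8 : √(2 * D) * √(2 * D) = 2 * D := Real.mul_self_sqrt (by linarith)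
    calc (k : ℝ) * ∑ d ∈ Finset.Icc 1 N, 1 / (d : ℝ) ≤ √(2 * D) * (2 * √(2 * D)) := by
          gcongr
          linarith
      _ = 4 * D := by linarith
  have hsq := sum_Icc_inv_sq_le N
  have hsq' : ∑ d ∈ Finset.Icc 1 N, 1 / (d : ℝ) ^ 2 ≤ 2 := by
    have : 0 ≤ 1 / (N : ℝ) := by positivity
    linarith
  refine h1.trans ?_
  rw [← Finset.mul_sum, Finset.sum_comm]
  calc _ ≤ 2 * ∑ d ∈ Finset.Icc 1 N,
        (k.totient / k : ℝ) * (2 * D * (1 / (d : ℝ) ^ 2) + k * (1 / (d : ℝ))) := by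
        gcongr with d hd
        exact h2 d hd
    _ = 2 * ((k.totient / k : ℝ) * (2 * D * ∑ d ∈ Finset.Icc 1 N, (1 / (d : ℝ) ^ 2) +
          k * ∑ d ∈ Finset.Icc 1 N, 1 / (d : ℝ))) := by
        rw [← Finset.mul_sum, Finset.sum_add_distrib, ← Finset.mul_sum, ← Finset.mul_sum]
    _ ≤ 2 * ((k.totient / k : ℝ) * (2 * D * 2 + 4 * D)) := by gcongr
    _ ≤ _ := by
        have : 0 ≤ (k.totient / k : ℝ) * D := by positivity
        nlinarith

end SieveSum

section NearPairs

variable {P : Finset ℕ} {g u v : ℕ}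

lemma totient_prod_primes_div {Q : Finset ℕ} (hQ : ∀ p ∈ Q, p.Prime) :
    ((∏ p ∈ Q, p).totient : ℝ) / ((∏ p ∈ Q, p : ℕ) : ℝ) = ∏ p ∈ Q, (1 - 1 / (p : ℝ)) := by
  have h := Nat.totient_eq_mul_prod_factors (∏ p ∈ Q, p)
  rw [Nat.primeFactors_prod hQ] at h
  have h0 : ((∏ p ∈ Q, p : ℕ) : ℝ) ≠ 0 := by
    exact_mod_cast (Finset.prod_pos fun q hq => (hQ q hq).pos).ne'
  rw [div_eq_iff h0, mul_comm]
  have h' : (((∏ p ∈ Q, p).totient : ℚ) : ℝ) =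
      (((∏ p ∈ Q, p : ℕ) : ℚ) * ∏ p ∈ Q, (1 - (p : ℚ)⁻¹) : ℚ) := by rw [h]
  push_cast at h' ⊢
  simpa [one_div] using h'

lemma factorization_ne_of_dvd {p : ℕ} (hp : p.Prime) (hg : 0 < g) (hu : 0 < u) (hv : 0 < v)
    (huv : Nat.Coprime u v) (h : p ∣ u * v) :
    (g * v).factorization p ≠ (g * u).factorization p := by
  rw [Nat.factorization_mul hg.ne' hv.ne', Nat.factorization_mul hg.ne' hu.ne']
  simp only [Finsupp.add_apply, ne_eq, add_right_inj]
  rcases (hp.dvd_mul).1 h with h | h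
  · have hv' : ¬ p ∣ v := fun h' => hp.one_lt.ne' (Nat.eq_one_of_dvd_coprimes huv h h')
    rw [Nat.factorization_eq_zero_of_not_dvd hv']
    exact (hp.factorization_pos_of_dvd hu.ne' h).ne
  · have hv' : ¬ p ∣ u := fun h' => hp.one_lt.ne' (Nat.eq_one_of_dvd_coprimes huv h' h)
    rw [Nat.factorization_eq_zero_of_not_dvd hv']
    exact (hp.factorization_pos_of_dvd hv.ne' h).ne'

lemma sieveFactor_mul_prod_le (hP : ∀ p ∈ P, p.Prime) (hg : 0 < g) (hu : 0 < u) (hv : 0 < v)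
    (huv : Nat.Coprime u v) (z : ℕ) :
    sieveFactor P (u * v) * ∏ p ∈ P.filter (fun p => p ∣ u * v ∧ p ≤ z), (1 - 1 / (p : ℝ)) ≤
      Real.exp (2 * discrepancy z P (g * v).factorization (g * u).factorization) := by
  rw [sieveFactor, ← Finset.prod_filter_mul_prod_filter_not (P.filter (fun p => p ∣ u * v))
    (fun p => p ≤ z), Finset.filter_filter, Finset.filter_filter, mul_right_comm,
    ← Finset.prod_mul_distrib]
  rw [Finset.prod_eq_one (s := P.filter (fun p => p ∣ u * v ∧ p ≤ z)) (fun p hp =>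
    inv_mul_cancel₀ (one_sub_inv_mem (hP p (Finset.mem_filter.1 hp).1)).1.ne'), one_mul]
  rw [discrepancy, Finset.mul_sum, Real.exp_sum]
  have hsub : P.filter (fun p => p ∣ u * v ∧ ¬ p ≤ z) ⊆ P.filter (fun p : ℕ => (z : ℝ) < p) := by
    intro p hp
    simp only [Finset.mem_filter, not_le] at hp ⊢
    exact ⟨hp.1, by exact_mod_cast hp.2.2⟩
  refine le_trans ?_ (Finset.prod_le_prod_of_subset_of_one_le hsub (fun _ _ => by positivity)
    fun p _ _ => ?_)
  · refine Finset.prod_le_prod (fun p hp => ?_) fun p hp => ?_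
    · exact inv_nonneg.2 (one_sub_inv_mem (hP p (Finset.mem_filter.1 hp).1)).1.le
    · obtain ⟨hpP, hpd, -⟩ := Finset.mem_filter.1 hp
      have hpp := hP p hpP
      rw [if_neg (factorization_ne_of_dvd hpp hg hu hv huv hpd)]
      have h2 : (2 : ℝ) ≤ p := by exact_mod_cast hpp.two_le
      have hx : 1 / (p : ℝ) ≤ 1 / 2 := one_div_le_one_div_of_le (by norm_num) h2
      have hx0 : 0 < 1 / (p : ℝ) := by positivity
      refine le_trans ?_ (Real.add_one_le_exp _)
      rw [inv_le_iff_one_le_mul₀ (by linarith)]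
      nlinarith
  · refine Real.one_le_exp (mul_nonneg (by norm_num) ?_)
    split_ifs <;> positivity

lemma card_near_pairs_le (hP : ∀ p ∈ P, p.Prime) (hg : 0 < g) (hu : 0 < u) (hv : 0 < v)
    (huv : Nat.Coprime u v) {D : ℝ} (hD : 1 / 2 ≤ D) (z : ℕ)
    (hz : ((∏ p ∈ P.filter (fun p => p ∣ u * v ∧ p ≤ z), p : ℕ) : ℝ) ^ 2 ≤ 2 * D) :
    (((reducedResidues P (g * v) ×ˢ reducedResidues P (g * u)).filter (fun c =>
      (c.1 * u - c.2 * v : ℤ) ≠ 0 ∧ |((c.1 * u - c.2 * v : ℤ) : ℝ)| < 2 * D)).card : ℝ) ≤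
      48 * D * (g * (density P (g * v).factorization * density P (g * u).factorization)) *
        Real.exp (2 * discrepancy z P (g * v).factorization (g * u).factorization) := by
  classical
  set Q := P.filter (fun p => p ∣ u * v ∧ p ≤ z) with hQ
  have hQp : ∀ p ∈ Q, p.Prime := fun p hp => hP p (Finset.mem_filter.1 hp).1
  set k := ∏ p ∈ Q, p with hk
  have hk0 : 0 < k := Finset.prod_pos fun q hq => (hQp q hq).pos
  set N := ⌊2 * D⌋₊ with hN
  set B : ℝ := g * (density P (g * v).factorization * density P (g * u).factorization) *
    sieveFactor P (u * v) with hB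
  have hρ := mul_nonneg (density_pos hP (g * v).factorization).le
    (density_pos hP (g * u).factorization).le
  have hB0 : 0 ≤ B := mul_nonneg (mul_nonneg (by positivity) hρ) (sieveFactor_nonneg hP _)
  set J := (Finset.Icc 1 N).filter (Nat.Coprime k ·) with hJ
  have hsub : ((reducedResidues P (g * v) ×ˢ reducedResidues P (g * u)).filter (fun c =>
      (c.1 * u - c.2 * v : ℤ) ≠ 0 ∧ |((c.1 * u - c.2 * v : ℤ) : ℝ)| < 2 * D)) ⊆
      J.biUnion fun j => latticePairs P g u v j ∪ latticePairs P g u v (-j) := by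
    intro c hc
    obtain ⟨hc1, hc2, hc3⟩ := Finset.mem_filter.1 hc
    set h : ℤ := c.1 * u - c.2 * v with hh
    have hcl : c ∈ latticePairs P g u v h := Finset.mem_filter.2 ⟨hc1, rfl⟩
    refine Finset.mem_biUnion.2 ⟨h.natAbs, ?_, ?_⟩
    · refine Finset.mem_filter.2 ⟨Finset.mem_Icc.2 ⟨Int.natAbs_pos.2 hc2, Nat.le_floor ?_⟩, ?_⟩
      · rw [Nat.cast_natAbs, Int.cast_abs]
        exact hc3.le
      · refine Nat.Coprime.prod_left fun p hp => ?_
        obtain ⟨hpP, hpd, -⟩ := Finset.mem_filter.1 hp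
        rw [(hP p hpP).coprime_iff_not_dvd]
        have := not_dvd_of_mem_latticePairs hP huv hcl hpP hpd
        rwa [Int.natCast_dvd] at this
    · rw [Finset.mem_union]
      rcases Int.natAbs_eq h with h' | h'
      · left; rwa [← h']
      · right; rwa [← h']
  have hcard : ∀ j ∈ J, ((latticePairs P g u v j ∪ latticePairs P g u v (-j)).card : ℝ) ≤
      2 * B * sieveFactor P j := by
    intro j _
    have h1 := card_latticePairs_le_density hP hg hu hv huv (h := (j : ℤ))
    have h2 := card_latticePairs_le_density hP hg hu hv huv (h := -(j : ℤ))
    rw [Int.natAbs_neg] at h2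
    rw [Int.natAbs_natCast, ← hB] at h1 h2
    have h3 : ((latticePairs P g u v j ∪ latticePairs P g u v (-j)).card : ℝ) ≤
      (latticePairs P g u v j).card + (latticePairs P g u v (-j)).card := by
      exact_mod_cast Finset.card_union_le _ _
    linarith
  have hNle : (N : ℝ) ≤ 2 * D := Nat.floor_le (by linarith)
  calc _ ≤ ((J.biUnion fun j => latticePairs P g u v j ∪ latticePairs P g u v (-j)).card : ℝ) := by
        exact_mod_cast Finset.card_le_card hsub
    _ ≤ ∑ j ∈ J, ((latticePairs P g u v j ∪ latticePairs P g u v (-j)).card : ℝ) := by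
        exact_mod_cast Finset.card_biUnion_le
    _ ≤ ∑ j ∈ J, 2 * B * sieveFactor P j := Finset.sum_le_sum hcard
    _ = 2 * B * ∑ j ∈ J, sieveFactor P j := by rw [Finset.mul_sum]
    _ ≤ 2 * B * (24 * D * (k.totient / k)) := by
        gcongr
        exact sum_sieveFactor_coprime_le hP hk0 hD hz hNle
    _ = 48 * D * (g * (density P (g * v).factorization * density P (g * u).factorization)) *
        (sieveFactor P (u * v) * ∏ p ∈ Q, (1 - 1 / (p : ℝ))) := by
        rw [hk, totient_prod_primes_div hQp, hB]; ring
    _ ≤ _ := by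
        gcongr
        exact sieveFactor_mul_prod_le hP hg hu hv huv z

/-- The sieving level attached to the dyadic scale `2 ^ i`. -/
def sieveLevel (i : ℕ) : ℕ := max 1 (i / 4)

lemma prod_primes_le_sieveLevel_sq (hP : ∀ p ∈ P, p.Prime) (n i : ℕ) :
    (∏ p ∈ P.filter (fun p => p ∣ n ∧ p ≤ sieveLevel i), p) ^ 2 ≤ 2 ^ i := by
  have hsub : P.filter (fun p => p ∣ n ∧ p ≤ sieveLevel i) ⊆
      (Finset.range (i / 4 + 1)).filter Nat.Prime := by
    intro p hp
    obtain ⟨hpP, -, hpz⟩ := Finset.mem_filter.1 hp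
    have := (hP p hpP).two_le
    refine Finset.mem_filter.2 ⟨Finset.mem_range.2 ?_, hP p hpP⟩
    rcases le_max_iff.1 hpz with h | h <;> omega
  have h1 : ∏ p ∈ P.filter (fun p => p ∣ n ∧ p ≤ sieveLevel i), p ≤
      primorial (i / 4) :=
    Finset.prod_le_prod_of_subset_of_one_le' hsub
      fun p hp _ => (Finset.mem_filter.1 hp).2.one_lt.le
  calc _ ≤ (4 ^ (i / 4)) ^ 2 := Nat.pow_le_pow_left (h1.trans (primorial_le_four_pow _)) 2
    _ = 2 ^ (4 * (i / 4)) := by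
      rw [← pow_mul, show (4 : ℕ) = 2 ^ 2 by norm_num, ← pow_mul]; congr 1; ring
    _ ≤ 2 ^ i := Nat.pow_le_pow_right (by norm_num) (by omega)

end NearPairs

section Overlap

variable {P : Finset ℕ} {g u v : ℕ}

lemma card_reducedResidues (hP : ∀ p ∈ P, p.Prime) {n : ℕ} (hn : n ≠ 0) :
    ((reducedResidues P n).card : ℝ) = n * density P n.factorization := by
  classical
  set Q := P.filter (fun p => p ∣ n) with hQ
  have hQp : ∀ p ∈ Q, p.Prime := fun p hp => hP p (Finset.mem_filter.1 hp).1
  set k := ∏ p ∈ Q, p with hk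
  have hk0 : 0 < k := Finset.prod_pos fun q hq => (hQp q hq).pos
  have hkn : k ∣ n := Finset.prod_primes_dvd n (fun p hp => (hQp p hp).prime)
    fun p hp => (Finset.mem_filter.1 hp).2
  obtain ⟨t, ht⟩ := hkn
  have hcount : ∀ t : ℕ, ((Finset.range (k * t)).filter (Nat.Coprime k ·)).card =
      t * k.totient := by
    intro t
    induction t with
    | zero => simp
    | succ t ih =>
      have := Nat.filter_coprime_Ico_eq_totient k (k * t)
      have hd : Disjoint ((Finset.range (k * t)).filter (Nat.Coprime k ·))
          ((Finset.Ico (k * t) (k * t + k)).filter (Nat.Coprime k ·)) := by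
        refine Finset.disjoint_filter_filter ?_
        rw [Finset.range_eq_Ico]
        exact Finset.Ico_disjoint_Ico_consecutive _ _ _
      have hu : Finset.range (k * (t + 1)) =
          Finset.range (k * t) ∪ Finset.Ico (k * t) (k * t + k) := by
        rw [Finset.range_eq_Ico, Finset.range_eq_Ico,
          Finset.Ico_union_Ico_eq_Ico (Nat.zero_le _) (Nat.le_add_right _ _), mul_add, mul_one]
      rw [hu, Finset.filter_union, Finset.card_union_of_disjoint hd, ih, this]
      ring
  have hRR : reducedResidues P n = (Finset.range n).filter (Nat.Coprime k ·) := by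
    refine Finset.filter_congr fun a _ => ?_
    rw [hk, Nat.coprime_prod_left_iff]
    constructor
    · intro h p hp
      have hp' := Finset.mem_filter.1 hp
      exact ((hQp p hp).coprime_iff_not_dvd).2 (h p hp'.1 hp'.2)
    · intro h p hp hpn
      exact ((hP p hp).coprime_iff_not_dvd).1 (h p (Finset.mem_filter.2 ⟨hp, hpn⟩))
  have hcount' := hcount t
  rw [← ht] at hcount'
  rw [hRR, hcount', density_factorization hP hn, ← Finset.prod_filter,
    ← totient_prod_primes_div hQp, ← hk, ht]
  have : (k : ℝ) ≠ 0 := by exact_mod_cast hk0.ne'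
  push_cast
  field_simp

/-- The total length of the overlaps between the intervals centred at the reduced fractions with
denominators `m` and `n`. -/
noncomputable def overlap (P : Finset ℕ) (ψ : ℕ → ℝ) (m n : ℕ) : ℝ :=
  ∑ c ∈ reducedResidues P m ×ˢ reducedResidues P n,
    volume.real (Metric.ball ((c.1 : ℝ) / m) (ψ m / m) ∩ Metric.ball ((c.2 : ℝ) / n) (ψ n / n))

lemma volume_real_ball_inter_le (x y : ℝ) {r s : ℝ} (hr : 0 ≤ r) (hs : 0 ≤ s) :
    volume.real (Metric.ball x r ∩ Metric.ball y s) ≤ 2 * min r s := by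
  rw [mul_min_of_nonneg _ _ zero_le_two]
  refine le_min ?_ ?_
  · rw [← Real.volume_real_ball (a := x) hr]
    exact measureReal_mono Set.inter_subset_left (by simp [Real.volume_ball, ENNReal.mul_eq_top])
  · rw [← Real.volume_real_ball (a := y) hs]
    exact measureReal_mono Set.inter_subset_right (by simp [Real.volume_ball, ENNReal.mul_eq_top])

lemma volume_real_ball_inter_eq_zero {x y r s : ℝ} (h : r + s ≤ |x - y|) :
    volume.real (Metric.ball x r ∩ Metric.ball y s) = 0 := by
  rw [(Metric.ball_disjoint_ball (by rwa [Real.dist_eq])).inter_eq, measureReal_empty]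

lemma overlap_self (hP : ∀ p ∈ P, p.Prime) {ψ : ℕ → ℝ} {n : ℕ} (hn : n ≠ 0) (h0 : 0 ≤ ψ n)
    (h1 : ψ n ≤ 1 / 2) :
    overlap P ψ n n = 2 * (ψ n * density P n.factorization) := by
  classical
  have hn' : (0 : ℝ) < n := by exact_mod_cast hn.bot_lt
  rw [overlap, Finset.sum_product]
  have : ∀ a ∈ reducedResidues P n, ∑ b ∈ reducedResidues P n, volume.real
      (Metric.ball ((a : ℝ) / n) (ψ n / n) ∩ Metric.ball ((b : ℝ) / n) (ψ n / n)) =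
      2 * (ψ n / n) := by
    intro a ha
    rw [Finset.sum_eq_single_of_mem a ha, Set.inter_self, Real.volume_real_ball (by positivity)]
    intro b _ hb
    refine volume_real_ball_inter_eq_zero ?_
    rw [← sub_div, abs_div, abs_of_pos hn', ← add_div]
    gcongr
    have : (1 : ℝ) ≤ |(a : ℝ) - b| := by
      have : (1 : ℤ) ≤ |(a : ℤ) - b| := Int.one_le_abs (by omega)
      exact_mod_cast this
    linarith
  rw [Finset.sum_congr rfl this, Finset.sum_const, nsmul_eq_mul, card_reducedResidues hP hn]
  field_simp

lemma lt_max_of_mem_latticePairs_zero {Y : ℕ} (huv : Nat.Coprime u v) (hne : u ≠ v)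
    (hu : 0 < u) (hv : 0 < v)
    {c : ℕ × ℕ} (hc : c ∈ latticePairs ((Finset.range (Y + 1)).filter Nat.Prime) g u v 0) :
    Y < max u v := by
  have h1 : u * v ≠ 1 := by
    intro h
    exact hne ((Nat.eq_one_of_mul_eq_one_right h).trans (Nat.eq_one_of_mul_eq_one_left h).symm)
  obtain ⟨p, hp, hpd⟩ := Nat.exists_prime_and_dvd h1
  by_contra hY
  push Not at hY
  have hpY : p ≤ max u v := by
    rcases hp.dvd_mul.1 hpd with h | h
    · exact (Nat.le_of_dvd hu h).trans (le_max_left _ _)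
    · exact (Nat.le_of_dvd hv h).trans (le_max_right _ _)
  exact not_dvd_of_mem_latticePairs (fun q hq => (Finset.mem_filter.1 hq).2) huv hc
    (Finset.mem_filter.2 ⟨Finset.mem_range.2 (by omega), hp⟩) hpd (by simp)

/-- The scale of the pair `(m, n)`. -/
noncomputable def pairScale (ψ : ℕ → ℝ) (m n : ℕ) : ℝ :=
  max (n * ψ m) (m * ψ n) / (Nat.gcd m n)

lemma exists_coprime_mul {m n : ℕ} (hm : m ≠ 0) (hn : n ≠ 0) :
    ∃ g v u : ℕ, 0 < g ∧ 0 < v ∧ 0 < u ∧ Nat.Coprime u v ∧ m = g * v ∧ n = g * u := by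
  obtain ⟨v, u, huv, hv, hu⟩ := Nat.exists_coprime m n
  refine ⟨m.gcd n, v, u, Nat.gcd_pos_of_pos_left _ hm.bot_lt, Nat.pos_of_ne_zero fun h => ?_,
    Nat.pos_of_ne_zero fun h => ?_, huv.symm, by rw [mul_comm]; exact hv,
    by rw [mul_comm]; exact hu⟩
  · exact hm (by rw [hv, h, zero_mul])
  · exact hn (by rw [hu, h, zero_mul])

lemma pairScale_mul (ψ : ℕ → ℝ) (hg : 0 < g) (huv : Nat.Coprime u v) :
    pairScale ψ (g * v) (g * u) = max (u * ψ (g * v)) (v * ψ (g * u)) := by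
  have hg' : (0 : ℝ) < g := by exact_mod_cast hg
  rw [pairScale, Nat.gcd_mul_left, huv.symm.gcd_eq_one, mul_one, div_eq_iff hg'.ne',
    max_mul_of_nonneg _ _ hg'.le]
  push_cast
  congr 1 <;> ring

lemma overlap_le {Y : ℕ} (hY : 0 < Y) {ψ : ℕ → ℝ} {m n : ℕ} (hm : m ≠ 0) (hn : n ≠ 0)
    (hmn : m ≠ n) (hψm : 0 < ψ m) (hψn : 0 < ψ n) (hψm1 : ψ m ≤ 1) (hψn1 : ψ n ≤ 1)
    (hP : P = (Finset.range (Y + 1)).filter Nat.Prime) :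
    overlap P ψ m n ≤ 96 * (ψ m * density P m.factorization * (ψ n * density P n.factorization)) *
      (if 1 / 2 ≤ pairScale ψ m n then Real.exp (2 * discrepancy
        (sieveLevel (Nat.log 2 ⌊2 * pairScale ψ m n⌋₊)) P m.factorization n.factorization) else 0) +
      2 / Y := by
  classical
  have hPp : ∀ p ∈ P, p.Prime := fun p hp => (Finset.mem_filter.1 (hP ▸ hp)).2
  obtain ⟨g, v, u, hg, hv, hu, huv, rfl, rfl⟩ := exists_coprime_mul hm hn
  have huv' : u ≠ v := fun h => by simp [h] at hmn
  have hg' : (0 : ℝ) < g := by exact_mod_cast hg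
  have hu' : (0 : ℝ) < u := by exact_mod_cast hu
  have hv' : (0 : ℝ) < v := by exact_mod_cast hv
  set x := ψ (g * v) with hx
  set y := ψ (g * u) with hy
  set D := pairScale ψ (g * v) (g * u) with hD
  have hDeq : D = max (u * x) (v * y) := pairScale_mul ψ hg huv
  have hD0 : 0 < D := by rw [hDeq]; exact lt_max_of_lt_left (by positivity)
  set R := reducedResidues P (g * v) ×ˢ reducedResidues P (g * u) with hR
  set V : ℕ × ℕ → ℝ := fun c => volume.real (
      Metric.ball ((c.1 : ℝ) / (g * v : ℕ)) (x / (g * v : ℕ)) ∩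
    Metric.ball ((c.2 : ℝ) / (g * u : ℕ)) (y / (g * u : ℕ))) with hV
  set M := min (x / (g * v : ℕ)) (y / (g * u : ℕ)) with hM
  have hVle : ∀ c, V c ≤ 2 * M := fun c =>
    volume_real_ball_inter_le _ _ (by positivity) (by positivity)
  have hM0 : 0 ≤ M := le_min (by positivity) (by positivity)
  have hMD : M = x * y / (g * D) := by
    have hMe : M = min (u * x) (v * y) / (g * u * v) := by
      rw [eq_div_iff (by positivity), hM, min_mul_of_nonneg _ _ (by positivity)]
      push_cast
      congr 1 <;> field_simp
    rw [hMe, div_eq_div_iff (by positivity) (by positivity)]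
    have := min_mul_max (u * x) (v * y)
    rw [← hDeq] at this
    linear_combination g * this
  have hVz : ∀ c : ℕ × ℕ, 2 * D ≤ |((c.1 * u - c.2 * v : ℤ) : ℝ)| → V c = 0 := by
    intro c hc
    refine volume_real_ball_inter_eq_zero ?_
    have e1 : (c.1 : ℝ) / (g * v : ℕ) - (c.2 : ℝ) / (g * u : ℕ) =
        ((c.1 * u - c.2 * v : ℤ) : ℝ) / (g * u * v) := by
      push_cast; field_simp
    have e2 : x / (g * v : ℕ) + y / (g * u : ℕ) = (u * x + v * y) / (g * u * v) := by
      push_cast; field_simp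
    rw [e1, e2, abs_div, abs_of_pos (a := (g * u * v : ℝ)) (by positivity)]
    gcongr
    have h1 : u * x ≤ D := hDeq ▸ le_max_left _ _
    have h2 : v * y ≤ D := hDeq ▸ le_max_right _ _
    linarith
  have hsum : overlap P ψ (g * v) (g * u) = ∑ c ∈ R, V c := rfl
  set A := R.filter (fun c => (c.1 * u - c.2 * v : ℤ) ≠ 0 ∧
    |((c.1 * u - c.2 * v : ℤ) : ℝ)| < 2 * D) with hA
  have hsplit : ∑ c ∈ R, V c ≤ A.card * (2 * M) + (latticePairs P g u v 0).card * (2 * M) := by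
    have h1 : ∑ c ∈ R, V c = ∑ c ∈ A ∪ latticePairs P g u v 0, V c := by
      refine (Finset.sum_subset ?_ fun c hc hc' => hVz c ?_).symm
      · exact Finset.union_subset (Finset.filter_subset _ _) (Finset.filter_subset _ _)
      · by_contra hlt
        push Not at hlt
        refine hc' (Finset.mem_union.2 ?_)
        by_cases h0 : (c.1 * u - c.2 * v : ℤ) = 0
        · exact Or.inr (Finset.mem_filter.2 ⟨hc, h0⟩)
        · exact Or.inl (Finset.mem_filter.2 ⟨hc, h0, hlt⟩)
    rw [h1, ← add_mul]
    calc _ ≤ (A ∪ latticePairs P g u v 0).card • (2 * M) :=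
          Finset.sum_le_card_nsmul _ _ _ fun c _ => hVle c
      _ ≤ _ := by
          rw [nsmul_eq_mul]
          gcongr
          exact_mod_cast Finset.card_union_le _ _
  rw [hsum]
  refine hsplit.trans (add_le_add ?_ ?_)
  · split_ifs with h
    · have hcard := card_near_pairs_le (P := P) hPp hg hu hv huv h
        (sieveLevel (Nat.log 2 ⌊2 * D⌋₊)) (by
          have h1 := prod_primes_le_sieveLevel_sq hPp (u * v) (Nat.log 2 ⌊2 * D⌋₊)
          have h2 : 2 ^ (Nat.log 2 ⌊2 * D⌋₊) ≤ ⌊2 * D⌋₊ :=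
            Nat.pow_log_le_self 2 (Nat.floor_pos.2 (by linarith)).ne'
          calc _ ≤ ((⌊2 * D⌋₊ : ℕ) : ℝ) := by exact_mod_cast h1.trans h2
            _ ≤ 2 * D := Nat.floor_le (by linarith))
      rw [← hA] at hcard
      refine (mul_le_mul_of_nonneg_right hcard (by positivity)).trans (le_of_eq ?_)
      rw [hMD]
      field_simp
      ring
    · have hA0 : A = ∅ := by
        refine Finset.filter_eq_empty_iff.2 fun c _ hc => ?_
        have : (1 : ℝ) ≤ |((c.1 * u - c.2 * v : ℤ) : ℝ)| := by
          rw [← Int.cast_abs]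
          exact_mod_cast Int.one_le_abs hc.1
        push Not at h
        linarith [hc.2]
      simp [hA0]
  · rcases (latticePairs P g u v 0).eq_empty_or_nonempty with h | ⟨c, hc⟩
    · rw [h, Finset.card_empty, Nat.cast_zero, zero_mul]; positivity
    · have hlt := lt_max_of_mem_latticePairs_zero huv huv' hu hv (hP ▸ hc)
      have hcard : ((latticePairs P g u v 0).card : ℝ) ≤ g := by
        exact_mod_cast card_latticePairs_le_self hv huv
      have hgM : g * M ≤ 1 / Y := by
        rcases lt_max_iff.1 hlt with h | h
        · calc g * M ≤ g * (y / (g * u : ℕ)) := by gcongr; exact min_le_right _ _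
            _ = y / u := by push_cast; field_simp
            _ ≤ 1 / Y := by gcongr
        · calc g * M ≤ g * (x / (g * v : ℕ)) := by gcongr; exact min_le_left _ _
            _ = x / v := by push_cast; field_simp
            _ ≤ 1 / Y := by gcongr
      calc _ ≤ g * (2 * M) := by gcongr
        _ = 2 * (g * M) := by ring
        _ ≤ 2 * (1 / Y) := by gcongr
        _ = 2 / Y := by ring

end Overlap

section SecondMoment

lemma sq_sum_measureReal_le {κ : Type*} (Λ : Finset κ) (A : κ → Set ℝ)
    (hA : ∀ c ∈ Λ, MeasurableSet (A c)) (hfin : ∀ c ∈ Λ, volume (A c) ≠ ⊤) :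
    (∑ c ∈ Λ, volume.real (A c)) ^ 2 ≤
      volume.real (⋃ c ∈ Λ, A c) * ∑ c ∈ Λ, ∑ d ∈ Λ, volume.real (A c ∩ A d) := by
  set U := ⋃ c ∈ Λ, A c with hU
  have hUm : MeasurableSet U := Finset.measurableSet_biUnion _ hA
  have hUfin : volume U ≠ ⊤ := by
    refine ((measure_biUnion_finset_le _ _).trans_lt ?_).ne
    exact ENNReal.sum_lt_top.2 fun c hc => (hfin c hc).lt_top
  have hintegrable : ∀ {s : Set ℝ}, MeasurableSet s → volume s ≠ ⊤ →
      Integrable (s.indicator (1 : ℝ → ℝ)) := fun hs h =>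
    (integrable_indicator_iff hs).2 (integrableOn_const h)
  have hinter : ∀ c ∈ Λ, ∀ d, volume (A c ∩ d) ≠ ⊤ := fun c hc d =>
    measure_ne_top_of_subset Set.inter_subset_left (hfin c hc)
  set f : ℝ → ℝ := fun x => ∑ c ∈ Λ, (A c).indicator (1 : ℝ → ℝ) x with hf
  set S := ∑ c ∈ Λ, volume.real (A c) with hS
  set M := ∑ c ∈ Λ, ∑ d ∈ Λ, volume.real (A c ∩ A d) with hM
  have key : ∀ t : ℝ, 0 ≤ volume.real U * (t * t) + (-2 * S) * t + M := by
    intro t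
    have h1 : ∫ x, (f x - t * U.indicator (1 : ℝ → ℝ) x) ^ 2 =
        volume.real U * (t * t) + (-2 * S) * t + M := by
      have h2 : ∀ x, (f x - t * U.indicator (1 : ℝ → ℝ) x) ^ 2 =
          ((∑ c ∈ Λ, ∑ d ∈ Λ, (A c ∩ A d).indicator (1 : ℝ → ℝ) x) +
            ∑ c ∈ Λ, (-2 * t) * (A c).indicator (1 : ℝ → ℝ) x) +
            (t * t) * U.indicator (1 : ℝ → ℝ) x := by
        intro x
        have e1 : f x * f x = ∑ c ∈ Λ, ∑ d ∈ Λ, (A c ∩ A d).indicator (1 : ℝ → ℝ) x := by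
          rw [hf, Finset.sum_mul_sum]
          refine Finset.sum_congr rfl fun c _ => Finset.sum_congr rfl fun d _ => ?_
          rw [Set.inter_indicator_one]; rfl
        have e2 : f x * U.indicator (1 : ℝ → ℝ) x = f x := by
          rw [hf, Finset.sum_mul]
          refine Finset.sum_congr rfl fun c hc => ?_
          by_cases hx : x ∈ A c
          · have : x ∈ U := Set.mem_biUnion hc hx
            simp [hx, this]
          · simp [hx]
        have e3 : U.indicator (1 : ℝ → ℝ) x * U.indicator (1 : ℝ → ℝ) x =
            U.indicator (1 : ℝ → ℝ) x := by
          by_cases hx : x ∈ U <;> simp [hx]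
        rw [← e1, ← Finset.mul_sum]
        change _ = f x * f x + -2 * t * f x + _
        linear_combination (-2 * t) * e2 + t ^ 2 * e3
      simp_rw [h2]
      have i1 : ∀ c ∈ Λ, ∀ d ∈ Λ, Integrable ((A c ∩ A d).indicator (1 : ℝ → ℝ)) :=
        fun c hc d hd => hintegrable ((hA c hc).inter (hA d hd)) (hinter c hc _)
      rw [integral_add, integral_add, integral_finsetSum, integral_finsetSum, integral_const_mul,
        integral_indicator_one hUm]
      · have e4 : ∀ c ∈ Λ, ∫ x, ∑ d ∈ Λ, (A c ∩ A d).indicator (1 : ℝ → ℝ) x =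
            ∑ d ∈ Λ, volume.real (A c ∩ A d) := by
          intro c hc
          rw [integral_finsetSum _ fun d hd => i1 c hc d hd]
          exact Finset.sum_congr rfl fun d hd =>
            integral_indicator_one ((hA c hc).inter (hA d hd))
        have e5 : ∀ c ∈ Λ, ∫ x, (-2 * t) * (A c).indicator (1 : ℝ → ℝ) x =
            (-2 * t) * volume.real (A c) := by
          intro c hc
          rw [integral_const_mul, integral_indicator_one (hA c hc)]
        rw [Finset.sum_congr rfl e4, Finset.sum_congr rfl e5, ← Finset.mul_sum]
        ring
      · exact fun c hc => (hintegrable (hA c hc) (hfin c hc)).const_mul _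
      · exact fun c hc => integrable_finsetSum _ fun d hd => i1 c hc d hd
      · exact integrable_finsetSum _ fun c hc => integrable_finsetSum _ fun d hd => i1 c hc d hd
      · exact integrable_finsetSum _ fun c hc => (hintegrable (hA c hc) (hfin c hc)).const_mul _
      · exact (integrable_finsetSum _ fun c hc =>
          integrable_finsetSum _ fun d hd => i1 c hc d hd).add
          (integrable_finsetSum _ fun c hc => (hintegrable (hA c hc) (hfin c hc)).const_mul _)
      · exact (hintegrable hUm hUfin).const_mul _
    rw [← h1]
    exact integral_nonneg fun x => sq_nonneg _
  have := discrim_le_zero key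
  rw [discrim] at this
  linarith

end SecondMoment

section Scales

variable {P : Finset ℕ} {g u v : ℕ}

lemma primeProd_factorization_sub_le (hP : ∀ p ∈ P, p.Prime) (hg : 0 < g) (hu : 0 < u)
    (hv : 0 < v) :
    (primeProd P fun p => (g * v).factorization p - (g * u).factorization p) ≤ v := by
  classical
  calc _ ≤ ∏ p ∈ P, p ^ v.factorization p := by
        refine Finset.prod_le_prod' fun p hp => Nat.pow_le_pow_right (hP p hp).pos ?_
        rw [Nat.factorization_mul hg.ne' hv.ne', Nat.factorization_mul hg.ne' hu.ne']
        simp only [Finsupp.add_apply]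
        omega
    _ ≤ ∏ p ∈ P ∪ v.primeFactors, p ^ v.factorization p := by
        refine Finset.prod_le_prod_of_subset_of_one_le' Finset.subset_union_left fun p hp _ => ?_
        rcases Finset.mem_union.1 hp with h | h
        · exact Nat.one_le_pow _ _ (hP p h).pos
        · exact Nat.one_le_pow _ _ (Nat.prime_of_mem_primeFactors h).pos
    _ = ∏ p ∈ v.primeFactors, p ^ v.factorization p := by
        refine (Finset.prod_subset Finset.subset_union_right fun p _ hp => ?_).symm
        rw [← Nat.support_factorization, Finsupp.notMem_support_iff] at hp
        rw [hp, pow_zero]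
    _ = v := Nat.prod_factorization_pow_eq_self hv.ne'

lemma mul_le_of_pairScale_le {ψ : ℕ → ℝ} {Λ D : ℝ} (hΛ : 0 < Λ) (hg : 0 < g)
    (huv : Nat.Coprime u v)
    (hm : 1 / Λ ≤ ψ (g * v)) (hn : 1 / Λ ≤ ψ (g * u)) (hD : pairScale ψ (g * v) (g * u) ≤ D) :
    u ≤ Λ * D ∧ v ≤ Λ * D := by
  rw [pairScale_mul ψ hg huv] at hD
  have h1 := (le_max_left _ _).trans hD
  have h2 := (le_max_right _ _).trans hD
  rw [div_le_iff₀ hΛ] at hm hn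
  constructor
  · calc (u : ℝ) = u * 1 := (mul_one _).symm
      _ ≤ u * (ψ (g * v) * Λ) := by gcongr
      _ = Λ * (u * ψ (g * v)) := by ring
      _ ≤ Λ * D := by gcongr
  · calc (v : ℝ) = v * 1 := (mul_one _).symm
      _ ≤ v * (ψ (g * u) * Λ) := by gcongr
      _ = Λ * (v * ψ (g * u)) := by ring
      _ ≤ Λ * D := by gcongr

lemma factorization_eq_of_pairScale_lt {ψ : ℕ → ℝ} {Λ : ℕ} (hΛ : 0 < Λ) {m n : ℕ} (hm0 : m ≠ 0)
    (hn0 : n ≠ 0) (hm : 1 / (Λ : ℝ) ≤ ψ m) (hn : 1 / (Λ : ℝ) ≤ ψ n)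
    (hD : pairScale ψ m n < Λ) {p : ℕ} (hp : Λ ^ 2 < p) :
    m.factorization p = n.factorization p := by
  obtain ⟨g, v, u, hg, hv, hu, huv, rfl, rfl⟩ := exists_coprime_mul hm0 hn0
  obtain ⟨h1, h2⟩ := mul_le_of_pairScale_le (by exact_mod_cast hΛ) hg huv hm hn hD.le
  have h1 : u ≤ Λ * Λ := by exact_mod_cast h1
  have h2 : v ≤ Λ * Λ := by exact_mod_cast h2
  rw [Nat.factorization_mul hg.ne' hv.ne', Nat.factorization_mul hg.ne' hu.ne']
  simp only [Finsupp.add_apply]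
  rw [Nat.factorization_eq_zero_of_not_dvd fun h => absurd (Nat.le_of_dvd hv h) (by nlinarith),
    Nat.factorization_eq_zero_of_not_dvd fun h => absurd (Nat.le_of_dvd hu h) (by nlinarith)]

lemma dvd_mul_of_factorization_ne {p : ℕ} (hg : 0 < g) (hu : 0 < u)
    (hv : 0 < v) (h : (g * v).factorization p ≠ (g * u).factorization p) : p ∣ u * v := by
  rw [Nat.factorization_mul hg.ne' hv.ne', Nat.factorization_mul hg.ne' hu.ne'] at h
  simp only [Finsupp.add_apply, ne_eq, add_right_inj] at h
  by_contra hd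
  refine h ?_
  rw [Nat.factorization_eq_zero_of_not_dvd fun h => hd (Dvd.dvd.mul_left h _),
    Nat.factorization_eq_zero_of_not_dvd fun h => hd (Dvd.dvd.mul_right h _)]

lemma le_eight_mul_sieveLevel (i : ℕ) : i ≤ 8 * sieveLevel i := by
  unfold sieveLevel; omega

lemma discrepancy_le_of_le_pairScale (hP : ∀ p ∈ P, p.Prime) {ψ : ℕ → ℝ} {Λ : ℝ} (hΛ : 1 ≤ Λ)
    {m n : ℕ} (hm0 : m ≠ 0) (hn0 : n ≠ 0) (hm : 1 / Λ ≤ ψ m) (hn : 1 / Λ ≤ ψ n)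
    (hD : Λ ≤ pairScale ψ m n) :
    discrepancy (sieveLevel (Nat.log 2 ⌊2 * pairScale ψ m n⌋₊)) P m.factorization
      n.factorization ≤ 32 := by
  classical
  obtain ⟨g, v, u, hg, hv, hu, huv, rfl, rfl⟩ := exists_coprime_mul hm0 hn0
  set D := pairScale ψ (g * v) (g * u) with hDdef
  set i := Nat.log 2 ⌊2 * D⌋₊ with hi
  obtain ⟨h1, h2⟩ := mul_le_of_pairScale_le (by linarith) hg huv hm hn le_rfl
  rw [← hDdef] at h1 h2
  have hD0 : 0 ≤ D := by linarith
  have hDi : D < 2 ^ i := by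
    have h3 : ⌊2 * D⌋₊ < 2 ^ (i + 1) := Nat.lt_pow_succ_log_self (by norm_num) _
    rw [Nat.floor_lt (by linarith)] at h3
    push_cast [pow_succ] at h3
    linarith
  set Q := P.filter (fun p => (g * v).factorization p ≠ (g * u).factorization p) with hQ
  have hQp : ∀ p ∈ Q, p.Prime := fun p hp => hP p (Finset.mem_filter.1 hp).1
  have hcard : Q.card ≤ 4 * i := by
    have h4 : 2 ^ Q.card ≤ u * v := by
      calc 2 ^ Q.card = ∏ _p ∈ Q, 2 := by rw [Finset.prod_const]
        _ ≤ ∏ p ∈ Q, p := Finset.prod_le_prod' fun p hp => (hQp p hp).two_le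
        _ ≤ u * v := Nat.le_of_dvd (by positivity) (Finset.prod_primes_dvd _
            (fun p hp => (hQp p hp).prime) fun p hp =>
            dvd_mul_of_factorization_ne hg hu hv (Finset.mem_filter.1 hp).2)
    have h5 : (2 : ℝ) ^ Q.card ≤ 2 ^ (4 * i) := by
      calc (2 : ℝ) ^ Q.card ≤ u * v := by exact_mod_cast h4
        _ ≤ (D * D) * (D * D) := by
            gcongr
            · exact h1.trans (by gcongr)
            · exact h2.trans (by gcongr)
        _ = D ^ 4 := by ring
        _ ≤ (2 ^ i) ^ 4 := by gcongr
        _ = 2 ^ (4 * i) := by rw [← pow_mul, mul_comm]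
    exact (pow_le_pow_iff_right₀ (by norm_num)).1 h5
  set z := sieveLevel i with hz
  have hz0 : 0 < z := lt_of_lt_of_le one_pos (le_max_left _ _)
  have hz0' : (0 : ℝ) < z := by exact_mod_cast hz0
  have hiz : i ≤ 8 * z := le_eight_mul_sieveLevel i
  calc discrepancy z P (g * v).factorization (g * u).factorization
      ≤ ∑ p ∈ P, if (g * v).factorization p ≠ (g * u).factorization p then 1 / (z : ℝ) else 0 := by
        rw [discrepancy, Finset.sum_filter]
        refine Finset.sum_le_sum fun p _ => ?_
        by_cases h : (g * v).factorization p = (g * u).factorization p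
        · simp [h]
        · simp only [h, ite_false, ne_eq, not_false_eq_true, ite_true]
          split_ifs with hp
          · gcongr
          · positivity
    _ = Q.card * (1 / (z : ℝ)) := by rw [← Finset.sum_filter, Finset.sum_const, nsmul_eq_mul]
    _ ≤ 32 := by
        rw [mul_one_div, div_le_iff₀ hz0']
        have : Q.card ≤ 32 * z := by omega
        exact_mod_cast this

end Scales

section SmallScales

/-- The discrepancy of a pair above the sieving level attached to its scale. -/
noncomputable def scaleDiscrepancy (P : Finset ℕ) (ψ : ℕ → ℝ) (m n : ℕ) : ℝ :=
  discrepancy (sieveLevel (Nat.log 2 ⌊2 * pairScale ψ m n⌋₊)) P m.factorization n.factorization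

/-- Approximation functions `ψ` on `X` bounded below by `1 / Λ`. -/
structure IsAdmissibleFamily (X : Finset ℕ) (ψ : ℕ → ℝ) (Λ : ℕ) : Prop where
  pos : ∀ n, 0 < ψ n
  ne_zero : ∀ n ∈ X, n ≠ 0
  le_half : ∀ n ∈ X, ψ n ≤ 1 / 2
  inv_le : ∀ n ∈ X, 1 / (Λ : ℝ) ≤ ψ n
  one_le : 1 ≤ Λ
  card_le : X.card ≤ Λ

lemma admissible_of_pairScale_lt {X : Finset ℕ} {ψ : ℕ → ℝ} {Λ : ℕ}
    (h : IsAdmissibleFamily X ψ Λ) (i : ℕ) (E : ℕ → ℕ → Prop)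
    (hE : ∀ m ∈ X, ∀ n ∈ X, E m n → pairScale ψ m n < Λ ∧
      Nat.log 2 ⌊2 * pairScale ψ m n⌋₊ = i) :
    Admissible ((Finset.range (Λ ^ 2 + 1)).filter Nat.Prime) (fun n p : ℕ => n.factorization p)
      (fun n => ψ n / 2 ^ i) (fun n => ψ n / 2 ^ i) E X X := by
  set P := (Finset.range (Λ ^ 2 + 1)).filter Nat.Prime with hP
  have hPp : ∀ p ∈ P, p.Prime := fun p hp => (Finset.mem_filter.1 hp).2
  have hscale : ∀ m ∈ X, ∀ n ∈ X, E m n → pairScale ψ m n < 2 ^ i := by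
    intro m hm n hn hmn
    have h3 : ⌊2 * pairScale ψ m n⌋₊ < 2 ^ (i + 1) :=
      (hE m hm n hn hmn).2 ▸ Nat.lt_pow_succ_log_self (by norm_num) _
    have h0 : 0 ≤ pairScale ψ m n :=
      div_nonneg (le_max_of_le_left (mul_nonneg (Nat.cast_nonneg _) (h.pos m).le))
        (Nat.cast_nonneg _)
    rw [Nat.floor_lt (by linarith)] at h3
    push_cast [pow_succ] at h3
    linarith
  have hagree : ∀ m ∈ X, ∀ n ∈ X, E m n → ∀ p ∉ P, m.factorization p = n.factorization p := by
    intro m hm n hn hmn p hp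
    by_cases hpp : p.Prime
    · refine factorization_eq_of_pairScale_lt h.one_le (h.ne_zero m hm) (h.ne_zero n hn)
        (h.inv_le m hm) (h.inv_le n hn) (hE m hm n hn hmn).1 ?_
      by_contra hle
      exact hp (Finset.mem_filter.2 ⟨Finset.mem_range.2 (by omega), hpp⟩)
    · rw [Nat.factorization_eq_zero_of_not_prime _ hpp,
        Nat.factorization_eq_zero_of_not_prime _ hpp]
  refine ⟨?_, ?_, ?_, ?_⟩
  · intro m hm n hn hmn
    obtain ⟨g, v, u, hg, hv, hu, huv, rfl, rfl⟩ := exists_coprime_mul (h.ne_zero m hm)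
      (h.ne_zero n hn)
    have h1 := primeProd_factorization_sub_le hPp hg hu hv
    have h2 := hscale _ hm _ hn hmn
    rw [pairScale_mul ψ hg huv] at h2
    have h3 := (le_max_right _ _).trans_lt h2
    have h4 := h.pos (g * u)
    rw [← mul_div_assoc, div_le_one (by positivity)]
    refine le_trans ?_ h3.le
    gcongr
  · intro m hm n hn hmn
    obtain ⟨g, v, u, hg, hv, hu, huv, rfl, rfl⟩ := exists_coprime_mul (h.ne_zero m hm)
      (h.ne_zero n hn)
    have h1 := primeProd_factorization_sub_le hPp hg hv hu
    have h2 := hscale _ hm _ hn hmn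
    rw [pairScale_mul ψ hg huv] at h2
    have h3 := (le_max_left _ _).trans_lt h2
    have h4 := h.pos (g * v)
    rw [← mul_div_assoc, div_le_one (by positivity)]
    refine le_trans ?_ h3.le
    gcongr
  · intro v hv w hw w' hw' hvw hvw' hx
    refine Nat.eq_of_factorization_eq (h.ne_zero w hw) (h.ne_zero w' hw') fun p => ?_
    by_cases hp : p ∈ P
    · exact hx p hp
    · rw [← hagree v hv w hw hvw p hp, hagree v hv w' hw' hvw' p hp]
  · intro w hw v hv v' hv' hvw hvw' hx
    refine Nat.eq_of_factorization_eq (h.ne_zero v hv) (h.ne_zero v' hv') fun p => ?_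
    by_cases hp : p ∈ P
    · exact hx p hp
    · rw [hagree v hv w hw hvw p hp, hagree v' hv' w hw hvw' p hp]

lemma sum_geometric_half_le (n : ℕ) : ∑ i ∈ Finset.range n, (1 / 2 : ℝ) ^ i ≤ 2 := by
  have h := summable_geometric_two.sum_le_tsum (Finset.range n) fun i _ => by positivity
  rwa [tsum_geometric_two] at h

lemma exp_coeff_le (i K : ℕ) (hK : 1 ≤ K) :
    Real.exp (2 * K + 2) * (2 ^ i * 2 ^ i * Real.exp (-(40 * (sieveLevel i : ℝ) * K))) ≤
      Real.exp 2 * ((1 / 2) ^ i * (1 / 2) ^ K) := by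
  have he : (1 / 2 : ℝ) ≥ Real.exp (-1) := by
    rw [Real.exp_neg, ge_iff_le, one_div]
    exact inv_anti₀ (by norm_num) (by linarith [Real.add_one_le_exp (1 : ℝ)])
  have h2 : (2 : ℝ) ≤ Real.exp 1 := by linarith [Real.add_one_le_exp (1 : ℝ)]
  have hpow : ∀ j : ℕ, Real.exp (-(j : ℝ)) ≤ (1 / 2) ^ j := fun j => by
    calc Real.exp (-(j : ℝ)) = Real.exp (-1) ^ j := by rw [← Real.exp_nat_mul]; ring_nf
      _ ≤ _ := by gcongr
  have hpow2 : (2 : ℝ) ^ i ≤ Real.exp i := by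
    calc (2 : ℝ) ^ i ≤ Real.exp 1 ^ i := by gcongr
      _ = _ := by rw [← Real.exp_nat_mul]; ring_nf
  have hz : (i : ℝ) ≤ 8 * sieveLevel i := by exact_mod_cast le_eight_mul_sieveLevel i
  have hz1 : (1 : ℝ) ≤ sieveLevel i := by exact_mod_cast le_max_left _ _
  have hK' : (1 : ℝ) ≤ K := by exact_mod_cast hK
  calc _ ≤ Real.exp (2 * K + 2) * (Real.exp i * Real.exp i *
        Real.exp (-(40 * (sieveLevel i : ℝ) * K))) := by gcongr
    _ = Real.exp (2 * K + 2 + (i + i + -(40 * (sieveLevel i : ℝ) * K))) := by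
        rw [Real.exp_add (2 * (K : ℝ) + 2), Real.exp_add ((i : ℝ) + i), Real.exp_add (i : ℝ)]
    _ ≤ Real.exp (2 + (-i + -K)) := by
        refine Real.exp_le_exp.2 ?_
        nlinarith [mul_nonneg (sub_nonneg.2 hz1) (sub_nonneg.2 hK')]
    _ = Real.exp 2 * (Real.exp (-i) * Real.exp (-K)) := by rw [Real.exp_add, Real.exp_add]
    _ ≤ _ := by gcongr <;> exact hpow _

lemma mul_exp_le_sum {w L : ℝ} {j I J : ℕ} (hw : 0 ≤ w) (hj : j < I) (hJ : ⌊L⌋₊ < J) :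
    w * Real.exp (2 * L) ≤ Real.exp 2 * w + ∑ i ∈ Finset.range I, ∑ K ∈ Finset.range J,
      if 1 ≤ K then Real.exp (2 * K + 2) * (if j = i ∧ (K : ℝ) ≤ L then w else 0) else 0 := by
  set F : ℕ → ℕ → ℝ := fun i K =>
    if 1 ≤ K then Real.exp (2 * K + 2) * (if j = i ∧ (K : ℝ) ≤ L then w else 0) else 0 with hF
  have hnn : ∀ i K, 0 ≤ F i K := by
    intro i K
    rw [hF]
    dsimp only
    split_ifs <;> positivity
  have h1 : F j ⌊L⌋₊ ≤ ∑ i ∈ Finset.range I, ∑ K ∈ Finset.range J, F i K :=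
    (Finset.single_le_sum (f := fun K => F j K) (fun K _ => hnn j K)
      (Finset.mem_range.2 hJ)).trans
      (Finset.single_le_sum (f := fun i => ∑ K ∈ Finset.range J, F i K)
        (fun i _ => Finset.sum_nonneg fun K _ => hnn i K) (Finset.mem_range.2 hj))
  refine le_trans ?_ (add_le_add_right h1 _)
  rcases lt_or_ge L 1 with hlt | hge
  · have : Real.exp (2 * L) ≤ Real.exp 2 := Real.exp_le_exp.2 (by linarith)
    nlinarith [hnn j ⌊L⌋₊]
  · have hK1 : 1 ≤ ⌊L⌋₊ := Nat.le_floor (by exact_mod_cast hge)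
    have hKL : (⌊L⌋₊ : ℝ) ≤ L := Nat.floor_le (by linarith)
    have hLK : L < ⌊L⌋₊ + 1 := Nat.lt_floor_add_one _
    rw [hF]
    dsimp only
    rw [if_pos hK1, if_pos ⟨rfl, hKL⟩]
    have h3 : Real.exp (2 * L) ≤ Real.exp (2 * ⌊L⌋₊ + 2) := Real.exp_le_exp.2 (by linarith)
    nlinarith [mul_le_mul_of_nonneg_right h3 hw, mul_nonneg (Real.exp_pos 2).le hw]

lemma exists_sum_small_scale_le : ∃ C : ℝ, 0 < C ∧ ∀ (X : Finset ℕ) (ψ : ℕ → ℝ) (Λ : ℕ),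
    IsAdmissibleFamily X ψ Λ → ∀ P : Finset ℕ, P = (Finset.range (Λ ^ 2 + 1)).filter Nat.Prime →
    (∑ m ∈ X, ∑ n ∈ X, if pairScale ψ m n < Λ then ψ m * density P m.factorization *
      (ψ n * density P n.factorization) * Real.exp (2 * scaleDiscrepancy P ψ m n) else 0) ≤
      Real.exp 2 * (∑ n ∈ X, ψ n * density P n.factorization) ^ 2 + C *
      ((∑ n ∈ X, ψ n * density P n.factorization) *
        (∑ n ∈ X, ψ n * density P n.factorization)) ^ (3 / 4 : ℝ) := by
  classical
  obtain ⟨C, hC, hbound⟩ := exists_edgeBound (l := 40) (by norm_num)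
  refine ⟨4 * Real.exp 2 * C, by positivity, fun X ψ Λ h P hP => ?_⟩
  have hPp : ∀ p ∈ P, p.Prime := fun p hp => (Finset.mem_filter.1 (hP ▸ hp)).2
  set μ : ℕ → ℝ := fun n => ψ n * density P n.factorization with hμ
  have hμ0 : ∀ n, 0 < μ n := fun n => mul_pos (h.pos n) (density_pos hPp _)
  set S := ∑ n ∈ X, μ n with hS
  have hS0 : 0 ≤ S := Finset.sum_nonneg fun n _ => (hμ0 n).le
  set ix : ℕ → ℕ → ℕ := fun m n => Nat.log 2 ⌊2 * pairScale ψ m n⌋₊ with hix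
  set L := scaleDiscrepancy P ψ with hL
  obtain ⟨I, hIlt⟩ : ∃ I, ∀ c ∈ X ×ˢ X, ix c.1 c.2 < I :=
    ⟨_, fun c hc => Nat.lt_succ_of_le (Finset.le_sup (f := fun c : ℕ × ℕ => ix c.1 c.2) hc)⟩
  obtain ⟨J, hJlt⟩ : ∃ J, ∀ c ∈ X ×ˢ X, ⌊L c.1 c.2⌋₊ < J :=
    ⟨_, fun c hc => Nat.lt_succ_of_le (Finset.le_sup (f := fun c : ℕ × ℕ => ⌊L c.1 c.2⌋₊) hc)⟩
  set E : ℕ → ℕ → ℕ → ℕ → Prop := fun i K m n =>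
    (pairScale ψ m n < Λ ∧ ix m n = i) ∧ (K : ℝ) ≤ L m n with hE
  have hmass : ∀ i K, edgeMass μ μ (E i K) X X ≤
      2 ^ i * 2 ^ i * (C * Real.exp (-(40 * (sieveLevel i : ℝ) * K)) * (S * S) ^ (3 / 4 : ℝ)) := by
    intro i K
    have hT : (1 : ℝ) ≤ 2 ^ i := one_le_pow₀ (by norm_num)
    have hscale : edgeMass μ μ (E i K) X X = 2 ^ i * 2 ^ i * edgeMass
        (fun n => ψ n / 2 ^ i * density P n.factorization)
        (fun n => ψ n / 2 ^ i * density P n.factorization) (E i K) X X :=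
      edgeMass_scale (fun n _ => by rw [hμ]; field_simp) (fun n _ => by rw [hμ]; field_simp)
    rw [hscale]
    gcongr
    have hadm : Admissible P (fun n p : ℕ => n.factorization p)
      (fun n => ψ n / 2 ^ i) (fun n => ψ n / 2 ^ i) (E i K) X X := by
      rw [hP]
      exact admissible_of_pairScale_lt h i _ fun m _ n _ hmn => hmn.1
    have hz1 : (1 : ℝ) ≤ sieveLevel i := by exact_mod_cast le_max_left _ _
    refine (hbound ℕ (fun n p : ℕ => n.factorization p) (sieveLevel i) P hz1 hPp
      (fun n => ψ n / 2 ^ i)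
      (fun n => ψ n / 2 ^ i) (E i K) X X K (fun n => div_pos (h.pos n) (by positivity))
      (fun n => div_pos (h.pos n) (by positivity)) hadm ?_).trans ?_
    · intro m _ n _ hmn
      have h1 := hmn.2
      have h2 := hmn.1.2
      rw [hL, scaleDiscrepancy] at h1
      rw [hix] at h2
      dsimp only at h2
      rwa [h2] at h1
    · have hS' : ∑ n ∈ X, ψ n / 2 ^ i * density P n.factorization ≤ S := by
        refine Finset.sum_le_sum fun n _ => ?_
        have := density_pos hPp n.factorization
        change _ ≤ ψ n * density P n.factorization
        gcongr
        exact div_le_self (h.pos n).le hT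
      have hS'' : 0 ≤ ∑ n ∈ X, ψ n / 2 ^ i * density P n.factorization :=
        Finset.sum_nonneg fun n _ => mul_nonneg (div_nonneg (h.pos n).le (by positivity))
          (density_pos hPp _).le
      gcongr
  have hpt : ∀ m ∈ X, ∀ n ∈ X, (if pairScale ψ m n < Λ then μ m * μ n * Real.exp (2 * L m n)
      else 0) ≤ Real.exp 2 * (μ m * μ n) + ∑ i ∈ Finset.range I, ∑ K ∈ Finset.range J,
        if 1 ≤ K then Real.exp (2 * K + 2) * (if E i K m n then μ m * μ n else 0) else 0 := by
    intro m hm n hn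
    have hmn := mul_pos (hμ0 m) (hμ0 n)
    have hmem : (m, n) ∈ X ×ˢ X := Finset.mem_product.2 ⟨hm, hn⟩
    have hiI := hIlt _ hmem
    have hKJ := hJlt _ hmem
    by_cases hD : pairScale ψ m n < Λ
    · simp only [hE, hD, true_and, if_true]
      exact mul_exp_le_sum hmn.le hiI hKJ
    · simp only [hE, hD, false_and, if_false, mul_zero, ite_self, Finset.sum_const_zero, add_zero]
      positivity
  calc _ ≤ ∑ m ∈ X, ∑ n ∈ X, (Real.exp 2 * (μ m * μ n) + ∑ i ∈ Finset.range I,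
        ∑ K ∈ Finset.range J, if 1 ≤ K then Real.exp (2 * K + 2) *
          (if E i K m n then μ m * μ n else 0) else 0) :=
        Finset.sum_le_sum fun m hm => Finset.sum_le_sum fun n hn => hpt m hm n hn
    _ = Real.exp 2 * S ^ 2 + ∑ i ∈ Finset.range I, ∑ K ∈ Finset.range J,
        if 1 ≤ K then Real.exp (2 * K + 2) * edgeMass μ μ (E i K) X X else 0 := by
        simp_rw [Finset.sum_add_distrib]
        congr 1
        · rw [sq, hS, Finset.sum_mul_sum, Finset.mul_sum]
          exact Finset.sum_congr rfl fun m _ => by rw [Finset.mul_sum]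
        · have e1 : ∀ m ∈ X, ∑ n ∈ X, ∑ i ∈ Finset.range I, ∑ K ∈ Finset.range J,
              (if 1 ≤ K then Real.exp (2 * K + 2) *
                (if E i K m n then μ m * μ n else 0) else 0) =
              ∑ i ∈ Finset.range I, ∑ K ∈ Finset.range J, ∑ n ∈ X, (if 1 ≤ K then
                Real.exp (2 * K + 2) * (if E i K m n then μ m * μ n else 0) else 0) := by
            intro m _
            rw [Finset.sum_comm]
            exact Finset.sum_congr rfl fun i _ => Finset.sum_comm
          rw [Finset.sum_congr rfl e1, Finset.sum_comm]
          refine Finset.sum_congr rfl fun i _ => ?_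
          rw [Finset.sum_comm]
          refine Finset.sum_congr rfl fun K _ => ?_
          rw [edgeMass_eq_sum]
          by_cases hK : 1 ≤ K
          · simp only [hK, if_true, Finset.mul_sum]
            refine Finset.sum_congr rfl fun _ _ => Finset.sum_congr rfl fun _ _ => ?_
            congr
          · simp [hK]
    _ ≤ Real.exp 2 * S ^ 2 + ∑ i ∈ Finset.range I, ∑ K ∈ Finset.range J,
        (C * (S * S) ^ (3 / 4 : ℝ) * Real.exp 2) * ((1 / 2) ^ i * (1 / 2) ^ K) := by
        gcongr with i _ K _
        split_ifs with hK
        · calc _ ≤ Real.exp (2 * K + 2) * (2 ^ i * 2 ^ i * (C * Real.exp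
              (-(40 * (sieveLevel i : ℝ) * K)) * (S * S) ^ (3 / 4 : ℝ))) := by
                gcongr; exact hmass i K
            _ = C * (S * S) ^ (3 / 4 : ℝ) * (Real.exp (2 * K + 2) *
              (2 ^ i * 2 ^ i * Real.exp (-(40 * (sieveLevel i : ℝ) * K)))) := by ring
            _ ≤ C * (S * S) ^ (3 / 4 : ℝ) * (Real.exp 2 * ((1 / 2) ^ i * (1 / 2) ^ K)) := by
                exact mul_le_mul_of_nonneg_left (exp_coeff_le i K hK) (by positivity)
            _ = _ := by ring
        · positivity
    _ = Real.exp 2 * S ^ 2 + (C * (S * S) ^ (3 / 4 : ℝ) * Real.exp 2) *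
        ((∑ i ∈ Finset.range I, (1 / 2 : ℝ) ^ i) * ∑ K ∈ Finset.range J, (1 / 2 : ℝ) ^ K) := by
        rw [Finset.sum_mul_sum (Finset.range I), Finset.mul_sum (Finset.range I)]
        exact congrArg _ (Finset.sum_congr rfl fun i _ => by rw [Finset.mul_sum (Finset.range J)])
    _ ≤ Real.exp 2 * S ^ 2 + (C * (S * S) ^ (3 / 4 : ℝ) * Real.exp 2) * (2 * 2) := by
        gcongr <;> exact sum_geometric_half_le _
    _ = _ := by ring

end SmallScales

section VolumeBound

/-- The union of the intervals of radius `ψ n / n` around the reduced fractions with denominator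
`n ∈ X`, where reducedness is only tested at the primes in `P`. -/
def approxUnion (P X : Finset ℕ) (ψ : ℕ → ℝ) : Set ℝ :=
  ⋃ c ∈ X.sigma fun n => reducedResidues P n, Metric.ball ((c.2 : ℝ) / c.1) (ψ c.1 / c.1)

lemma sum_overlap_le {X : Finset ℕ} {ψ : ℕ → ℝ} {Λ : ℕ} (h : IsAdmissibleFamily X ψ Λ)
    {P : Finset ℕ} (hP : P = (Finset.range (Λ ^ 2 + 1)).filter Nat.Prime) :
    ∑ m ∈ X, ∑ n ∈ X, overlap P ψ m n ≤
      2 * (∑ n ∈ X, ψ n * density P n.factorization) + 96 * (Real.exp 64 *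
      (∑ n ∈ X, ψ n * density P n.factorization) ^ 2 +
      ∑ m ∈ X, ∑ n ∈ X, if pairScale ψ m n < Λ then ψ m * density P m.factorization *
        (ψ n * density P n.factorization) * Real.exp (2 * scaleDiscrepancy P ψ m n) else 0) +
      2 := by
  classical
  have hPp : ∀ p ∈ P, p.Prime := fun p hp => (Finset.mem_filter.1 (hP ▸ hp)).2
  set μ : ℕ → ℝ := fun n => ψ n * density P n.factorization with hμ
  have hμ0 : ∀ n, 0 < μ n := fun n => mul_pos (h.pos n) (density_pos hPp _)
  have hΛ : (1 : ℝ) ≤ Λ := by exact_mod_cast h.one_le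
  have hpt : ∀ m ∈ X, ∀ n ∈ X, overlap P ψ m n ≤ (if m = n then 2 * μ m else 0) +
      96 * (Real.exp 64 * (μ m * μ n) + if pairScale ψ m n < Λ then μ m * μ n *
        Real.exp (2 * scaleDiscrepancy P ψ m n) else 0) + 2 / (Λ : ℝ) ^ 2 := by
    intro m hm n hn
    have hmn := mul_pos (hμ0 m) (hμ0 n)
    have hite : 0 ≤ if pairScale ψ m n < Λ then μ m * μ n *
        Real.exp (2 * scaleDiscrepancy P ψ m n) else 0 := by split_ifs <;> positivity
    have hΛ2 : 0 ≤ 2 / (Λ : ℝ) ^ 2 := by positivity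
    have he : 0 < Real.exp 64 * (μ m * μ n) := by positivity
    rcases eq_or_ne m n with rfl | hne
    · rw [overlap_self hPp (h.ne_zero m hm) (h.pos m).le (h.le_half m hm), if_pos rfl]
      have : 2 * (ψ m * density P m.factorization) = 2 * μ m := rfl
      linarith
    · rw [if_neg hne, zero_add]
      have h1 := overlap_le (Y := Λ ^ 2) (pow_pos h.one_le 2) (h.ne_zero m hm) (h.ne_zero n hn) hne
        (h.pos m) (h.pos n) (by linarith [h.le_half m hm]) (by linarith [h.le_half n hn]) hP
      push_cast at h1
      refine h1.trans (add_le_add_left ?_ _)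
      change 96 * (μ m * μ n) * (if 1 / 2 ≤ pairScale ψ m n then
        Real.exp (2 * scaleDiscrepancy P ψ m n) else 0) ≤ _
      rw [mul_assoc]
      refine mul_le_mul_of_nonneg_left ?_ (by norm_num)
      by_cases hD : pairScale ψ m n < Λ
      · rw [if_pos hD]
        split_ifs
        · linarith
        · rw [mul_zero]; positivity
      · rw [if_neg hD, add_zero, if_pos (by linarith), mul_comm]
        have h2 := discrepancy_le_of_le_pairScale hPp hΛ (h.ne_zero m hm) (h.ne_zero n hn)
          (h.inv_le m hm) (h.inv_le n hn) (not_lt.1 hD)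
        gcongr
        change 2 * discrepancy _ _ _ _ ≤ _
        linarith
  have hcard : (X.card : ℝ) ≤ Λ := by exact_mod_cast h.card_le
  calc _ ≤ _ := Finset.sum_le_sum fun m hm => Finset.sum_le_sum fun n hn => hpt m hm n hn
    _ = 2 * (∑ n ∈ X, μ n) + 96 * (Real.exp 64 * (∑ n ∈ X, μ n) ^ 2 +
        ∑ m ∈ X, ∑ n ∈ X, if pairScale ψ m n < Λ then μ m * μ n *
          Real.exp (2 * scaleDiscrepancy P ψ m n) else 0) +
        X.card * (X.card * (2 / (Λ : ℝ) ^ 2)) := by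
        simp_rw [Finset.sum_add_distrib, ← Finset.mul_sum, Finset.sum_add_distrib,
          Finset.sum_const, nsmul_eq_mul]
        congr 2
        · rw [Finset.mul_sum]
          refine Finset.sum_congr rfl fun m hm => ?_
          rw [Finset.sum_ite_eq, if_pos hm]
        · congr 2
          rw [sq, Finset.sum_mul_sum]
          simp_rw [← Finset.mul_sum]
    _ ≤ _ := by
        refine add_le_add_right ?_ _
        calc (X.card : ℝ) * (X.card * (2 / (Λ : ℝ) ^ 2)) ≤ Λ * (Λ * (2 / (Λ : ℝ) ^ 2)) := by gcongr
          _ = 2 := by field_simp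

lemma exists_le_volume_approxUnion {c₀ : ℝ} (hc₀ : 0 < c₀) : ∃ c : ℝ, 0 < c ∧
    ∀ (X : Finset ℕ) (ψ : ℕ → ℝ) (Λ : ℕ), IsAdmissibleFamily X ψ Λ →
    ∀ P : Finset ℕ, P = (Finset.range (Λ ^ 2 + 1)).filter Nat.Prime →
    c₀ ≤ ∑ n ∈ X, ψ n * density P n.factorization →
    c ≤ volume.real (approxUnion P X ψ) := by
  classical
  obtain ⟨C, hC, hsmall⟩ := exists_sum_small_scale_le
  set M : ℝ := 2 / c₀ + 96 * (Real.exp 64 + (Real.exp 2 + C * (c₀ * c₀) ^ (-(1 / 4) : ℝ))) +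
    2 / c₀ ^ 2 with hM
  have hM0 : 0 < M := by positivity
  refine ⟨4 / M, by positivity, fun X ψ Λ h P hP hS => ?_⟩
  have hPp : ∀ p ∈ P, p.Prime := fun p hp => (Finset.mem_filter.1 (hP ▸ hp)).2
  set S := ∑ n ∈ X, ψ n * density P n.factorization with hSdef
  have hS0 : 0 < S := hc₀.trans_le hS
  set A : (Σ _ : ℕ, ℕ) → Set ℝ := fun c => Metric.ball ((c.2 : ℝ) / c.1) (ψ c.1 / c.1) with hA
  have hCS := sq_sum_measureReal_le (X.sigma fun n => reducedResidues P n) A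
    (fun c _ => measurableSet_ball) fun c _ => measure_ball_lt_top.ne
  have hfirst : ∑ c ∈ X.sigma fun n => reducedResidues P n, volume.real (A c) = 2 * S := by
    rw [Finset.sum_sigma, hSdef, Finset.mul_sum]
    refine Finset.sum_congr rfl fun n hn => ?_
    have hn0 : (0 : ℝ) < n := by exact_mod_cast (h.ne_zero n hn).bot_lt
    have : ∀ a ∈ reducedResidues P n, volume.real (A ⟨n, a⟩) = 2 * (ψ n / n) := fun a _ =>
      Real.volume_real_ball (div_nonneg (h.pos n).le hn0.le)
    rw [Finset.sum_congr rfl this, Finset.sum_const, nsmul_eq_mul,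
      card_reducedResidues hPp (h.ne_zero n hn)]
    field_simp
  have hsecond : ∑ c ∈ X.sigma fun n => reducedResidues P n,
      ∑ d ∈ X.sigma fun n => reducedResidues P n, volume.real (A c ∩ A d) =
      ∑ m ∈ X, ∑ n ∈ X, overlap P ψ m n := by
    rw [Finset.sum_sigma]
    refine Finset.sum_congr rfl fun m _ => ?_
    rw [Finset.sum_comm, Finset.sum_sigma]
    refine Finset.sum_congr rfl fun n _ => ?_
    rw [Finset.sum_comm, overlap, Finset.sum_product]
  rw [hfirst, hsecond] at hCS
  have hle : ∑ m ∈ X, ∑ n ∈ X, overlap P ψ m n ≤ M * S ^ 2 := by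
    refine (sum_overlap_le h hP).trans ?_
    have h1 := hsmall X ψ Λ h P hP
    rw [← hSdef] at h1 ⊢
    have h2 : (S * S) ^ (3 / 4 : ℝ) ≤ (c₀ * c₀) ^ (-(1 / 4) : ℝ) * S ^ 2 := by
      calc (S * S) ^ (3 / 4 : ℝ) = (S * S) ^ (-(1 / 4) : ℝ) * (S * S) ^ (1 : ℝ) := by
            rw [← Real.rpow_add (by positivity)]; norm_num
        _ ≤ (c₀ * c₀) ^ (-(1 / 4) : ℝ) * S ^ 2 := by
            rw [Real.rpow_one, ← sq]
            gcongr ?_ * _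
            exact Real.rpow_le_rpow_of_nonpos (by positivity) (by nlinarith) (by norm_num)
    have h3 : 2 * S ≤ 2 / c₀ * S ^ 2 := by
      rw [div_mul_eq_mul_div, le_div_iff₀ hc₀]; nlinarith
    have h4 : 2 ≤ 2 / c₀ ^ 2 * S ^ 2 := by
      rw [div_mul_eq_mul_div, le_div_iff₀ (by positivity)]
      gcongr
    have h5 := mul_le_mul_of_nonneg_left h2 hC.le
    rw [hM]
    linarith
  have hU : 0 ≤ volume.real (approxUnion P X ψ) := measureReal_nonneg
  have h6 : (2 * S) ^ 2 ≤ volume.real (approxUnion P X ψ) * (M * S ^ 2) :=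
    hCS.trans (mul_le_mul_of_nonneg_left hle hU)
  rw [div_le_iff₀ hM0]
  have h7 : 0 < S ^ 2 := by positivity
  refine le_of_mul_le_mul_right ?_ h7
  linarith

end VolumeBound

section Mertens

/-- The upper bound in the first theorem of Mertens. -/
lemma sum_log_div_prime_le {Y : ℕ} (hY : 1 ≤ Y) :
    ∑ p ∈ (Finset.range (Y + 1)).filter Nat.Prime, Real.log p / (p : ℝ) ≤ 2 * Real.log Y := by
  have hY0 : (0 : ℝ) < Y := by exact_mod_cast hY
  have h1 : ∑ p ∈ (Finset.range (Y + 1)).filter Nat.Prime,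
      ((Y.factorial.factorization p : ℕ) : ℝ) * Real.log p = Real.log (Y.factorial : ℝ) := by
    rw [Real.log_nat_eq_sum_factorization, Finsupp.sum]
    symm
    apply Finset.sum_subset
    · intro p hp
      rw [Nat.support_factorization, Nat.mem_primeFactors] at hp
      rw [Finset.mem_filter, Finset.mem_range, Nat.lt_succ_iff]
      exact ⟨(hp.1.dvd_factorial).1 hp.2.1, hp.1⟩
    · intro p _ hp
      rw [Finsupp.notMem_support_iff] at hp
      simp [hp]
  have h2 : Real.log (Y.factorial : ℝ) ≤ Y * Real.log Y := by
    rw [← Real.log_pow]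
    apply Real.log_le_log (by exact_mod_cast Y.factorial_pos)
    exact_mod_cast Y.factorial_le_pow
  have h3 : ∑ p ∈ (Finset.range (Y + 1)).filter Nat.Prime, Y / 2 * (Real.log p / (p : ℝ)) ≤
      ∑ p ∈ (Finset.range (Y + 1)).filter Nat.Prime,
        ((Y.factorial.factorization p : ℕ) : ℝ) * Real.log p := by
    apply Finset.sum_le_sum
    intro p hp
    rw [Finset.mem_filter, Finset.mem_range, Nat.lt_succ_iff] at hp
    have hp0 : (0 : ℝ) < p := by exact_mod_cast hp.2.pos
    have hlog : 0 ≤ Real.log p := Real.log_natCast_nonneg p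
    have h4 : Y / p ≤ Y.factorial.factorization p := by
      rw [Nat.factorization_factorial hp.2 (Nat.lt_add_one (Nat.log p Y))]
      have hmem : 1 ∈ Finset.Ico 1 (Nat.log p Y + 1) := by
        rw [Finset.mem_Ico]
        exact ⟨le_rfl, Nat.lt_add_one_of_le (Nat.log_pos hp.2.one_lt hp.1)⟩
      calc Y / p = Y / p ^ 1 := by rw [pow_one]
        _ ≤ _ := Finset.single_le_sum (f := fun i => Y / p ^ i) (fun _ _ => Nat.zero_le _) hmem
    have h5 : Y ≤ 2 * p * (Y / p) := by
      have := Nat.lt_mul_div_succ Y hp.2.pos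
      have h6 : 1 ≤ Y / p := (Nat.one_le_div_iff hp.2.pos).2 hp.1
      nlinarith
    have h7 : (Y : ℝ) ≤ 2 * p * (Y.factorial.factorization p : ℕ) := by
      exact_mod_cast h5.trans (Nat.mul_le_mul_left _ h4)
    calc Y / 2 * (Real.log p / (p : ℝ)) = (Y / (2 * p)) * Real.log p := by field_simp
      _ ≤ _ := by
        gcongr
        rw [div_le_iff₀ (by positivity)]
        linarith
  rw [← Finset.mul_sum, h1] at h3
  have h8 := h3.trans h2
  by_contra! hcon
  have : Y / 2 * (2 * Real.log Y) < Y / 2 *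
      ∑ p ∈ (Finset.range (Y + 1)).filter Nat.Prime, Real.log p / (p : ℝ) := by gcongr
  linarith

lemma tsum_rpow_le {s : ℝ} (hs : 1 < s) :
    ∑' n : ℕ, ((n : ℝ) ^ s)⁻¹ ≤ 1 + 1 / (s - 1) := by
  have h := ZetaAsymptotics.zeta_limit_aux1 hs
  have h0 : 0 ≤ ZetaAsymptotics.termTSum s :=
    tsum_nonneg fun n => ZetaAsymptotics.term_nonneg _ _
  have h1 := (Real.summable_nat_rpow_inv.2 hs).tsum_eq_zero_add
  have h2 : ∑' n : ℕ, (((n + 1 : ℕ) : ℝ) ^ s)⁻¹ = ∑' n : ℕ, 1 / (n + 1 : ℝ) ^ s := by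
    congr 1
    ext n
    push_cast
    rw [one_div]
  rw [h1, h2, Nat.cast_zero, Real.zero_rpow (by linarith), inv_zero, zero_add]
  nlinarith

/-- `n ↦ n ^ (-s)` as a monoid homomorphism. -/
noncomputable def invRpowHom (s : ℝ) : ℕ →* ℝ where
  toFun n := ((n : ℝ) ^ s)⁻¹
  map_one' := by simp
  map_mul' m n := by
    rw [Nat.cast_mul, Real.mul_rpow (Nat.cast_nonneg _) (Nat.cast_nonneg _), mul_inv]

lemma prod_one_sub_rpow_ge {s : ℝ} (hs : 1 < s) (T : Finset ℕ) :
    (1 + 1 / (s - 1))⁻¹ ≤ ∏ p ∈ T.filter Nat.Prime, (1 - ((p : ℝ) ^ s)⁻¹) := by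
  have hsum : Summable (invRpowHom s) := Real.summable_nat_rpow_inv.2 hs
  have h := EulerProduct.prod_filter_prime_geometric_eq_tsum_factoredNumbers hsum T
  have h1 : ∑' m : Nat.factoredNumbers T, invRpowHom s m ≤ 1 + 1 / (s - 1) := by
    refine le_trans ?_ (tsum_rpow_le hs)
    exact hsum.tsum_subtype_le (γ := ℝ) (fun n => (invRpowHom s) n) _
      (fun n => inv_nonneg.2 (Real.rpow_nonneg (Nat.cast_nonneg _) _))
  rw [← h, Finset.prod_inv_distrib] at h1
  have hpos : 0 < ∏ p ∈ T.filter Nat.Prime, (1 - invRpowHom s p) := by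
    apply Finset.prod_pos
    intro p hp
    have hp2 := (Finset.mem_filter.1 hp).2.one_lt
    have : 1 < (p : ℝ) ^ s := Real.one_lt_rpow (by exact_mod_cast hp2) (by linarith)
    exact sub_pos.2 (inv_lt_one_of_one_lt₀ this)
  exact inv_le_of_inv_le₀ hpos h1

/-- The lower bound in the third theorem of Mertens. -/
lemma exp_div_log_le_prod_one_sub_inv {Y : ℕ} (hY : 2 ≤ Y) :
    Real.exp (-4) / (1 + Real.log Y) ≤
      ∏ p ∈ (Finset.range (Y + 1)).filter Nat.Prime, (1 - 1 / (p : ℝ)) := by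
  have hlog : 0 < Real.log Y := Real.log_pos (by exact_mod_cast hY)
  obtain ⟨ε, hε⟩ : ∃ ε, ε = 1 / Real.log Y := ⟨_, rfl⟩
  have hε0 : 0 < ε := by rw [hε]; positivity
  have h1 := prod_one_sub_rpow_ge (s := 1 + ε) (by linarith) (Finset.range (Y + 1))
  have h2 : ∀ p ∈ (Finset.range (Y + 1)).filter Nat.Prime,
      1 - ((p : ℝ) ^ (1 + ε))⁻¹ ≤
        (1 - 1 / (p : ℝ)) * Real.exp (2 * ε * (Real.log p / (p : ℝ))) := by
    intro p hp
    have hp2 := (Finset.mem_filter.1 hp).2.two_le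
    have hp2' : (2 : ℝ) ≤ p := by exact_mod_cast hp2
    have hp0 : (0 : ℝ) < p := by linarith
    have hx : 1 / (p : ℝ) ≤ 1 / 2 := one_div_le_one_div_of_le (by norm_num) hp2'
    have hx0 : 0 < 1 / (p : ℝ) := by positivity
    have hlogp : 0 ≤ Real.log p := Real.log_natCast_nonneg p
    have h3 : 1 - ε * Real.log p ≤ ((p : ℝ) ^ ε)⁻¹ := by
      rw [← Real.rpow_neg hp0.le, Real.rpow_def_of_pos hp0]
      have := Real.add_one_le_exp (Real.log p * -ε)
      linarith
    have h4 : ((p : ℝ) ^ (1 + ε))⁻¹ = 1 / (p : ℝ) * ((p : ℝ) ^ ε)⁻¹ := by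
      rw [Real.rpow_add hp0, Real.rpow_one, mul_inv, one_div]
    rw [h4]
    have h5 := Real.add_one_le_exp (2 * ε * (Real.log p / (p : ℝ)))
    have h6 : Real.log p / (p : ℝ) = 1 / (p : ℝ) * Real.log p := by ring
    rw [h6] at h5 ⊢
    generalize 1 / (p : ℝ) = x at *
    have hxl : 0 ≤ ε * (x * Real.log p) := by positivity
    calc 1 - x * ((p : ℝ) ^ ε)⁻¹ ≤ 1 - x * (1 - ε * Real.log p) := by gcongr
      _ ≤ (1 - x) * (2 * ε * (x * Real.log p) + 1) := by nlinarith
      _ ≤ _ := by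
        apply mul_le_mul_of_nonneg_left h5
        linarith
  have h7 : ∏ p ∈ (Finset.range (Y + 1)).filter Nat.Prime, (1 - ((p : ℝ) ^ (1 + ε))⁻¹) ≤
      ∏ p ∈ (Finset.range (Y + 1)).filter Nat.Prime,
        ((1 - 1 / (p : ℝ)) * Real.exp (2 * ε * (Real.log p / (p : ℝ)))) := by
    apply Finset.prod_le_prod _ h2
    intro p hp
    have hp2 := (Finset.mem_filter.1 hp).2.one_lt
    have : 1 < (p : ℝ) ^ (1 + ε) := Real.one_lt_rpow (by exact_mod_cast hp2) (by linarith)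
    exact (sub_pos.2 (inv_lt_one_of_one_lt₀ this)).le
  rw [Finset.prod_mul_distrib, ← Real.exp_sum, ← Finset.mul_sum] at h7
  have hprod : 0 ≤ ∏ p ∈ (Finset.range (Y + 1)).filter Nat.Prime, (1 - 1 / (p : ℝ)) :=
    Finset.prod_nonneg fun p hp => (one_sub_inv_mem (Finset.mem_filter.1 hp).2).1.le
  have h8 : 2 * ε * ∑ p ∈ (Finset.range (Y + 1)).filter Nat.Prime, Real.log p / (p : ℝ) ≤ 4 := by
    calc _ ≤ 2 * ε * (2 * Real.log Y) := by
          gcongr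
          exact sum_log_div_prime_le (by omega)
      _ = 4 := by rw [hε]; field_simp; norm_num
  have h9 : (1 + Real.log Y)⁻¹ ≤
      (∏ p ∈ (Finset.range (Y + 1)).filter Nat.Prime, (1 - 1 / (p : ℝ))) * Real.exp 4 := by
    calc (1 + Real.log Y)⁻¹ = (1 + 1 / (1 + ε - 1))⁻¹ := by
          rw [add_sub_cancel_left, hε, one_div_one_div]
      _ ≤ _ := h1.trans h7
      _ ≤ _ := by gcongr
  rw [Real.exp_neg, div_eq_mul_inv, inv_mul_le_iff₀ (Real.exp_pos 4)]
  linarith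

lemma exp_div_log_le_density {Y : ℕ} (hY : 2 ≤ Y) (f : ℕ → ℕ) :
    Real.exp (-4) / (1 + Real.log Y) ≤ density ((Finset.range (Y + 1)).filter Nat.Prime) f := by
  refine (exp_div_log_le_prod_one_sub_inv hY).trans ?_
  apply Finset.prod_le_prod
  · exact fun p hp => (one_sub_inv_mem (Finset.mem_filter.1 hp).2).1.le
  · intro p hp
    split_ifs
    · exact (one_sub_inv_mem (Finset.mem_filter.1 hp).2).2
    · exact le_rfl

end Mertens

section Differences

/-- The positive differences of `a 1, …, a N`. -/
def posDiff (a : ℕ → ℕ) (N : ℕ) : Finset ℕ :=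
  (((Finset.Icc 1 N) ×ˢ (Finset.Icc 1 N)).filter fun p => p.1 < p.2).image fun p => a p.2 - a p.1

lemma mem_posDiff {a : ℕ → ℕ} {N n : ℕ} :
    n ∈ posDiff a N ↔ ∃ i j, 1 ≤ i ∧ i < j ∧ j ≤ N ∧ a j - a i = n := by
  simp only [posDiff, Finset.mem_image, Finset.mem_filter, Finset.mem_product, Finset.mem_Icc,
    Prod.exists]
  constructor
  · rintro ⟨i, j, ⟨⟨⟨h1, _⟩, _, h4⟩, h5⟩, h6⟩
    exact ⟨i, j, h1, h5, h4, h6⟩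
  · rintro ⟨i, j, h1, h2, h3, h4⟩
    exact ⟨i, j, ⟨⟨⟨h1, by omega⟩, by omega, h3⟩, h2⟩, h4⟩

lemma posDiff_mono (a : ℕ → ℕ) : Monotone (posDiff a) := by
  intro M N hMN n hn
  rw [mem_posDiff] at hn ⊢
  obtain ⟨i, j, h1, h2, h3, h4⟩ := hn
  exact ⟨i, j, h1, h2, h3.trans hMN, h4⟩

variable {a : ℕ → ℕ}

lemma pos_of_mem_posDiff (ha : ∀ m n, 1 ≤ m → m < n → a m < a n)
    {N n : ℕ} (hn : n ∈ posDiff a N) : 0 < n := by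
  rw [mem_posDiff] at hn
  obtain ⟨i, j, h1, h2, h3, h4⟩ := hn
  have := ha i j h1 h2
  omega

lemma diffCard_eq (ha : ∀ m n, 1 ≤ m → m < n → a m < a n)
    {N : ℕ} (hN : 1 ≤ N) : diffCard a N = 2 * (posDiff a N).card + 1 := by
  have h : ((Finset.Icc 1 N) ×ˢ (Finset.Icc 1 N)).image
      (fun p : ℕ × ℕ => (a p.1 : ℤ) - (a p.2 : ℤ)) =
      insert 0 ((posDiff a N).image (fun n : ℕ => (n : ℤ)) ∪
        (posDiff a N).image (fun n : ℕ => -(n : ℤ))) := by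
    ext z
    simp only [Finset.mem_image, Finset.mem_insert, Finset.mem_union, Finset.mem_product,
      Finset.mem_Icc, Prod.exists]
    constructor
    · rintro ⟨i, j, ⟨⟨h1, h2⟩, h3, h4⟩, rfl⟩
      rcases lt_trichotomy i j with hij | hij | hij
      · have := ha i j h1 hij
        refine Or.inr (Or.inr ⟨a j - a i, mem_posDiff.2 ⟨i, j, h1, hij, h4, rfl⟩, ?_⟩)
        omega
      · exact Or.inl (by rw [hij, sub_self])
      · have := ha j i h3 hij
        refine Or.inr (Or.inl ⟨a i - a j, mem_posDiff.2 ⟨j, i, h3, hij, h2, rfl⟩, ?_⟩)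
        omega
    · rintro (rfl | ⟨n, hn, rfl⟩ | ⟨n, hn, rfl⟩)
      · exact ⟨1, 1, ⟨⟨le_rfl, hN⟩, le_rfl, hN⟩, sub_self _⟩
      · obtain ⟨i, j, h1, h2, h3, h4⟩ := mem_posDiff.1 hn
        have := ha i j h1 h2
        exact ⟨j, i, ⟨⟨by omega, h3⟩, h1, by omega⟩, by omega⟩
      · obtain ⟨i, j, h1, h2, h3, h4⟩ := mem_posDiff.1 hn
        have := ha i j h1 h2
        exact ⟨i, j, ⟨⟨h1, by omega⟩, by omega, h3⟩, by omega⟩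
  rw [diffCard, h, Finset.card_insert_of_notMem, Finset.card_union_of_disjoint,
    Finset.card_image_of_injective, Finset.card_image_of_injective]
  · omega
  · intro m n hmn
    simpa using hmn
  · exact Nat.cast_injective
  · rw [Finset.disjoint_left]
    intro z hz hz'
    obtain ⟨m, hm, rfl⟩ := Finset.mem_image.1 hz
    obtain ⟨n, hn, hn'⟩ := Finset.mem_image.1 hz'
    have := pos_of_mem_posDiff ha hm
    have := pos_of_mem_posDiff ha hn
    omega
  · intro h0
    rcases Finset.mem_union.1 h0 with h0 | h0
    all_goals
      obtain ⟨n, hn, hn'⟩ := Finset.mem_image.1 h0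
      have := pos_of_mem_posDiff ha hn
      omega

lemma lt_card_posDiff_add_two (ha : ∀ m n, 1 ≤ m → m < n → a m < a n)
    (N : ℕ) : N < (posDiff a N).card + 2 := by
  have h : (Finset.Icc 2 N).card ≤ (posDiff a N).card := by
    apply Finset.card_le_card_of_injOn (fun j => a j - a 1)
    · intro j hj
      have hj' := Finset.mem_Icc.1 (Finset.mem_coe.1 hj)
      exact Finset.mem_coe.2 (mem_posDiff.2 ⟨1, j, le_rfl, by omega, hj'.2, rfl⟩)
    · intro i hi j hj hij
      have hi' := Finset.mem_Icc.1 (Finset.mem_coe.1 hi)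
      have hj' := Finset.mem_Icc.1 (Finset.mem_coe.1 hj)
      have h1 := ha 1 i le_rfl (by omega)
      have h2 := ha 1 j le_rfl (by omega)
      dsimp only at hij
      rcases lt_trichotomy i j with h | h | h
      · have := ha i j (by omega) h
        omega
      · exact h
      · have := ha j i (by omega) h
        omega
  rw [Nat.card_Icc] at h
  omega

lemma card_posDiff_succ_le (N : ℕ) : (posDiff a (N + 1)).card ≤ (posDiff a N).card + N := by
  have h : posDiff a (N + 1) ⊆
      posDiff a N ∪ (Finset.Icc 1 N).image fun i => a (N + 1) - a i := by
    intro n hn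
    obtain ⟨i, j, h1, h2, h3, h4⟩ := mem_posDiff.1 hn
    rw [Finset.mem_union]
    by_cases hj : j = N + 1
    · subst hj
      exact Or.inr (Finset.mem_image.2 ⟨i, Finset.mem_Icc.2 ⟨h1, by omega⟩, h4⟩)
    · exact Or.inl (mem_posDiff.2 ⟨i, j, h1, h2, by omega, h4⟩)
  calc _ ≤ _ := Finset.card_le_card h
    _ ≤ _ := Finset.card_union_le _ _
    _ ≤ _ := by
      gcongr
      simpa using Finset.card_image_le (s := Finset.Icc 1 N) (f := fun i => a (N + 1) - a i)

lemma diffCard_succ_le (ha : ∀ m n, 1 ≤ m → m < n → a m < a n)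
    {N : ℕ} (hN : 1 ≤ N) : diffCard a (N + 1) ≤ 3 * diffCard a N := by
  rw [diffCard_eq ha hN, diffCard_eq ha (by omega)]
  have := lt_card_posDiff_add_two ha N
  have := card_posDiff_succ_le (a := a) N
  omega

lemma diffCard_mono (ha : ∀ m n, 1 ≤ m → m < n → a m < a n)
    {M N : ℕ} (hM : 1 ≤ M) (hMN : M ≤ N) : diffCard a M ≤ diffCard a N := by
  rw [diffCard_eq ha hM, diffCard_eq ha (by omega)]
  have := Finset.card_le_card (posDiff_mono a hMN)
  omega

open Classical in
/-- The first `N` for which `n` is a difference of elements of `a 1, …, a N` (and `1` if there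
is none). -/
noncomputable def firstIndex (a : ℕ → ℕ) (n : ℕ) : ℕ :=
  if h : ∃ N, n ∈ posDiff a N then Nat.find h else 1

lemma mem_posDiff_firstIndex {n N : ℕ} (hn : n ∈ posDiff a N) :
    n ∈ posDiff a (firstIndex a n) := by
  classical
  have h : ∃ N, n ∈ posDiff a N := ⟨N, hn⟩
  rw [firstIndex, dif_pos h]
  exact Nat.find_spec h

lemma firstIndex_le {n N : ℕ} (hn : n ∈ posDiff a N) : firstIndex a n ≤ N := by
  classical
  have h : ∃ N, n ∈ posDiff a N := ⟨N, hn⟩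
  rw [firstIndex, dif_pos h]
  exact Nat.find_min' h hn

lemma lt_firstIndex {n M N : ℕ} (hn : n ∈ posDiff a N) (hM : n ∉ posDiff a M) :
    M < firstIndex a n := by
  by_contra! h
  exact hM (posDiff_mono a h (mem_posDiff_firstIndex hn))

lemma one_le_firstIndex (a : ℕ → ℕ) (n : ℕ) : 1 ≤ firstIndex a n := by
  by_cases h : ∃ N, n ∈ posDiff a N
  · obtain ⟨N, hN⟩ := h
    have := mem_posDiff_firstIndex hN
    obtain ⟨i, j, h1, h2, h3, h4⟩ := mem_posDiff.1 this
    omega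
  · rw [firstIndex, dif_neg h]

/-- The reciprocal of the size of the difference set in which `n` first occurs. -/
noncomputable def diffWeight (a : ℕ → ℕ) (n : ℕ) : ℝ := 1 / (diffCard a (firstIndex a n) : ℝ)

lemma diffCard_pos (ha : ∀ m n, 1 ≤ m → m < n → a m < a n)
    {N : ℕ} (hN : 1 ≤ N) : 0 < diffCard a N := by
  rw [diffCard_eq ha hN]
  omega

lemma diffWeight_pos (ha : ∀ m n, 1 ≤ m → m < n → a m < a n)
    (n : ℕ) : 0 < diffWeight a n :=
  one_div_pos.2 (by exact_mod_cast diffCard_pos ha (one_le_firstIndex a n))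

lemma diffWeight_le_one (ha : ∀ m n, 1 ≤ m → m < n → a m < a n)
    (n : ℕ) : diffWeight a n ≤ 1 := by
  have h : (1 : ℝ) ≤ (diffCard a (firstIndex a n) : ℝ) := by
    exact_mod_cast diffCard_pos ha (one_le_firstIndex a n)
  exact div_le_one_of_le₀ h (by linarith)

lemma log_diffCard_succ_sub_le (ha : ∀ m n, 1 ≤ m → m < n → a m < a n)
    {N : ℕ} (hN : 1 ≤ N) :
    Real.log (diffCard a (N + 1)) - Real.log (diffCard a N) ≤
      3 * (1 - (diffCard a N : ℝ) / diffCard a (N + 1)) := by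
  have hC : (0 : ℝ) < diffCard a N := by exact_mod_cast diffCard_pos ha hN
  have hC' : (0 : ℝ) < diffCard a (N + 1) := by exact_mod_cast diffCard_pos ha (by omega)
  rw [← Real.log_div hC'.ne' hC.ne']
  have h1 := Real.log_le_sub_one_of_pos (div_pos hC' hC)
  have h2 : (diffCard a (N + 1) : ℝ) / diffCard a N ≤ 3 := by
    rw [div_le_iff₀ hC]
    exact_mod_cast diffCard_succ_le ha hN
  have h3 : (1 : ℝ) - (diffCard a N : ℝ) / diffCard a (N + 1) ≥ 0 := by
    rw [ge_iff_le, sub_nonneg, div_le_one hC']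
    exact_mod_cast diffCard_mono ha hN (Nat.le_succ N)
  calc _ ≤ _ := h1
    _ = (diffCard a (N + 1) : ℝ) / diffCard a N *
        (1 - (diffCard a N : ℝ) / diffCard a (N + 1)) := by field_simp
    _ ≤ _ := by gcongr

lemma sum_diffWeight_new (ha : ∀ m n, 1 ≤ m → m < n → a m < a n)
    {N : ℕ} (hN : 1 ≤ N) :
    ∑ n ∈ posDiff a (N + 1) \ posDiff a N, diffWeight a n =
      (1 - (diffCard a N : ℝ) / diffCard a (N + 1)) / 2 := by
  have hC' : (0 : ℝ) < diffCard a (N + 1) := by exact_mod_cast diffCard_pos ha (by omega)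
  have hsub := posDiff_mono a (Nat.le_succ N)
  have h1 : ∀ n ∈ posDiff a (N + 1) \ posDiff a N,
      diffWeight a n = 1 / (diffCard a (N + 1) : ℝ) := by
    intro n hn
    have hn' := Finset.mem_sdiff.1 hn
    have : firstIndex a n = N + 1 :=
      le_antisymm (firstIndex_le hn'.1) (lt_firstIndex hn'.1 hn'.2)
    rw [diffWeight, this]
  have h2 : (diffCard a (N + 1) : ℝ) - diffCard a N =
      2 * ((posDiff a (N + 1) \ posDiff a N).card : ℝ) := by
    have h3 := Finset.card_sdiff_add_card_eq_card hsub
    rw [diffCard_eq ha hN, diffCard_eq ha (by omega), ← h3]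
    push_cast
    ring
  rw [Finset.sum_congr rfl h1, Finset.sum_const, nsmul_eq_mul]
  field_simp
  linarith

lemma log_le_sum_diffWeight (ha : ∀ m n, 1 ≤ m → m < n → a m < a n)
    {M N : ℕ} (hM : 1 ≤ M) (hMN : M ≤ N) :
    1 / 6 * (Real.log (diffCard a N) - Real.log (diffCard a M)) ≤
      ∑ n ∈ posDiff a N \ posDiff a M, diffWeight a n := by
  induction N, hMN using Nat.le_induction with
  | base => simp
  | succ N hMN ih =>
    have hN : 1 ≤ N := hM.trans hMN
    have hsub := posDiff_mono a (Nat.le_succ N)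
    have hsplit : posDiff a (N + 1) \ posDiff a M =
        (posDiff a N \ posDiff a M) ∪ (posDiff a (N + 1) \ posDiff a N) := by
      have h1 := posDiff_mono a hMN
      clear ih
      ext n
      simp only [Finset.mem_sdiff, Finset.mem_union]
      by_cases hn : n ∈ posDiff a N
      · simp [hn, hsub hn]
      · have h2 : n ∉ posDiff a M := fun h => hn (h1 h)
        simp [hn, h2]
    have hdisj : Disjoint (posDiff a N \ posDiff a M) (posDiff a (N + 1) \ posDiff a N) := by
      rw [Finset.disjoint_left]
      intro n h1 h2
      exact (Finset.mem_sdiff.1 h2).2 (Finset.mem_sdiff.1 h1).1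
    have hnew := sum_diffWeight_new ha hN
    rw [hsplit, Finset.sum_union hdisj, hnew]
    have hlog := log_diffCard_succ_sub_le ha hN
    linarith

lemma exists_volume_block_ge (ha : ∀ m n, 1 ≤ m → m < n → a m < a n) :
    ∃ c : ℝ, 0 < c ∧ ∀ M, 2 ≤ M → ∃ N, ∃ P : Finset ℕ,
    c ≤ volume.real (approxUnion P (posDiff a N \ posDiff a M) (diffWeight a)) := by
  obtain ⟨c, hc, hmain⟩ := exists_le_volume_approxUnion
    (c₀ := Real.exp (-4) / 42) (by positivity)
  refine ⟨c, hc, fun M hM => ?_⟩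
  have hM1 : 1 ≤ M := by omega
  have hCM : 3 ≤ diffCard a M := by
    rw [diffCard_eq ha hM1]
    have := lt_card_posDiff_add_two ha M
    omega
  have hex : ∃ N, M ≤ N ∧ diffCard a M ^ 2 ≤ diffCard a N := by
    refine ⟨M + diffCard a M ^ 2, by omega, ?_⟩
    rw [diffCard_eq ha (N := M + _) (by omega)]
    have := lt_card_posDiff_add_two ha (M + diffCard a M ^ 2)
    omega
  classical
  obtain ⟨N, hN⟩ : ∃ N, N = Nat.find hex := ⟨_, rfl⟩
  have hspec : M ≤ N ∧ diffCard a M ^ 2 ≤ diffCard a N := hN ▸ Nat.find_spec hex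
  have hMN : M < N := by
    rcases hspec.1.lt_or_eq with h | h
    · exact h
    · exfalso
      have := hspec.2
      rw [← h] at this
      nlinarith
  have hup : diffCard a N ≤ 3 * diffCard a M ^ 2 := by
    have h1 : ¬ (M ≤ N - 1 ∧ diffCard a M ^ 2 ≤ diffCard a (N - 1)) :=
      Nat.find_min hex (by omega)
    have h2 : diffCard a (N - 1) < diffCard a M ^ 2 := by
      by_contra! h
      exact h1 ⟨by omega, h⟩
    have h3 := diffCard_succ_le ha (N := N - 1) (by omega)
    rw [Nat.sub_add_cancel (by omega)] at h3
    omega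
  have hX : ∀ n ∈ posDiff a N \ posDiff a M, firstIndex a n ≤ N ∧ M < firstIndex a n := by
    intro n hn
    have hn' := Finset.mem_sdiff.1 hn
    exact ⟨firstIndex_le hn'.1, lt_firstIndex hn'.1 hn'.2⟩
  have hfam : IsAdmissibleFamily (posDiff a N \ posDiff a M) (diffWeight a) (diffCard a N) :=
    { pos := diffWeight_pos ha
      ne_zero := fun n hn => (pos_of_mem_posDiff ha (Finset.mem_sdiff.1 hn).1).ne'
      le_half := by
        intro n hn
        have h1 := diffCard_mono ha hM1 (hX n hn).2.le
        apply one_div_le_one_div_of_le (by norm_num)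
        have : 2 ≤ diffCard a (firstIndex a n) := by omega
        exact_mod_cast this
      inv_le := by
        intro n hn
        have h1 := diffCard_mono ha (one_le_firstIndex a n) (hX n hn).1
        apply one_div_le_one_div_of_le
        · exact_mod_cast diffCard_pos ha (one_le_firstIndex a n)
        · exact_mod_cast h1
      one_le := diffCard_pos ha (by omega)
      card_le := by
        rw [diffCard_eq ha (by omega)]
        have := Finset.card_le_card (Finset.sdiff_subset (s := posDiff a N) (t := posDiff a M))
        omega }
  refine ⟨N, _, hmain _ _ _ hfam _ rfl ?_⟩
  have hCM' : (3 : ℝ) ≤ diffCard a M := by exact_mod_cast hCM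
  have hCM0 : (0 : ℝ) < diffCard a M := by linarith
  have hCN0 : (0 : ℝ) < diffCard a N := by exact_mod_cast diffCard_pos ha (by omega)
  have hlog3 : 1 ≤ Real.log 3 := by
    rw [Real.le_log_iff_exp_le (by norm_num)]
    linarith [Real.exp_one_lt_d9]
  have hlogM : Real.log 3 ≤ Real.log (diffCard a M) := Real.log_le_log (by norm_num) hCM'
  have hlo : 2 * Real.log (diffCard a M) ≤ Real.log (diffCard a N) := by
    have : Real.log ((diffCard a M : ℝ) ^ 2) ≤ Real.log (diffCard a N) :=
      Real.log_le_log (by positivity) (by exact_mod_cast hspec.2)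
    rwa [Real.log_pow, Nat.cast_ofNat] at this
  have hhi : Real.log (diffCard a N) ≤ Real.log 3 + 2 * Real.log (diffCard a M) := by
    have : Real.log (diffCard a N) ≤ Real.log (3 * (diffCard a M : ℝ) ^ 2) :=
      Real.log_le_log hCN0 (by exact_mod_cast hup)
    rwa [Real.log_mul (by norm_num) (by positivity), Real.log_pow, Nat.cast_ofNat] at this
  have hY : 2 ≤ diffCard a N ^ 2 := by
    have := diffCard_mono ha hM1 hMN.le
    nlinarith
  have hdens : ∀ n : ℕ, Real.exp (-4) / (7 * Real.log (diffCard a M)) ≤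
      density ((Finset.range (diffCard a N ^ 2 + 1)).filter Nat.Prime) n.factorization := by
    intro n
    refine le_trans ?_ (exp_div_log_le_density hY _)
    have h0 : 0 ≤ Real.log (diffCard a N) := by linarith
    rw [Nat.cast_pow, Real.log_pow, Nat.cast_ofNat]
    apply div_le_div_of_nonneg_left (Real.exp_pos _).le (by positivity)
    linarith
  have hsum := log_le_sum_diffWeight ha hM1 hMN.le
  have hlogM0 : 0 < Real.log (diffCard a M) := by linarith
  calc Real.exp (-4) / 42
      = (1 / 6 * Real.log (diffCard a M)) * (Real.exp (-4) / (7 * Real.log (diffCard a M))) := by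
        field_simp
        norm_num
    _ ≤ (∑ n ∈ posDiff a N \ posDiff a M, diffWeight a n) *
          (Real.exp (-4) / (7 * Real.log (diffCard a M))) := by
        gcongr
        linarith
    _ ≤ _ := by
        rw [Finset.sum_mul]
        apply Finset.sum_le_sum
        intro n _
        exact mul_le_mul_of_nonneg_left (hdens n) (diffWeight_pos ha n).le

end Differences

section ZeroOne

lemma le_measure_frequently {α : Type*} [MeasurableSpace α] {μ : Measure α} {G : ℕ → Set α}
    (hG : ∀ k, MeasurableSet (G k)) {B : Set α} (hB : μ B ≠ ⊤) (hGB : ∀ k, G k ⊆ B)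
    {c : ENNReal} (hc : ∀ k, c ≤ μ (G k)) : c ≤ μ {x | ∃ᶠ k in atTop, x ∈ G k} := by
  have h1 : {x | ∃ᶠ k in atTop, x ∈ G k} = ⋂ m, ⋃ k, ⋃ _ : m ≤ k, G k := by
    ext x
    simp [frequently_atTop]
  have hanti : Antitone fun m => ⋃ k, ⋃ _ : m ≤ k, G k := by
    intro m n hmn
    exact Set.iUnion_mono fun k => Set.iUnion_mono' fun h => ⟨hmn.trans h, le_rfl⟩
  have hmeas : ∀ m, MeasurableSet (⋃ k, ⋃ _ : m ≤ k, G k) := fun m =>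
    MeasurableSet.iUnion fun k => MeasurableSet.iUnion fun _ => hG k
  have hfin : μ (⋃ k, ⋃ _ : 0 ≤ k, G k) ≠ ⊤ :=
    ne_top_of_le_ne_top hB (measure_mono (Set.iUnion_subset fun k => Set.iUnion_subset fun _ =>
      hGB k))
  rw [h1]
  refine ge_of_tendsto' (tendsto_measure_iInter_atTop (fun m => (hmeas m).nullMeasurableSet)
    hanti ⟨0, hfin⟩) fun m => (hc m).trans (measure_mono ?_)
  exact Set.subset_iUnion₂_of_subset m le_rfl le_rfl

lemma measurableSet_approxUnion (P X : Finset ℕ) (ψ : ℕ → ℝ) :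
    MeasurableSet (approxUnion P X ψ) :=
  Finset.measurableSet_biUnion _ fun _ _ => measurableSet_ball

variable {a : ℕ → ℕ}

/-- The approximation radii at denominator `q` coming from differences divisible by `q`. -/
def radiusSet (a : ℕ → ℕ) (q : ℕ) : Set ℝ :=
  {r | ∃ n N, n ∈ posDiff a N ∧ q ∣ n ∧ r = diffWeight a n / n}

/-- The largest approximation radius at denominator `q` coming from the differences. -/
noncomputable def radius (a : ℕ → ℕ) (q : ℕ) : ℝ := sSup (radiusSet a q)

lemma radiusSet_le (ha : ∀ m n, 1 ≤ m → m < n → a m < a n)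
    {q : ℕ} (hq : 0 < q) {r : ℝ} (hr : r ∈ radiusSet a q) : r ≤ 1 / q := by
  obtain ⟨n, N, hn, hqn, rfl⟩ := hr
  have hn0 := pos_of_mem_posDiff ha hn
  have hqn' : (q : ℝ) ≤ n := by exact_mod_cast Nat.le_of_dvd hn0 hqn
  have hq' : (0 : ℝ) < q := by exact_mod_cast hq
  gcongr
  exact diffWeight_le_one ha n

lemma le_radius (ha : ∀ m n, 1 ≤ m → m < n → a m < a n)
    {q n N : ℕ} (hn : n ∈ posDiff a N) (hq : 0 < q) (hqn : q ∣ n) :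
    diffWeight a n / n ≤ radius a q :=
  le_csSup ⟨1 / q, fun _ hr => radiusSet_le ha hq hr⟩ ⟨n, N, hn, hqn, rfl⟩

lemma exists_of_lt_radius {q : ℕ} {t : ℝ} (ht0 : 0 ≤ t) (ht : t < radius a q) :
    ∃ n N, n ∈ posDiff a N ∧ q ∣ n ∧ t < diffWeight a n / n := by
  rcases (radiusSet a q).eq_empty_or_nonempty with h | h
  · rw [radius, h, Real.sSup_empty] at ht
    linarith
  · obtain ⟨r, ⟨n, N, hn, hqn, rfl⟩, hr⟩ := exists_lt_of_lt_csSup h ht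
    exact ⟨n, N, hn, hqn, hr⟩

lemma tendsto_radius (ha : ∀ m n, 1 ≤ m → m < n → a m < a n) :
    Tendsto (radius a) atTop (nhds 0) := by
  refine squeeze_zero' ?_ ?_ tendsto_one_div_atTop_nhds_zero_nat
  · refine Eventually.of_forall fun q => Real.sSup_nonneg fun r hr => ?_
    obtain ⟨n, N, _, _, rfl⟩ := hr
    exact div_nonneg (diffWeight_pos ha n).le (Nat.cast_nonneg n)
  · filter_upwards [eventually_gt_atTop 0] with q hq
    exact Real.sSup_le (fun r hr => radiusSet_le ha hq hr) (by positivity)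

lemma deltaMin_le {n N : ℕ} (hn : n ∈ posDiff a N) (ha : ∀ m n, 1 ≤ m → m < n → a m < a n)
    (α : ℝ) : deltaMin a α N ≤ nint (n * α) := by
  obtain ⟨i, j, h1, h2, h3, h4⟩ := mem_posDiff.1 hn
  apply csInf_le
  · refine ⟨0, ?_⟩
    rintro x ⟨_, _, _, _, _, _, _, rfl⟩
    exact abs_nonneg _
  · refine ⟨j, i, by omega, h3, h1, by omega, by omega, ?_⟩
    rw [← h4, Nat.cast_sub (ha i j h1 h2).le]

lemma frequently_deltaMin_le (ha : ∀ m n, 1 ≤ m → m < n → a m < a n) {α : ℝ}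
    (hα : (α : UnitAddCircle) ∈ addWellApproximable UnitAddCircle (radius a)) :
    ∃ᶠ N in atTop, deltaMin a α N ≤ 1 / (diffCard a N : ℝ) := by
  rw [UnitAddCircle.mem_addWellApproximable_iff] at hα
  rw [frequently_atTop]
  intro M
  obtain ⟨q, hqinf, hq⟩ := hα.exists_gt ((posDiff a M).sup id)
  obtain ⟨b, hb, -, hdist⟩ := hqinf
  obtain ⟨n, N, hn, hqn, hlt⟩ := exists_of_lt_radius (norm_nonneg _) hdist
  have hq0 : 0 < q := by omega
  have hn0 := pos_of_mem_posDiff ha hn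
  have hnq := Nat.le_of_dvd hn0 hqn
  have hnM : n ∉ posDiff a M := fun h => by
    have : n ≤ (posDiff a M).sup id := Finset.le_sup (f := id) h
    omega
  refine ⟨firstIndex a n, (lt_firstIndex hn hnM).le, ?_⟩
  refine (deltaMin_le (mem_posDiff_firstIndex hn) ha α).trans ?_
  have hn0' : (0 : ℝ) < n := by exact_mod_cast hn0
  have hzero : n • (((b : ℝ) / q : ℝ) : UnitAddCircle) = 0 := by
    obtain ⟨k, rfl⟩ := hqn
    have hq0' : (q : ℝ) ≠ 0 := by exact_mod_cast hq0.ne'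
    rw [← AddCircle.coe_nsmul, AddCircle.coe_eq_zero_iff]
    refine ⟨(k * b : ℕ), ?_⟩
    simp only [nsmul_eq_mul, zsmul_eq_mul, mul_one]
    push_cast
    field_simp
  have hnorm : nint (n * α) =
      ‖n • ((α : UnitAddCircle) - (((b : ℝ) / q : ℝ) : UnitAddCircle))‖ := by
    rw [smul_sub, hzero, sub_zero, ← AddCircle.coe_nsmul, UnitAddCircle.norm_eq, nsmul_eq_mul, nint]
  rw [hnorm]
  calc _ ≤ n * ‖(α : UnitAddCircle) - (((b : ℝ) / q : ℝ) : UnitAddCircle)‖ := norm_nsmul_le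
    _ ≤ n * (diffWeight a n / n) := by gcongr
    _ = diffWeight a n := by field_simp

lemma ae_real_of_ae_unitAddCircle {p : UnitAddCircle → Prop} (hp : ∀ᵐ x, p x) :
    ∀ᵐ x : ℝ, p (x : UnitAddCircle) := by
  have h1 : ∀ k : ℤ, ∀ᵐ x : ℝ, x ∈ Set.Ioc (k : ℝ) (k + 1) → p (x : UnitAddCircle) := by
    intro k
    rw [← ae_restrict_iff' measurableSet_Ioc]
    exact (UnitAddCircle.measurePreserving_mk (k : ℝ)).quasiMeasurePreserving.ae hp
  filter_upwards [ae_all_iff.2 h1] with x hx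
  refine hx (⌈x⌉ - 1) ⟨?_, ?_⟩
  · have := Int.ceil_lt_add_one x
    push_cast
    linarith
  · have := Int.le_ceil x
    push_cast
    linarith

lemma exists_coprime_div_eq {b n : ℕ} (hb : b < n) :
    ∃ m q, m < q ∧ gcd m q = 1 ∧ q ∣ n ∧ (m : ℝ) / q = (b : ℝ) / n := by
  have hn : 0 < n := by omega
  have hg : 0 < Nat.gcd b n := Nat.gcd_pos_of_pos_right _ hn
  refine ⟨b / Nat.gcd b n, n / Nat.gcd b n, ?_, Nat.coprime_div_gcd_div_gcd hg,
    Nat.div_dvd_of_dvd (Nat.gcd_dvd_right _ _), ?_⟩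
  · exact Nat.div_lt_div_of_lt_of_dvd (Nat.gcd_dvd_right _ _) hb
  · have hg' : ((Nat.gcd b n : ℕ) : ℝ) ≠ 0 := by exact_mod_cast hg.ne'
    rw [Nat.cast_div (Nat.gcd_dvd_left _ _) hg', Nat.cast_div (Nat.gcd_dvd_right _ _) hg',
      div_div_div_cancel_right₀ hg']

lemma mem_posDiff_of_lt {K n N : ℕ} (hn : n ∈ posDiff a N) (hK : n < K) :
    n ∈ posDiff a ((Finset.range K).sup (firstIndex a)) :=
  posDiff_mono a (Finset.le_sup (Finset.mem_range.2 hK)) (mem_posDiff_firstIndex hn)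

lemma mem_addWellApproximable_of_irrational (ha : ∀ m n, 1 ≤ m → m < n → a m < a n)
    {α : ℝ} (hα : Irrational α)
    (h : ∀ M, ∃ n N b, n ∈ posDiff a N ∧ n ∉ posDiff a M ∧ b < n ∧
      |α - (b : ℝ) / n| < diffWeight a n / n) :
    (α : UnitAddCircle) ∈ addWellApproximable UnitAddCircle (radius a) := by
  rw [UnitAddCircle.mem_addWellApproximable_iff]
  intro hfin
  obtain ⟨F, hF⟩ : ∃ F : Set ℝ, F = ⋃ q ∈ {n : ℕ | ∃ m < n, gcd m n = 1 ∧
    ‖(α : UnitAddCircle) - (((m : ℝ) / n : ℝ) : UnitAddCircle)‖ < radius a n},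
      ⋃ m ∈ Finset.range q, {(m : ℝ) / q} := ⟨_, rfl⟩
  have hFfin : F.Finite := by
    rw [hF]
    refine hfin.biUnion fun q _ => ?_
    exact Set.Finite.biUnion (Finset.finite_toSet _) fun m _ => Set.finite_singleton _
  have hαF : α ∈ Fᶜ := by
    intro hmem
    rw [hF] at hmem
    simp only [Set.mem_iUnion, Set.mem_singleton_iff] at hmem
    obtain ⟨q, _, m, _, hm⟩ := hmem
    refine hα ⟨(m : ℚ) / q, ?_⟩
    rw [hm]
    push_cast
    rfl
  obtain ⟨ε, hε, hball⟩ := Metric.isOpen_iff.1 hFfin.isClosed.isOpen_compl α hαF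
  obtain ⟨K, hK⟩ := exists_nat_one_div_lt hε
  obtain ⟨n, N, b, hn, hnM, hb, hlt⟩ := h ((Finset.range (K + 1)).sup (firstIndex a))
  have hKn : K + 1 ≤ n := by
    by_contra! hlt'
    exact hnM (mem_posDiff_of_lt hn hlt')
  obtain ⟨m, q, hmq, hcop, hqn, heq⟩ := exists_coprime_div_eq hb
  have hKn' : (K : ℝ) + 1 ≤ n := by exact_mod_cast hKn
  have hsmall : |α - (b : ℝ) / n| < ε := by
    refine hlt.trans (lt_of_le_of_lt ?_ hK)
    gcongr
    exact diffWeight_le_one ha n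
  have hmem : (b : ℝ) / n ∈ F := by
    rw [hF]
    simp only [Set.mem_iUnion, Set.mem_singleton_iff]
    refine ⟨q, ⟨m, hmq, hcop, ?_⟩, m, Finset.mem_range.2 hmq, heq.symm⟩
    rw [heq, ← AddCircle.coe_sub]
    refine lt_of_le_of_lt ?_ (hlt.trans_le (le_radius ha hn (by omega) hqn))
    rw [UnitAddCircle.norm_eq]
    simpa using round_le (α - (b : ℝ) / n) 0
  refine hball ?_ hmem
  rw [Metric.mem_ball, dist_comm, Real.dist_eq]
  exact hsmall

lemma ae_mem_addWellApproximable (ha : ∀ m n, 1 ≤ m → m < n → a m < a n) :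
    ∀ᵐ x : UnitAddCircle, x ∈ addWellApproximable UnitAddCircle (radius a) := by
  have : Fact (0 < (1 : ℝ)) := ⟨one_pos⟩
  refine (AddCircle.addWellApproximable_ae_empty_or_univ (radius a)
    (tendsto_radius ha)).resolve_left fun hnull => ?_
  have hnull' := ae_real_of_ae_unitAddCircle hnull
  obtain ⟨c, hc, hblock⟩ := exists_volume_block_ge ha
  choose N P hvol using fun k : ℕ => hblock (k + 2) (by omega)
  obtain ⟨G, hG⟩ : ∃ G : ℕ → Set ℝ, G = fun k =>
    approxUnion (P k) (posDiff a (N k) \ posDiff a (k + 2)) (diffWeight a) := ⟨_, rfl⟩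
  have hmemG : ∀ k α, α ∈ G k → ∃ n b, n ∈ posDiff a (N k) ∧ n ∉ posDiff a (k + 2) ∧ b < n ∧
      |α - (b : ℝ) / n| < diffWeight a n / n := by
    intro k α hα
    rw [hG] at hα
    simp only [approxUnion, Set.mem_iUnion, Finset.mem_sigma, Finset.mem_sdiff] at hα
    obtain ⟨⟨n, b⟩, ⟨hn, hb⟩, hα⟩ := hα
    exact ⟨n, b, hn.1, hn.2, Finset.mem_range.1 (Finset.mem_filter.1 hb).1, hα⟩
  have hsub : ∀ k, G k ⊆ Set.Icc (-1) 2 := by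
    intro k α hα
    obtain ⟨n, b, hn, _, hb, hlt⟩ := hmemG k α hα
    have hn0 : 1 ≤ n := by omega
    have hn0' : (1 : ℝ) ≤ n := by exact_mod_cast hn0
    have h1 : diffWeight a n / n ≤ 1 := by
      rw [div_le_one (by linarith)]
      exact (diffWeight_le_one ha n).trans hn0'
    have h2 : (b : ℝ) / n ≤ 1 := by
      rw [div_le_one (by linarith)]
      exact_mod_cast hb.le
    have h3 : 0 ≤ (b : ℝ) / n := by positivity
    obtain ⟨h4, h5⟩ := abs_lt.1 hlt
    constructor <;> linarith
  have hlow : ENNReal.ofReal c ≤ volume {x : ℝ | ∃ᶠ k in atTop, x ∈ G k} := by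
    refine le_measure_frequently (B := Set.Icc (-1) 2) ?_ ?_ hsub fun k => ?_
    · intro k
      rw [hG]
      exact measurableSet_approxUnion _ _ _
    · exact measure_Icc_lt_top.ne
    · refine ENNReal.ofReal_le_of_le_toReal ?_
      rw [hG]
      exact hvol k
  have hirr : ∀ᵐ x : ℝ, Irrational x := by
    have : (Set.range ((↑) : ℚ → ℝ)).Countable := Set.countable_range _
    exact this.ae_notMem volume
  have hzero : volume {x : ℝ | ∃ᶠ k in atTop, x ∈ G k} = 0 := by
    have : ∀ᵐ x : ℝ, ¬ ∃ᶠ k in atTop, x ∈ G k := by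
      filter_upwards [hnull', hirr] with x hx hxirr hfreq
      refine hx (mem_addWellApproximable_of_irrational ha hxirr fun M => ?_)
      obtain ⟨k, hk, hxk⟩ := frequently_atTop.1 hfreq M
      obtain ⟨n, b, hn, hnk, hb, hlt⟩ := hmemG k x hxk
      exact ⟨n, N k, b, hn, fun h => hnk (posDiff_mono a (by omega) h), hb, hlt⟩
    rw [ae_iff] at this
    simpa only [not_not] using this
  rw [hzero, nonpos_iff_eq_zero, ENNReal.ofReal_eq_zero] at hlow
  linarith

end ZeroOne

theorem stmt1 (a : ℕ → ℕ)
    (hpos : ∀ n, 1 ≤ n → 0 < a n)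
    (hmono : ∀ m n, 1 ≤ m → m < n → a m < a n) :
    ∀ᵐ α ∂(volume : Measure ℝ), α ∈ Set.Icc (0 : ℝ) 1 →
      ∃ᶠ N in atTop, deltaMin a α N ≤ 1 / (diffCard a N : ℝ) := by
  filter_upwards [ae_real_of_ae_unitAddCircle (ae_mem_addWellApproximable hmono)] with α hα _
  exact frequently_deltaMin_le hmono hα
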